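/- There exists a continuous function h_0 ∈ C(𝕋^5, ℂ) with h_0(0) = 1 and Σ_{k=0}^{2} |h_0(x − w_k)|² = 1 for all x ∈ 𝕋^5 (i.e. h_0 is a normalized continuous low-pass filter for the order-3 group F), such that there do NOT exist continuous functions h_1, h_2 ∈ C(𝕋^5, ℂ) with ⟨h_j, h_k⟩ equal to the constant function δ_{jk} for all 0 ≤ j, k ≤ 2. That is, h_0 admits no corresponding family of continuous high-pass filters; in particular the condition 2q − 1 > n in the existence theorem is sharp for n = 5, q = 3. -/

import Mathlib

open scoped Real ComplexConjugate
noncomputable section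

/-- The `n`-torus `ℝ^n/ℤ^n`. -/
abbrev Torus (n : ℕ) : Type := Fin n → AddCircle (1 : ℝ)

/-- The elements `w_0, w_1, w_2` of the order-3 subgroup of `𝕋^5`: the classes of
`(k/3, 0, 0, 0, 0)` for `k = 0, 1, 2`. -/
def w3 (k : Fin 3) : Torus 5 :=
  fun i => if i = 0 then (((k : ℝ) / 3 : ℝ) : AddCircle (1 : ℝ)) else 0

namespace Lowpass

section Fourier

open UnitAddTorus MeasureTheory

local instance : MeasureSpace UnitAddCircle := ⟨AddCircle.haarAddCircle⟩

local instance : Measure.IsAddHaarMeasure (volume : Measure UnitAddCircle) :=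
  inferInstanceAs (Measure.IsAddHaarMeasure AddCircle.haarAddCircle)

local instance : IsProbabilityMeasure (volume : Measure UnitAddCircle) :=
  inferInstanceAs (IsProbabilityMeasure AddCircle.haarAddCircle)

/-- Continuous complex functions on the five-dimensional torus. -/
abbrev CT : Type := C(Torus 5, ℂ)

lemma integrable_CT (f : CT) :
    Integrable (fun x => f x) (volume : Measure (UnitAddTorus (Fin 5))) :=
  f.continuous.integrable_of_hasCompactSupport (HasCompactSupport.of_compactSpace _)

/-- The mean value of a continuous function on the torus. -/
def mean : CT →ₗ[ℂ] ℂ where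
  toFun f := ∫ x : UnitAddTorus (Fin 5), f x
  map_add' f g := by
    simpa using integral_add (integrable_CT f) (integrable_CT g)
  map_smul' c f := by
    simp only [ContinuousMap.smul_apply, RingHom.id_apply]
    exact integral_smul c _

lemma mean_star (f : CT) : mean (star f) = conj (mean f) := by
  simp only [mean, LinearMap.coe_mk, AddHom.coe_mk, ContinuousMap.star_apply]
  exact integral_conj

/-- The Fourier coefficient of index `n`. -/
def fc (n : Fin 5 → ℤ) : CT →ₗ[ℂ] ℂ := mean ∘ₗ LinearMap.mulLeft ℂ (mFourier (-n))

lemma fc_apply (n : Fin 5 → ℤ) (f : CT) : fc n f = mean (mFourier (-n) * f) := rfl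

lemma mFourier_add' (m n : Fin 5 → ℤ) :
    (mFourier (m + n) : CT) = mFourier m * mFourier n := by
  ext x; exact mFourier_add

lemma star_mFourier (m : Fin 5 → ℤ) : star (mFourier m : CT) = mFourier (-m) := by
  ext x; exact mFourier_neg.symm

lemma fc_star (n : Fin 5 → ℤ) (f : CT) : fc n (star f) = conj (fc (-n) f) := by
  rw [fc_apply, fc_apply, ← mean_star, star_mul', star_mFourier, neg_neg]

lemma fc_mFourier_mul (m n : Fin 5 → ℤ) (f : CT) : fc n (mFourier m * f) = fc (n - m) f := by
  rw [fc_apply, fc_apply, ← mul_assoc, ← mFourier_add', neg_sub, neg_add_eq_sub]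

lemma hasSum_sq_fc (f : CT) : HasSum (fun n => ‖fc n f‖ ^ 2) (mean (star f * f)).re := by
  have h := hasSum_sq_mFourierCoeff (ContinuousMap.toLp (E := ℂ) 2 volume ℂ f)
  convert h using 1
  · funext n
    exact congrArg (fun z : ℂ => ‖z‖ ^ 2) (mFourierCoeff_toLp f n).symm
  simp only [mean, LinearMap.coe_mk, AddHom.coe_mk]
  have h1 : ∫ x : UnitAddTorus (Fin 5), (star f * f) x =
      ((∫ x : UnitAddTorus (Fin 5), ‖f x‖ ^ 2 : ℝ) : ℂ) := by
    rw [← integral_complex_ofReal]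
    congr 1
    ext x
    simp [← Complex.normSq_eq_conj_mul_self, Complex.normSq_eq_norm_sq]
  rw [h1, Complex.ofReal_re]
  apply integral_congr_ae
  filter_upwards [ContinuousMap.coeFn_toLp (E := ℂ) (p := 2) (𝕜 := ℂ)
    (volume : Measure (UnitAddTorus (Fin 5))) f] with x hx
  rw [hx]

lemma mean_nonneg (f : CT) (h : ∀ x, 0 ≤ (f x).re) : 0 ≤ (mean f).re := by
  have : (mean f).re = ∫ x : UnitAddTorus (Fin 5), (f x).re :=
    (integral_re (integrable_CT f)).symm
  rw [this]
  exact integral_nonneg h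

lemma fc_mFourier (m n : Fin 5 → ℤ) : fc n (mFourier m) = if n = m then 1 else 0 := by
  have h := orthonormal_iff_ite.mp (orthonormal_mFourier (d := Fin 5)) n m
  rw [← h, ContinuousMap.inner_toLp]
  simp only [← mFourier_neg]
  rw [fc_apply]
  simp only [mean, LinearMap.coe_mk, AddHom.coe_mk]
  congr 1
  ext x
  exact mul_comm _ _

end Fourier

section Toeplitz

open UnitAddTorus MeasureTheory
open Matrix

variable {σ : Type*} [Fintype σ]

/-- The squared Euclidean norm of a finite family of complex numbers. -/
def nsq {ι : Type*} [Fintype ι] (v : ι → ℂ) : ℝ := ∑ i, ‖v i‖ ^ 2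

lemma nsq_nonneg {ι : Type*} [Fintype ι] (v : ι → ℂ) : 0 ≤ nsq v :=
  Finset.sum_nonneg fun _ _ => sq_nonneg _

lemma nsq_eq {ι : Type*} [Fintype ι] (v : ι → ℂ) : nsq v = (star v ⬝ᵥ v).re := by
  rw [nsq, dotProduct, Complex.re_sum]
  refine Finset.sum_congr rfl fun i _ => ?_
  rw [Pi.star_apply, RCLike.star_def, ← Complex.normSq_eq_conj_mul_self, Complex.ofReal_re,
    Complex.normSq_eq_norm_sq]

lemma nsq_eq_zero {ι : Type*} [Fintype ι] {v : ι → ℂ} (h : nsq v ≤ 0) : v = 0 := by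
  have h0 := (Finset.sum_eq_zero_iff_of_nonneg fun i _ => sq_nonneg ‖v i‖).mp
    (le_antisymm h (nsq_nonneg v))
  ext i
  simpa using h0 i (Finset.mem_univ i)

lemma nsq_mulVec {ι : Type*} [Fintype ι] (M : Matrix ι ι ℂ) (v : ι → ℂ) :
    nsq (M *ᵥ v) = (star v ⬝ᵥ ((Mᴴ * M) *ᵥ v)).re := by
  rw [nsq_eq, star_mulVec, ← dotProduct_mulVec, mulVec_mulVec]

lemma nsq_smul {ι : Type*} [Fintype ι] (c : ℂ) (v : ι → ℂ) : nsq (c • v) = ‖c‖ ^ 2 * nsq v := by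
  simp [nsq, mul_pow, Finset.mul_sum]

lemma nsq_add_le {ι : Type*} [Fintype ι] (v w : ι → ℂ) :
    nsq (v + w) ≤ 2 * nsq v + 2 * nsq w := by
  simp only [nsq, Finset.mul_sum, ← Finset.sum_add_distrib]
  refine Finset.sum_le_sum fun i _ => ?_
  have h := norm_add_le (v i) (w i)
  have h2 := pow_le_pow_left₀ (norm_nonneg _) h 2
  rw [Pi.add_apply]
  nlinarith [sq_nonneg (‖v i‖ - ‖w i‖)]

lemma neg_nsq_le_re_dotProduct {ι : Type*} [Fintype ι] (v w : ι → ℂ) :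
    -(nsq v + nsq w) ≤ 2 * (star v ⬝ᵥ w).re := by
  have h := nsq_nonneg (v + w)
  have h2 : nsq (v + w) = nsq v + nsq w + 2 * (star v ⬝ᵥ w).re := by
    simp only [nsq, dotProduct, Complex.re_sum, Finset.mul_sum, ← Finset.sum_add_distrib]
    refine Finset.sum_congr rfl fun i _ => ?_
    simp only [← Complex.normSq_eq_norm_sq, Complex.normSq_apply, Pi.add_apply, Complex.add_re,
      Complex.add_im, Complex.mul_re, Pi.star_apply, RCLike.star_def, Complex.conj_re,
      Complex.conj_im]
    ring
  linarith

lemma nsq_mulVec_le {ι : Type*} [Fintype ι] (M : Matrix ι ι ℂ) (v : ι → ℂ) :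
    nsq (M *ᵥ v) ≤ (∑ i, ∑ j, ‖M i j‖ ^ 2) * nsq v := by
  rw [nsq, Finset.sum_mul]
  refine Finset.sum_le_sum fun i _ => ?_
  have h1 : ‖(M *ᵥ v) i‖ ≤ ∑ j, ‖M i j‖ * ‖v j‖ := by
    refine (norm_sum_le _ _).trans (le_of_eq ?_)
    simp
  exact (pow_le_pow_left₀ (norm_nonneg _) h1 2).trans (Finset.sum_mul_sq_le_sq_mul_sq _ _ _)

/-- Evaluation of a matrix of functions at a point. -/
def evalAt {m n : Type*} (F : Matrix m n CT) (x : Torus 5) : Matrix m n ℂ := F.map (· x)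

@[simp] lemma evalAt_apply {m n : Type*} (F : Matrix m n CT) (x : Torus 5) (s : m) (t : n) :
    evalAt F x s t = F s t x := rfl

lemma evalAt_mul {l m n : Type*} [Fintype m] (F : Matrix l m CT) (G : Matrix m n CT) (x : Torus 5) :
    evalAt (F * G) x = evalAt F x * evalAt G x := by
  ext s t
  simp [mul_apply, ContinuousMap.coe_sum, Finset.sum_apply]

omit [Fintype σ] in
lemma evalAt_one [DecidableEq σ] (x : Torus 5) : evalAt (1 : Matrix σ σ CT) x = 1 := by
  ext s t
  simp only [evalAt_apply, one_apply]
  split_ifs <;> simp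

lemma nsq_evalAt_le (F : Matrix σ σ CT) (x : Torus 5) (v : σ → ℂ) :
    nsq (evalAt F x *ᵥ v) ≤ (∑ i, ∑ j, ‖F i j‖ ^ 2) * nsq v := by
  refine (nsq_mulVec_le _ _).trans (mul_le_mul_of_nonneg_right ?_ (nsq_nonneg v))
  gcongr with i _ j _
  exact (F i j).norm_coe_le_norm x

/-- The mean square of a finite family of functions. -/
def msq (φ : σ → CT) : ℝ := ∑ s, (mean (star (φ s) * φ s)).re

lemma hasSum_msq (φ : σ → CT) : HasSum (fun n => ∑ s, ‖fc n (φ s)‖ ^ 2) (msq φ) :=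
  hasSum_sum fun s _ => hasSum_sq_fc (φ s)

lemma msq_mono {φ ψ : σ → CT} {C : ℝ} (h : ∀ x, nsq (fun s => φ s x) ≤ C * nsq fun s => ψ s x) :
    msq φ ≤ C * msq ψ := by
  have key : C * msq ψ - msq φ =
      (mean ((C : ℂ) • ∑ s, star (ψ s) * ψ s - ∑ s, star (φ s) * φ s)).re := by
    simp [msq, map_sum, Complex.re_sum]
  rw [← sub_nonneg, key]
  refine mean_nonneg _ fun x => ?_
  have hx := h x
  rw [nsq_eq, nsq_eq] at hx
  simp only [dotProduct, Pi.star_apply] at hx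
  simpa [ContinuousMap.coe_sum, Finset.sum_apply] using hx

/-- The index set of the Fourier modes of size at most `ρ`. -/
abbrev Box (ρ : ℕ) : Type := Fin 5 → Fin (2 * ρ + 1)

/-- The frequency of an element of the box. -/
def freq {ρ : ℕ} (k : Box ρ) : Fin 5 → ℤ := fun j => (k j : ℤ) - ρ

lemma freq_injective {ρ : ℕ} : Function.Injective (freq (ρ := ρ)) := fun k l h => by
  ext j
  have := congrFun h j
  simp only [freq] at this
  omega

lemma exists_lt_of_notMem_range {ρ : ℕ} {n : Fin 5 → ℤ} (h : n ∉ Set.range (freq (ρ := ρ))) :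
    ∃ j, (ρ : ℤ) < |n j| := by
  by_contra! hn
  refine h ⟨fun j => ⟨(n j + ρ).toNat, ?_⟩, ?_⟩
  · have := abs_le.mp (hn j)
    omega
  · ext j
    have := abs_le.mp (hn j)
    simp only [freq]
    omega

/-- The trigonometric polynomials with given coefficients. -/
def synth {ρ : ℕ} (v : Box ρ × σ → ℂ) (s : σ) : CT := ∑ k, v (k, s) • (mFourier (freq k) : CT)

omit [Fintype σ] in
lemma fc_mul_synth {ρ : ℕ} (v : Box ρ × σ → ℂ) (s : σ) (n : Fin 5 → ℤ) (f : CT) :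
    fc n (f * synth v s) = ∑ k, fc (n - freq k) f * v (k, s) := by
  rw [synth, Finset.mul_sum, map_sum]
  refine Finset.sum_congr rfl fun k _ => ?_
  rw [mul_smul_comm, map_smul, mul_comm f, fc_mFourier_mul, smul_eq_mul, mul_comm]

lemma msq_synth {ρ : ℕ} (v : Box ρ × σ → ℂ) : msq (synth v) = nsq v := by
  have h := hasSum_msq (synth v)
  have hz : ∀ n ∉ Set.range (freq (ρ := ρ)), ∑ s, ‖fc n (synth v s)‖ ^ 2 = 0 := fun n hn => by
    refine Finset.sum_eq_zero fun s _ => ?_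
    have : fc n (synth v s) = 0 := by
      rw [synth, map_sum]
      refine Finset.sum_eq_zero fun k _ => ?_
      rw [map_smul, fc_mFourier, if_neg (fun e => hn ⟨k, e.symm⟩), smul_zero]
    rw [this, norm_zero, zero_pow two_ne_zero]
  rw [← freq_injective.hasSum_iff hz] at h
  rw [h.unique (hasSum_fintype _), nsq, Fintype.sum_prod_type]
  refine (Finset.sum_congr rfl fun k _ => Finset.sum_congr rfl fun s _ => ?_).symm
  rw [synth, map_sum, Finset.sum_eq_single k]
  · rw [map_smul, fc_mFourier, if_pos rfl, smul_eq_mul, mul_one]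
  · intro l _ hl
    rw [map_smul, fc_mFourier, if_neg (fun e => hl (freq_injective e).symm), smul_zero]
  · simp

/-- The truncated Toeplitz matrix of a matrix-valued symbol. -/
def toep (ρ : ℕ) (F : Matrix σ σ CT) : Matrix (Box ρ × σ) (Box ρ × σ) ℂ :=
  of fun p q => fc (freq p.1 - freq q.1) (F p.2 q.2)

/-- The action of a matrix of functions on a vector of functions. -/
def act (F : Matrix σ σ CT) (φ : σ → CT) (s : σ) : CT := ∑ t, F s t * φ t

lemma fc_act_synth {ρ : ℕ} (F : Matrix σ σ CT) (v : Box ρ × σ → ℂ) (s : σ) (n : Fin 5 → ℤ) :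
    fc n (act F (synth v) s) = ∑ q : Box ρ × σ, fc (n - freq q.1) (F s q.2) * v q := by
  rw [act, map_sum, Fintype.sum_prod_type_right]
  exact Finset.sum_congr rfl fun t _ => fc_mul_synth _ _ _ _

lemma toep_mulVec {ρ : ℕ} (F : Matrix σ σ CT) (v : Box ρ × σ → ℂ) (k : Box ρ) (s : σ) :
    (toep ρ F *ᵥ v) (k, s) = fc (freq k) (act F (synth v) s) := by
  rw [fc_act_synth]
  rfl

lemma act_apply (F : Matrix σ σ CT) (φ : σ → CT) (x : Torus 5) :
    (fun s => act F φ s x) = evalAt F x *ᵥ fun s => φ s x := by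
  ext s
  simp [act, mulVec, dotProduct, ContinuousMap.coe_sum, Finset.sum_apply]

lemma nsq_toep {ρ : ℕ} (F : Matrix σ σ CT) (v : Box ρ × σ → ℂ) :
    nsq (toep ρ F *ᵥ v) = ∑ k : Box ρ, ∑ s, ‖fc (freq k) (act F (synth v) s)‖ ^ 2 := by
  rw [nsq, Fintype.sum_prod_type]
  simp only [toep_mulVec]

lemma msq_act_synth_le {ρ : ℕ} {F : Matrix σ σ CT} {C : ℝ}
    (hF : ∀ x v, nsq (evalAt F x *ᵥ v) ≤ C * nsq v) (v : Box ρ × σ → ℂ) :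
    msq (act F (synth v)) ≤ C * nsq v := by
  rw [← msq_synth v]
  refine msq_mono fun x => ?_
  rw [act_apply]
  exact hF x _

lemma nsq_toep_le {ρ : ℕ} {F : Matrix σ σ CT} {C : ℝ}
    (hF : ∀ x v, nsq (evalAt F x *ᵥ v) ≤ C * nsq v) (v : Box ρ × σ → ℂ) :
    nsq (toep ρ F *ᵥ v) ≤ C * nsq v := by
  refine le_trans ?_ (msq_act_synth_le hF v)
  rw [nsq_toep]
  have h := hasSum_msq (act F (synth v))
  have h2 := sum_le_hasSum (Finset.univ.map ⟨freq (ρ := ρ), freq_injective⟩)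
    (fun n _ => Finset.sum_nonneg fun s _ => sq_nonneg _) h
  simpa using h2

/-- The modes within distance `r` of the boundary of the box. -/
def IsFar (r : ℕ) {ρ : ℕ} (k : Box ρ) : Prop := ∃ j, (ρ : ℤ) - r < |freq k j|

open Classical in
/-- The part of a vector supported near the boundary of the box. -/
def farPart (r : ℕ) {ρ : ℕ} (v : Box ρ × σ → ℂ) : Box ρ × σ → ℂ :=
  fun p => if IsFar r p.1 then v p else 0

/-- All Fourier modes of `f` have size at most `r`. -/
def BandLimited (r : ℕ) (f : CT) : Prop := ∀ n : Fin 5 → ℤ, (∃ j, (r : ℤ) < |n j|) → fc n f = 0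

lemma nsq_le_toep {ρ r : ℕ} {F : Matrix σ σ CT} {b C : ℝ} (hb : 0 ≤ b)
    (hFb : ∀ x v, nsq v ≤ b * nsq (evalAt F x *ᵥ v))
    (hF : ∀ x v, nsq (evalAt F x *ᵥ v) ≤ C * nsq v) (hr : ∀ s t, BandLimited r (F s t))
    (v : Box ρ × σ → ℂ) :
    nsq v ≤ b * (nsq (toep ρ F *ᵥ v) + C * nsq (farPart r v)) := by
  classical
  have h1 : nsq v ≤ b * msq (act F (synth v)) := by
    rw [← msq_synth v]
    refine msq_mono fun x => ?_
    rw [act_apply]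
    exact hFb x _
  refine h1.trans (mul_le_mul_of_nonneg_left ?_ hb)
  refine le_trans ?_ (add_le_add le_rfl (msq_act_synth_le hF (farPart r v)))
  set a : (Fin 5 → ℤ) → ℝ := fun n => ∑ s, ‖fc n (act F (synth v) s)‖ ^ 2 with ha
  have h2 : HasSum (Set.indicator (Set.range (freq (ρ := ρ))) a) (nsq (toep ρ F *ᵥ v)) := by
    rw [nsq_toep, ← freq_injective.hasSum_iff]
    · convert hasSum_fintype _ using 2 with k
      simp [ha]
    · intro n hn
      exact Set.indicator_of_notMem hn _
  refine hasSum_le (fun n => ?_) (hasSum_msq _) (h2.add (hasSum_msq (act F (synth (farPart r v)))))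
  by_cases hn : n ∈ Set.range (freq (ρ := ρ))
  · rw [Set.indicator_of_mem hn]
    exact le_add_of_nonneg_right (Finset.sum_nonneg fun s _ => sq_nonneg _)
  · rw [Set.indicator_of_notMem hn, zero_add]
    refine le_of_eq (Finset.sum_congr rfl fun s _ => ?_)
    rw [fc_act_synth, fc_act_synth]
    congr 2
    refine Finset.sum_congr rfl fun q _ => ?_
    by_cases hq : IsFar r q.1
    · simp [farPart, hq]
    · obtain ⟨j, hj⟩ := exists_lt_of_notMem_range hn
      rw [hr s q.2 (n - freq q.1) ⟨j, ?_⟩, zero_mul, zero_mul]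
      have : |freq q.1 j| ≤ ρ - r := by
        by_contra! h
        exact hq ⟨j, h⟩
      have h3 := abs_sub_abs_le_abs_sub (n j) (freq q.1 j)
      rw [Pi.sub_apply]
      omega

end Toeplitz

section Localizer

open UnitAddTorus MeasureTheory
open Matrix

variable {σ : Type*} [Fintype σ]

lemma sum_sq_of_anticommute {R ι : Type*} [Ring R] (s : Finset ι) (x : ι → R)
    (h : ∀ i ∈ s, ∀ j ∈ s, i ≠ j → x i * x j + x j * x i = 0) :
    (∑ i ∈ s, x i) * ∑ i ∈ s, x i = ∑ i ∈ s, x i * x i := by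
  classical
  induction s using Finset.induction_on with
  | empty => simp
  | insert a s ha ih =>
    have h1 : x a * ∑ i ∈ s, x i + (∑ i ∈ s, x i) * x a = 0 := by
      rw [Finset.mul_sum, Finset.sum_mul, ← Finset.sum_add_distrib]
      refine Finset.sum_eq_zero fun i hi => h _ (Finset.mem_insert_self _ _) _
        (Finset.mem_insert_of_mem hi) ?_
      rintro rfl
      exact ha hi
    have h2 := ih fun i hi j hj => h i (Finset.mem_insert_of_mem hi) j (Finset.mem_insert_of_mem hj)
    rw [Finset.sum_insert ha, Finset.sum_insert ha, ← h2, add_mul, mul_add, mul_add,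
      add_assoc, ← add_assoc (x a * ∑ i ∈ s, x i), h1, zero_add]

/-- Hermitian anticommuting square roots of one. -/
structure IsClifford {ι : Type*} [DecidableEq σ] (Γ : ι → Matrix σ σ ℂ) : Prop where
  herm : ∀ j, (Γ j)ᴴ = Γ j
  sq : ∀ j, Γ j * Γ j = 1
  anti : ∀ i j, i ≠ j → Γ i * Γ j + Γ j * Γ i = 0

open scoped Kronecker

/-- The truncated Dirac operator, in the Fourier basis. -/
def dirac (ρ : ℕ) (Γ : Fin 5 → Matrix σ σ ℂ) : Matrix (Box ρ × σ) (Box ρ × σ) ℂ :=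
  ∑ j, diagonal (fun k : Box ρ => (freq k j : ℂ)) ⊗ₖ Γ j

omit [Fintype σ] in
lemma dirac_apply {ρ : ℕ} (Γ : Fin 5 → Matrix σ σ ℂ) (p q : Box ρ × σ) :
    dirac ρ Γ p q = if p.1 = q.1 then ∑ j, (freq p.1 j : ℂ) * Γ j p.2 q.2 else 0 := by
  simp only [dirac, Matrix.sum_apply, kroneckerMap_apply, diagonal_apply]
  split_ifs <;> simp

variable [DecidableEq σ]

lemma dirac_isHermitian {ρ : ℕ} {Γ : Fin 5 → Matrix σ σ ℂ} (hΓ : IsClifford Γ) :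
    (dirac ρ Γ).IsHermitian := by
  rw [IsHermitian, dirac, conjTranspose_sum]
  refine Finset.sum_congr rfl fun j _ => ?_
  rw [conjTranspose_kronecker, hΓ.herm, diagonal_conjTranspose]
  congr
  ext k
  simp

lemma dirac_mul_self {ρ : ℕ} {Γ : Fin 5 → Matrix σ σ ℂ} (hΓ : IsClifford Γ) :
    dirac ρ Γ * dirac ρ Γ =
      diagonal fun p : Box ρ × σ => ∑ j, (freq p.1 j : ℂ) * (freq p.1 j : ℂ) := by
  rw [dirac, sum_sq_of_anticommute]
  · simp_rw [← mul_kronecker_mul, hΓ.sq, diagonal_mul_diagonal]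
    ext p q
    simp only [Matrix.sum_apply, kroneckerMap_apply, diagonal_apply, one_apply, Prod.ext_iff]
    by_cases h1 : p.1 = q.1 <;> by_cases h2 : p.2 = q.2 <;> simp [h1, h2]
  · intro i _ j _ hij
    rw [← mul_kronecker_mul, ← mul_kronecker_mul, diagonal_mul_diagonal, diagonal_mul_diagonal]
    simp_rw [mul_comm (freq _ j : ℂ)]
    rw [← kronecker_add, hΓ.anti i j hij, kronecker_zero]

lemma nsq_dirac {ρ : ℕ} {Γ : Fin 5 → Matrix σ σ ℂ} (hΓ : IsClifford Γ) (v : Box ρ × σ → ℂ) :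
    nsq (dirac ρ Γ *ᵥ v) = ∑ p, (∑ j, (freq p.1 j : ℝ) ^ 2) * ‖v p‖ ^ 2 := by
  rw [nsq_mulVec, (dirac_isHermitian hΓ).eq, dirac_mul_self hΓ, dotProduct, Complex.re_sum]
  refine Finset.sum_congr rfl fun p _ => ?_
  have : (∑ j, (freq p.1 j : ℂ) * (freq p.1 j : ℂ)) = ((∑ j, (freq p.1 j : ℝ) ^ 2 : ℝ) : ℂ) := by
    push_cast
    simp_rw [sq]
  rw [mulVec_diagonal, this, mul_left_comm, Complex.re_ofReal_mul, Pi.star_apply, RCLike.star_def,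
    ← Complex.normSq_eq_conj_mul_self, Complex.ofReal_re, Complex.normSq_eq_norm_sq]

lemma le_nsq_dirac {ρ r : ℕ} (hr : r ≤ ρ) {Γ : Fin 5 → Matrix σ σ ℂ} (hΓ : IsClifford Γ)
    (v : Box ρ × σ → ℂ) :
    ((ρ : ℝ) - r) ^ 2 * nsq (farPart r v) ≤ nsq (dirac ρ Γ *ᵥ v) := by
  rw [nsq_dirac hΓ, nsq, Finset.mul_sum]
  refine Finset.sum_le_sum fun p _ => ?_
  have h0 : 0 ≤ ∑ j, (freq p.1 j : ℝ) ^ 2 := Finset.sum_nonneg fun _ _ => sq_nonneg _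
  by_cases hp : IsFar r p.1
  · rw [farPart, if_pos hp]
    refine mul_le_mul_of_nonneg_right ?_ (sq_nonneg _)
    obtain ⟨j, hj⟩ := hp
    refine le_trans ?_ (Finset.single_le_sum (f := fun j => (freq p.1 j : ℝ) ^ 2)
      (fun _ _ => sq_nonneg _) (Finset.mem_univ j))
    rw [← sq_abs (freq p.1 j : ℝ)]
    have h1 : (0 : ℝ) ≤ (ρ : ℝ) - r := sub_nonneg.mpr (by exact_mod_cast hr)
    refine pow_le_pow_left₀ h1 ?_ 2
    exact_mod_cast hj.le
  · rw [farPart, if_neg hp]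
    simpa using mul_nonneg h0 (sq_nonneg _)

omit [Fintype σ] [DecidableEq σ] in
lemma toep_isHermitian {ρ : ℕ} {F : Matrix σ σ CT} (hF : ∀ x, (evalAt F x).IsHermitian) :
    (toep ρ F).IsHermitian := by
  ext p q
  have h : F p.2 q.2 = star (F q.2 p.2) := by
    ext x
    exact ((hF x).apply p.2 q.2).symm
  rw [conjTranspose_apply, toep, of_apply, of_apply, h, fc_star, neg_sub]
  rfl

omit [Fintype σ] [DecidableEq σ] in
lemma toep_add (ρ : ℕ) (F G : Matrix σ σ CT) : toep ρ (F + G) = toep ρ F + toep ρ G := by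
  ext p q
  simp [toep]

/-- `f'` is, up to a constant, the `j`-th partial derivative of `f`. -/
def HasFourierDeriv (j : Fin 5) (f f' : CT) : Prop := ∀ n, fc n f' = n j * fc n f

omit [DecidableEq σ] in
lemma dirac_mul_toep_add {ρ : ℕ} {Γ : Fin 5 → Matrix σ σ ℂ} {F : Matrix σ σ CT}
    (hΓF : ∀ j x, Γ j * evalAt F x + evalAt F x * Γ j = 0)
    {F' : Fin 5 → Matrix σ σ CT} (hF' : ∀ j s t, HasFourierDeriv j (F s t) (F' j s t)) :
    dirac ρ Γ * toep ρ F + toep ρ F * dirac ρ Γ =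
      toep ρ (of fun s t => ∑ j, ∑ u, Γ j s u • F' j u t) := by
  ext p q
  have h1 : (dirac ρ Γ * toep ρ F) p q =
      ∑ j, ∑ u, (freq p.1 j : ℂ) * (Γ j p.2 u * fc (freq p.1 - freq q.1) (F u q.2)) := by
    rw [mul_apply, Fintype.sum_prod_type, Finset.sum_eq_single p.1]
    · simp only [dirac_apply, if_true, Finset.sum_mul, toep, of_apply]
      rw [Finset.sum_comm]
      simp only [mul_assoc]
    · intro k _ hk
      simp [dirac_apply, hk.symm]
    · simp
  have h2 : (toep ρ F * dirac ρ Γ) p q =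
      ∑ j, (freq q.1 j : ℂ) * ∑ u, Γ j u q.2 * fc (freq p.1 - freq q.1) (F p.2 u) := by
    rw [mul_apply, Fintype.sum_prod_type, Finset.sum_eq_single q.1]
    · simp only [dirac_apply, if_true, Finset.mul_sum, toep, of_apply]
      rw [Finset.sum_comm]
      refine Finset.sum_congr rfl fun j _ => Finset.sum_congr rfl fun u _ => by ring
    · intro k _ hk
      simp [dirac_apply, hk]
    · simp
  have h3 : ∀ j, ∑ u, Γ j u q.2 * fc (freq p.1 - freq q.1) (F p.2 u) =
      -∑ u, Γ j p.2 u * fc (freq p.1 - freq q.1) (F u q.2) := by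
    intro j
    have h : ∑ u, Γ j p.2 u • F u q.2 + ∑ u, Γ j u q.2 • F p.2 u = 0 := by
      ext x
      have := congrFun (congrFun (hΓF j x) p.2) q.2
      simp only [Matrix.add_apply, mul_apply, evalAt_apply, Matrix.zero_apply] at this
      simp only [ContinuousMap.add_apply, ContinuousMap.coe_sum, Finset.sum_apply,
        ContinuousMap.smul_apply, smul_eq_mul, ContinuousMap.zero_apply]
      rw [← this]
      simp_rw [mul_comm (F p.2 _ x)]
    have h' := congrArg (fc (freq p.1 - freq q.1)) h
    simp only [map_add, map_sum, map_smul, smul_eq_mul, map_zero] at h'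
    exact eq_neg_of_add_eq_zero_right h'
  rw [Matrix.add_apply, h1, h2]
  simp only [toep, of_apply, map_sum, map_smul, smul_eq_mul, hF' _ _ _ _, h3]
  rw [← Finset.sum_add_distrib]
  refine Finset.sum_congr rfl fun j _ => ?_
  rw [mul_neg, Finset.mul_sum, ← sub_eq_add_neg, ← Finset.sum_sub_distrib]
  refine Finset.sum_congr rfl fun u _ => ?_
  rw [Pi.sub_apply]
  push_cast
  ring

/-- The spectral localizer of a symbol. -/
def localizer (ρ : ℕ) (lam : ℝ) (Γ : Fin 5 → Matrix σ σ ℂ) (F : Matrix σ σ CT) :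
    Matrix (Box ρ × σ) (Box ρ × σ) ℂ := dirac ρ Γ + (lam : ℂ) • toep ρ F

lemma localizer_isHermitian {ρ : ℕ} {lam : ℝ} {Γ : Fin 5 → Matrix σ σ ℂ} {F : Matrix σ σ CT}
    (hΓ : IsClifford Γ) (hF : ∀ x, (evalAt F x).IsHermitian) :
    (localizer ρ lam Γ F).IsHermitian := by
  refine (dirac_isHermitian hΓ).add ?_
  rw [IsHermitian, conjTranspose_smul, (toep_isHermitian hF).eq, RCLike.star_def,
    Complex.conj_ofReal]

lemma det_localizer_add_ne_zero {Γ : Fin 5 → Matrix σ σ ℂ} (hΓ : IsClifford Γ) {F : Matrix σ σ CT}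
    (hF : ∀ x, (evalAt F x).IsHermitian) (hΓF : ∀ j x, Γ j * evalAt F x + evalAt F x * Γ j = 0)
    {F' : Fin 5 → Matrix σ σ CT} (hF' : ∀ j s t, HasFourierDeriv j (F s t) (F' j s t))
    {r : ℕ} (hr : ∀ s t, BandLimited r (F s t)) {b : ℝ} (hb : 0 < b)
    (hFb : ∀ x v, nsq v ≤ b * nsq (evalAt F x *ᵥ v)) :
    ∀ᶠ lam in Filter.atTop, ∀ᶠ ρ in Filter.atTop, ∀ E : Matrix σ σ CT,
      (∀ x v, nsq (evalAt E x *ᵥ v) ≤ 1 / (4 * b) * nsq v) →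
        (localizer ρ lam Γ (F + E)).det ≠ 0 := by
  set C : ℝ := ∑ i, ∑ j, ‖F i j‖ ^ 2 with hC
  have hC0 : 0 ≤ C := Finset.sum_nonneg fun _ _ => Finset.sum_nonneg fun _ _ => sq_nonneg _
  set W : Matrix σ σ CT := of fun s t => ∑ j, ∑ u, Γ j s u • F' j u t with hW
  set C1 : ℝ := ∑ i, ∑ j, ‖W i j‖ ^ 2 with hC1
  have hC10 : 0 ≤ C1 := Finset.sum_nonneg fun _ _ => Finset.sum_nonneg fun _ _ => sq_nonneg _
  filter_upwards [Filter.eventually_ge_atTop (b * (1 + C1) + 1)] with lam hlam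
  have hlam0 : 0 < lam := by
    have : 0 ≤ b * (1 + C1) := by positivity
    linarith
  obtain ⟨R, hR⟩ := exists_nat_ge (lam * (1 + C))
  filter_upwards [Filter.eventually_ge_atTop (r + R)] with ρ hρ E hE hdet
  obtain ⟨v, hv0, hv⟩ := exists_mulVec_eq_zero_iff.mpr hdet
  refine hv0 (nsq_eq_zero ?_)
  have h1 : localizer ρ lam Γ F *ᵥ v = (-(lam : ℂ)) • (toep ρ E *ᵥ v) := by
    rw [localizer, toep_add, smul_add, ← add_assoc, add_mulVec, smul_mulVec] at hv
    rw [neg_smul]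
    exact eq_neg_of_add_eq_zero_left hv
  have h2 : nsq (localizer ρ lam Γ F *ᵥ v) ≤ lam ^ 2 * (1 / (4 * b) * nsq v) := by
    rw [h1, nsq_smul, norm_neg, Complex.norm_real, Real.norm_eq_abs, sq_abs]
    exact mul_le_mul_of_nonneg_left (nsq_toep_le hE v) (sq_nonneg _)
  have hT := (toep_isHermitian (ρ := ρ) hF).eq
  have hD := (dirac_isHermitian (ρ := ρ) hΓ).eq
  have h3 : nsq (localizer ρ lam Γ F *ᵥ v) = nsq (dirac ρ Γ *ᵥ v) +
      lam ^ 2 * nsq (toep ρ F *ᵥ v) + lam * (star v ⬝ᵥ (toep ρ W *ᵥ v)).re := by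
    rw [nsq_mulVec, nsq_mulVec, nsq_mulVec, (localizer_isHermitian hΓ hF).eq, hT, hD, hW,
      ← dirac_mul_toep_add hΓF hF', localizer]
    have : (dirac ρ Γ + (lam : ℂ) • toep ρ F) * (dirac ρ Γ + (lam : ℂ) • toep ρ F) =
        dirac ρ Γ * dirac ρ Γ + ((lam ^ 2 : ℝ) : ℂ) • (toep ρ F * toep ρ F) +
          (lam : ℂ) • (dirac ρ Γ * toep ρ F + toep ρ F * dirac ρ Γ) := by
      rw [add_mul, mul_add, mul_add, mul_smul_comm, smul_mul_smul_comm, smul_mul_assoc, smul_add,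
        sq, Complex.ofReal_mul]
      abel
    rw [this, add_mulVec, add_mulVec, smul_mulVec, smul_mulVec, dotProduct_add, dotProduct_add,
      dotProduct_smul, dotProduct_smul, Complex.add_re, Complex.add_re, smul_eq_mul, smul_eq_mul,
      Complex.re_ofReal_mul, Complex.re_ofReal_mul]
  have h4 := neg_nsq_le_re_dotProduct v (toep ρ W *ᵥ v)
  have h5 := nsq_toep_le (ρ := ρ) (nsq_evalAt_le W) v
  have h6 := nsq_le_toep (ρ := ρ) hb.le hFb (nsq_evalAt_le F) hr v
  have h7 := le_nsq_dirac (ρ := ρ) (r := r) (by omega) hΓ v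
  have h8 : lam ^ 2 * C ≤ ((ρ : ℝ) - r) ^ 2 := by
    have : lam * (1 + C) ≤ (ρ : ℝ) - r := by
      have : ((r + R : ℕ) : ℝ) ≤ ρ := by exact_mod_cast hρ
      push_cast at this
      linarith
    calc lam ^ 2 * C ≤ (lam * (1 + C)) ^ 2 := by
          rw [mul_pow]
          refine mul_le_mul_of_nonneg_left ?_ (sq_nonneg _)
          nlinarith
      _ ≤ _ := pow_le_pow_left₀ (by positivity) this 2
  have h9 := nsq_nonneg (farPart r v)
  have h10 := nsq_nonneg v
  rw [← hC] at h6
  rw [← hC1] at h5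
  have h11 : lam ^ 2 * nsq v ≤
      b * (nsq (localizer ρ lam Γ F *ᵥ v) + lam * ((1 + C1) / 2 * nsq v)) := by
    have e1 : lam ^ 2 * nsq v ≤ b * (lam ^ 2 * nsq (toep ρ F *ᵥ v) +
        lam ^ 2 * C * nsq (farPart r v)) := by
      calc lam ^ 2 * nsq v ≤ lam ^ 2 * (b * (nsq (toep ρ F *ᵥ v) + C * nsq (farPart r v))) :=
            mul_le_mul_of_nonneg_left h6 (sq_nonneg _)
        _ = _ := by ring
    refine e1.trans (mul_le_mul_of_nonneg_left ?_ hb.le)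
    have e2 := (mul_le_mul_of_nonneg_right h8 h9).trans h7
    have e3 : lam * -((1 + C1) / 2 * nsq v) ≤ lam * (star v ⬝ᵥ (toep ρ W *ᵥ v)).re :=
      mul_le_mul_of_nonneg_left (by linarith) hlam0.le
    rw [h3]
    linarith
  have h12 : b * (lam ^ 2 * (1 / (4 * b) * nsq v)) = lam ^ 2 * nsq v / 4 := by
    field_simp
  have h13 := mul_le_mul_of_nonneg_left h2 hb.le
  rw [h12] at h13
  have h14 : lam * (lam * (3 / 4) - b * (1 + C1) / 2) * nsq v ≤ 0 := by
    nlinarith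
  have h15 : 0 < lam * (lam * (3 / 4) - b * (1 + C1) / 2) := by
    refine mul_pos hlam0 ?_
    have : 0 ≤ b * (1 + C1) := by positivity
    linarith
  by_contra! h
  exact absurd h14 (not_le.mpr (mul_pos h15 h))

end Localizer

section Homotopy

open UnitAddTorus MeasureTheory
open Matrix
open scoped Kronecker

lemma det_im_eq_zero {ι : Type*} [Fintype ι] [DecidableEq ι] {L : Matrix ι ι ℂ}
    (h : L.IsHermitian) : L.det.im = 0 := by
  have h1 := det_conjTranspose L
  rw [h.eq] at h1
  exact Complex.conj_eq_iff_im.mp h1.symm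

lemma det_mul_det_pos_of_path {ι : Type*} [Fintype ι] [DecidableEq ι] {L : ℝ → Matrix ι ι ℂ}
    (hc : Continuous L) (hH : ∀ t ∈ Set.Icc (0 : ℝ) 1, (L t).IsHermitian)
    (hd : ∀ t ∈ Set.Icc (0 : ℝ) 1, (L t).det ≠ 0) : 0 < (L 0).det.re * (L 1).det.re := by
  have hcont : Continuous fun t => (L t).det.re := Complex.continuous_re.comp hc.matrix_det
  have hne : ∀ t ∈ Set.Icc (0 : ℝ) 1, (L t).det.re ≠ 0 := fun t ht h =>
    hd t ht (Complex.ext h (det_im_eq_zero (hH t ht)))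
  by_contra! hneg
  have h0 : (0 : ℝ) ∈ Set.uIcc (L 0).det.re (L 1).det.re := by
    rw [Set.mem_uIcc]
    rcases mul_nonpos_iff.mp hneg with h | h
    · exact Or.inr ⟨h.2, h.1⟩
    · exact Or.inl h
  obtain ⟨t, ht, ht0⟩ := intermediate_value_uIcc hcont.continuousOn h0
  rw [Set.uIcc_of_le zero_le_one] at ht
  exact hne t ht ht0

/-- Trigonometric polynomials. -/
def IsTrigPoly (f : CT) : Prop :=
  (∃ r, BandLimited r f) ∧ ∀ j, ∃ f', HasFourierDeriv j f f'

lemma BandLimited.mono {r r' : ℕ} (h : r ≤ r') {f : CT} (hf : BandLimited r f) :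
    BandLimited r' f := fun n ⟨j, hj⟩ => hf n ⟨j, by omega⟩

lemma isTrigPoly_mFourier (m : Fin 5 → ℤ) : IsTrigPoly (mFourier m : CT) := by
  refine ⟨⟨∑ j, (m j).natAbs, ?_⟩, fun j => ⟨(m j : ℂ) • mFourier m, fun n => ?_⟩⟩
  · rintro n ⟨j, hj⟩
    rw [fc_mFourier, if_neg]
    rintro rfl
    have : (n j).natAbs ≤ ∑ j, (n j).natAbs :=
      Finset.single_le_sum (f := fun j => (n j).natAbs) (fun _ _ => Nat.zero_le _)
      (Finset.mem_univ j)
    rw [Int.abs_eq_natAbs] at hj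
    omega
  · rw [map_smul, fc_mFourier, smul_eq_mul]
    split_ifs with h
    · rw [h]
    · simp

lemma IsTrigPoly.add {f g : CT} (hf : IsTrigPoly f) (hg : IsTrigPoly g) : IsTrigPoly (f + g) := by
  obtain ⟨⟨r, hr⟩, hf⟩ := hf
  obtain ⟨⟨r', hr'⟩, hg⟩ := hg
  refine ⟨⟨max r r', fun n hn => ?_⟩, fun j => ?_⟩
  · rw [map_add, hr.mono (le_max_left _ _) n hn, hr'.mono (le_max_right _ _) n hn, add_zero]
  · obtain ⟨f', hf'⟩ := hf j
    obtain ⟨g', hg'⟩ := hg j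
    exact ⟨f' + g', fun n => by rw [map_add, map_add, hf', hg', mul_add]⟩

lemma IsTrigPoly.smul {f : CT} (hf : IsTrigPoly f) (c : ℂ) : IsTrigPoly (c • f) := by
  obtain ⟨⟨r, hr⟩, hf⟩ := hf
  refine ⟨⟨r, fun n hn => ?_⟩, fun j => ?_⟩
  · rw [map_smul, hr n hn, smul_zero]
  · obtain ⟨f', hf'⟩ := hf j
    exact ⟨c • f', fun n => by rw [map_smul, map_smul, hf', mul_smul_comm]⟩

lemma IsTrigPoly.star {f : CT} (hf : IsTrigPoly f) : IsTrigPoly (star f) := by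
  obtain ⟨⟨r, hr⟩, hf⟩ := hf
  refine ⟨⟨r, fun n ⟨j, hj⟩ => ?_⟩, fun j => ?_⟩
  · rw [fc_star, hr (-n) ⟨j, by simpa using hj⟩, map_zero]
  · obtain ⟨f', hf'⟩ := hf j
    exact ⟨-Star.star f', fun n => by rw [map_neg, fc_star, fc_star, hf']; simp⟩

lemma exists_isTrigPoly (g : CT) {δ : ℝ} (hδ : 0 < δ) : ∃ f, IsTrigPoly f ∧ ‖f - g‖ ≤ δ := by
  have h : g ∈ (Submodule.span ℂ
      (Set.range (mFourier (d := Fin 5)))).topologicalClosure := by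
    rw [span_mFourier_closure_eq_top]
    trivial
  obtain ⟨f, hf, hfg⟩ := Metric.mem_closure_iff.mp h δ hδ
  refine ⟨f, ?_, ?_⟩
  · refine Submodule.span_induction (p := fun f _ => IsTrigPoly f) ?_ ?_ ?_ ?_ hf
    · rintro _ ⟨m, rfl⟩
      exact isTrigPoly_mFourier m
    · exact zero_smul ℂ (mFourier 0 : CT) ▸ (isTrigPoly_mFourier 0).smul 0
    · exact fun _ _ _ _ => IsTrigPoly.add
    · exact fun c _ _ h => h.smul c
  · rw [← dist_eq_norm, dist_comm]
    exact hfg.le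

/-- The first Pauli matrix. -/
def pauliX : Matrix (Fin 2) (Fin 2) ℂ := !![0, 1; 1, 0]
/-- The second Pauli matrix. -/
def pauliY : Matrix (Fin 2) (Fin 2) ℂ := !![0, -Complex.I; Complex.I, 0]
/-- The third Pauli matrix. -/
def pauliZ : Matrix (Fin 2) (Fin 2) ℂ := !![1, 0; 0, -1]

lemma pauliX_mul_self : pauliX * pauliX = 1 := by
  ext i j; fin_cases i <;> fin_cases j <;> simp [pauliX]
lemma pauliY_mul_self : pauliY * pauliY = 1 := by
  ext i j; fin_cases i <;> fin_cases j <;> simp [pauliY]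
lemma pauliZ_mul_self : pauliZ * pauliZ = 1 := by
  ext i j; fin_cases i <;> fin_cases j <;> simp [pauliZ]
lemma pauliY_mul_pauliX : pauliY * pauliX = -(pauliX * pauliY) := by
  ext i j; fin_cases i <;> fin_cases j <;> simp [pauliX, pauliY]
lemma pauliZ_mul_pauliX : pauliZ * pauliX = -(pauliX * pauliZ) := by
  ext i j; fin_cases i <;> fin_cases j <;> simp [pauliX, pauliZ]
lemma pauliZ_mul_pauliY : pauliZ * pauliY = -(pauliY * pauliZ) := by
  ext i j; fin_cases i <;> fin_cases j <;> simp [pauliY, pauliZ]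
lemma pauliX_conjTranspose : pauliXᴴ = pauliX := by
  ext i j; fin_cases i <;> fin_cases j <;> simp [pauliX]
lemma pauliY_conjTranspose : pauliYᴴ = pauliY := by
  ext i j; fin_cases i <;> fin_cases j <;> simp [pauliY]
lemma pauliZ_conjTranspose : pauliZᴴ = pauliZ := by
  ext i j; fin_cases i <;> fin_cases j <;> simp [pauliZ]

/-- The index set of the spinors. -/
abbrev Spin : Type := Fin 2 × Fin 2 × Fin 2

/-- The gamma matrices. -/
def gam : Fin 5 → Matrix Spin Spin ℂ :=
  ![pauliZ ⊗ₖ (pauliX ⊗ₖ 1), pauliZ ⊗ₖ (pauliZ ⊗ₖ 1), pauliZ ⊗ₖ (pauliY ⊗ₖ pauliX),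
    pauliZ ⊗ₖ (pauliY ⊗ₖ pauliY), pauliZ ⊗ₖ (pauliY ⊗ₖ pauliZ)]

/-- The raising matrix in dimension two. -/
def pauliP : Matrix (Fin 2) (Fin 2) ℂ := !![0, 1; 0, 0]

lemma pauliP_mul_self : pauliP * pauliP = 0 := by
  ext i j; fin_cases i <;> fin_cases j <;> simp [pauliP]
lemma pauliP_add : pauliP * pauliPᴴ + pauliPᴴ * pauliP = 1 := by
  have h : pauliPᴴ = !![0, 0; 1, 0] := by
    ext i j; fin_cases i <;> fin_cases j <;> simp [pauliP]
  rw [h]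
  ext i j; fin_cases i <;> fin_cases j <;> simp [pauliP]
lemma pauliZ_mul_pauliP : pauliZ * pauliP = -(pauliP * pauliZ) := by
  ext i j; fin_cases i <;> fin_cases j <;> simp [pauliP, pauliZ]

/-- The raising matrix of the grading. -/
def raise : Matrix Spin Spin ℂ := pauliP ⊗ₖ 1

lemma neg_kronecker {l m n p : Type*} (A : Matrix l m ℂ) (B : Matrix n p ℂ) :
    (-A) ⊗ₖ B = -(A ⊗ₖ B) := by ext; simp
lemma kronecker_neg {l m n p : Type*} (A : Matrix l m ℂ) (B : Matrix n p ℂ) :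
    A ⊗ₖ (-B) = -(A ⊗ₖ B) := by ext; simp

lemma gam_isClifford : IsClifford gam where
  herm j := by
    fin_cases j <;> simp [gam, conjTranspose_kronecker, pauliX_conjTranspose, pauliY_conjTranspose,
      pauliZ_conjTranspose]
  sq j := by
    fin_cases j <;> simp [gam, ← mul_kronecker_mul, pauliX_mul_self, pauliY_mul_self,
      pauliZ_mul_self]
  anti i j h := by
    fin_cases i <;> fin_cases j <;> first | exact absurd rfl h | simp [gam, ← mul_kronecker_mul,
      pauliY_mul_self, pauliZ_mul_self, pauliY_mul_pauliX, pauliZ_mul_pauliX,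
      pauliZ_mul_pauliY, neg_kronecker, kronecker_neg]

lemma raise_mul_self : raise * raise = 0 := by
  rw [raise, ← mul_kronecker_mul, pauliP_mul_self, zero_kronecker]

lemma raise_add : raise * raiseᴴ + raiseᴴ * raise = 1 := by
  rw [raise, conjTranspose_kronecker, ← mul_kronecker_mul, ← mul_kronecker_mul, conjTranspose_one,
    ← add_kronecker, pauliP_add, mul_one, one_kronecker_one]

lemma gam_mul_raise (j : Fin 5) : gam j * raise + raise * gam j = 0 := by
  fin_cases j <;> simp [gam, raise, ← mul_kronecker_mul, pauliZ_mul_pauliP, neg_kronecker]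

lemma conjTranspose_raise_mul_self : raiseᴴ * raiseᴴ = 0 := by
  rw [← conjTranspose_mul, raise_mul_self, conjTranspose_zero]

lemma gam_mul_conjTranspose_raise (j : Fin 5) : gam j * raiseᴴ + raiseᴴ * gam j = 0 := by
  have h := congrArg conjTranspose (gam_mul_raise j)
  rwa [conjTranspose_add, conjTranspose_mul, conjTranspose_mul, gam_isClifford.herm,
    conjTranspose_zero, add_comm] at h

lemma norm_raise_le (p q : Spin) : ‖raise p q‖ ≤ 1 := by
  obtain ⟨a, b⟩ := p
  obtain ⟨c, d⟩ := q
  rw [raise, kroneckerMap_apply, norm_mul, one_apply]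
  refine mul_le_one₀ ?_ (norm_nonneg _) ?_
  · fin_cases a <;> fin_cases c <;> simp [pauliP]
  · split_ifs <;> simp

variable {N : Type*} [Fintype N] [DecidableEq N]

/-- The gamma matrices with coefficients in `N`. -/
def gamN (N : Type*) [DecidableEq N] (j : Fin 5) : Matrix (Spin × N) (Spin × N) ℂ := gam j ⊗ₖ 1

lemma gamN_isClifford : IsClifford (gamN N) where
  herm j := by rw [gamN, conjTranspose_kronecker, gam_isClifford.herm, conjTranspose_one]
  sq j := by rw [gamN, ← mul_kronecker_mul, gam_isClifford.sq, mul_one, one_kronecker_one]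
  anti i j h := by
    rw [gamN, gamN, ← mul_kronecker_mul, ← mul_kronecker_mul, ← add_kronecker,
      gam_isClifford.anti i j h, zero_kronecker]

/-- The Hermitian matrix with off-diagonal blocks `g` and `gᴴ`. -/
def offDiag {N : Type*} (g : Matrix N N ℂ) : Matrix (Spin × N) (Spin × N) ℂ :=
  raise ⊗ₖ g + raiseᴴ ⊗ₖ gᴴ

omit [Fintype N] [DecidableEq N] in
lemma offDiag_isHermitian (g : Matrix N N ℂ) : (offDiag g).IsHermitian := by
  rw [IsHermitian, offDiag, conjTranspose_add, conjTranspose_kronecker, conjTranspose_kronecker,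
    conjTranspose_conjTranspose, conjTranspose_conjTranspose, add_comm]

omit [DecidableEq N] in
lemma offDiag_mul_offDiag (g h : Matrix N N ℂ) : offDiag g * offDiag h =
    (raise * raiseᴴ) ⊗ₖ (g * hᴴ) + (raiseᴴ * raise) ⊗ₖ (gᴴ * h) := by
  simp only [offDiag, add_mul, mul_add, ← mul_kronecker_mul, raise_mul_self,
    conjTranspose_raise_mul_self, zero_kronecker, zero_add, add_zero]
  rw [add_comm]

lemma gamN_mul_offDiag (j : Fin 5) (g : Matrix N N ℂ) :
    gamN N j * offDiag g + offDiag g * gamN N j = 0 := by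
  have h : gamN N j * offDiag g + offDiag g * gamN N j =
      (gam j * raise + raise * gam j) ⊗ₖ g + (gam j * raiseᴴ + raiseᴴ * gam j) ⊗ₖ gᴴ := by
    simp only [offDiag, gamN, mul_add, add_mul, ← mul_kronecker_mul, one_mul, mul_one,
      add_kronecker]
    abel
  rw [h, gam_mul_raise, gam_mul_conjTranspose_raise, zero_kronecker, zero_kronecker, add_zero]

/-- The matrix of functions with off-diagonal blocks `g` and its adjoint. -/
def symb {N : Type*} (g : Matrix N N CT) : Matrix (Spin × N) (Spin × N) CT :=
  of fun p q => raise p.1 q.1 • g p.2 q.2 + conj (raise q.1 p.1) • star (g q.2 p.2)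

omit [Fintype N] [DecidableEq N] in
lemma evalAt_symb (g : Matrix N N CT) (x : Torus 5) :
    evalAt (symb g) x = offDiag (evalAt g x) := by
  ext p q
  simp [symb, offDiag]

omit [Fintype N] [DecidableEq N] in
lemma symb_add (g h : Matrix N N CT) : symb (g + h) = symb g + symb h := by
  ext p q x
  simp only [symb, Matrix.add_apply, of_apply, ContinuousMap.add_apply, ContinuousMap.smul_apply,
    ContinuousMap.star_apply, star_add, smul_eq_mul]
  ring

omit [Fintype N] [DecidableEq N] in
lemma norm_symb_le {g : Matrix N N CT} {δ : ℝ} (h : ∀ i j, ‖g i j‖ ≤ δ) (p q : Spin × N) :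
    ‖symb g p q‖ ≤ 2 * δ := by
  rw [symb, of_apply, two_mul]
  refine (norm_add_le _ _).trans (add_le_add ?_ ?_)
  · rw [norm_smul]
    exact (mul_le_of_le_one_left (norm_nonneg _) (norm_raise_le _ _)).trans (h _ _)
  · rw [norm_smul, RCLike.norm_conj]
    exact (mul_le_of_le_one_left (norm_nonneg _) (norm_raise_le _ _)).trans
      ((norm_star (g q.2 p.2)).trans_le (h _ _))

omit [DecidableEq N] in
lemma nsq_symb_le {g : Matrix N N CT} {δ : ℝ} (h : ∀ i j, ‖g i j‖ ≤ δ) (x : Torus 5)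
    (v : Spin × N → ℂ) : nsq (evalAt (symb g) x *ᵥ v) ≤
      ((Fintype.card (Spin × N) : ℝ) ^ 2 * (2 * δ) ^ 2) * nsq v := by
  refine (nsq_evalAt_le _ x v).trans (mul_le_mul_of_nonneg_right ?_ (nsq_nonneg v))
  calc ∑ p, ∑ q, ‖symb g p q‖ ^ 2 ≤ ∑ p : Spin × N, ∑ q : Spin × N, (2 * δ) ^ 2 := by
        gcongr with p _ q _
        exact norm_symb_le h p q
    _ = _ := by
        rw [Finset.sum_const, Finset.sum_const, Finset.card_univ]
        simp only [nsmul_eq_mul]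
        ring

/-- The localizer of an invertible matrix of functions. -/
def loc (ρ : ℕ) (lam : ℝ) (g : Matrix N N CT) : Matrix (Box ρ × Spin × N) (Box ρ × Spin × N) ℂ :=
  localizer ρ lam (gamN N) (symb g)

lemma loc_isHermitian (ρ : ℕ) (lam : ℝ) (g : Matrix N N CT) : (loc ρ lam g).IsHermitian :=
  localizer_isHermitian gamN_isClifford fun x => by
    rw [evalAt_symb]
    exact offDiag_isHermitian _

lemma nsq_le_symb {g h : Matrix N N CT} (hg : h * g = 1) (hg' : g * h = 1) (x : Torus 5)
    (v : Spin × N → ℂ) :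
    nsq v ≤ (∑ i, ∑ j, ‖symb hᴴ i j‖ ^ 2) * nsq (evalAt (symb g) x *ᵥ v) := by
  have h1 : evalAt (symb hᴴ) x * evalAt (symb g) x = 1 := by
    have e1 : evalAt h x * evalAt g x = 1 := by rw [← evalAt_mul, hg, evalAt_one]
    have e2 : evalAt g x * evalAt h x = 1 := by rw [← evalAt_mul, hg', evalAt_one]
    have e3 : evalAt hᴴ x = (evalAt h x)ᴴ := rfl
    rw [evalAt_symb, evalAt_symb, offDiag_mul_offDiag, e3, conjTranspose_conjTranspose,
      ← conjTranspose_mul, e1, e2, conjTranspose_one, ← add_kronecker, raise_add,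
      one_kronecker_one]
  have h2 := nsq_evalAt_le (symb hᴴ) x (evalAt (symb g) x *ᵥ v)
  rwa [mulVec_mulVec, h1, one_mulVec] at h2

/-- Invertibility of the localizer is uniform near an invertible matrix of functions. -/
lemma exists_det_loc_ne_zero {g : Matrix N N CT} (hg : IsUnit g) : ∃ δ > 0,
    ∀ᶠ lam in Filter.atTop, ∀ᶠ ρ in Filter.atTop, ∀ g' : Matrix N N CT,
      (∀ i j, ‖g' i j - g i j‖ ≤ δ) → (loc ρ lam g').det ≠ 0 := by
  obtain ⟨h, hg1, hg2⟩ := isUnit_iff_exists.mp hg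
  set B : ℝ := 1 + ∑ i, ∑ j, ‖symb hᴴ i j‖ ^ 2 with hB
  have hB1 : 1 ≤ B := by
    rw [hB]
    exact le_add_of_nonneg_right
      (Finset.sum_nonneg fun _ _ => Finset.sum_nonneg fun _ _ => sq_nonneg _)
  have hBg : ∀ x v, nsq v ≤ B * nsq (evalAt (symb g) x *ᵥ v) := fun x v =>
    (nsq_le_symb hg2 hg1 x v).trans (mul_le_mul_of_nonneg_right (by rw [hB]; linarith)
      (nsq_nonneg _))
  set S : ℝ := (Fintype.card (Spin × N) : ℝ) ^ 2 with hS
  have hS0 : 0 ≤ S := sq_nonneg _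
  set δ : ℝ := 1 / (16 * (B * (1 + S))) with hδ
  have hδ0 : 0 < δ := by positivity
  have hδ1 : 256 * B * S * δ ^ 2 ≤ 1 := by
    rw [hδ, div_pow, one_pow, mul_one_div, div_le_one (by positivity)]
    have e1 : B * S ≤ (B * (1 + S)) ^ 2 := by
      have : 1 ≤ B * (1 + S) := by nlinarith
      nlinarith
    nlinarith
  choose f hf hfg using fun i j => exists_isTrigPoly (g i j) hδ0
  have hpoly : ∀ p q, IsTrigPoly (symb (of f) p q) := fun p q =>
    ((hf _ _).smul _).add ((hf _ _).star.smul _)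
  choose r hr using fun p q => (hpoly p q).1
  choose F' hF' using fun p q => (hpoly p q).2
  have hfb : ∀ x v, nsq v ≤ 4 * B * nsq (evalAt (symb (of f)) x *ᵥ v) := by
    intro x v
    have e1 := hBg x v
    have e2 : evalAt (symb g) x *ᵥ v =
        evalAt (symb (of f)) x *ᵥ v + evalAt (symb (g - of f)) x *ᵥ v := by
      rw [← add_mulVec]
      congr 1
      have : g = of f + (g - of f) := by abel
      conv_lhs => rw [this, symb_add]
      rfl
    have e3 := nsq_symb_le (g := g - of f) (δ := δ)
      (fun i j => by rw [Matrix.sub_apply, norm_sub_rev]; exact hfg i j) x v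
    have e4 := nsq_add_le (evalAt (symb (of f)) x *ᵥ v) (evalAt (symb (g - of f)) x *ᵥ v)
    rw [← e2] at e4
    have e5 := nsq_nonneg v
    have e6 : B * nsq (evalAt (symb (g - of f)) x *ᵥ v) ≤ nsq v / 64 := by
      calc _ ≤ B * ((S * (2 * δ) ^ 2) * nsq v) := mul_le_mul_of_nonneg_left e3 (by linarith)
        _ = (256 * B * S * δ ^ 2) * nsq v / 64 := by ring
        _ ≤ 1 * nsq v / 64 := by gcongr
        _ = _ := by ring
    have e7 : B * nsq (evalAt (symb g) x *ᵥ v) ≤ B * (2 * nsq (evalAt (symb (of f)) x *ᵥ v) +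
        2 * nsq (evalAt (symb (g - of f)) x *ᵥ v)) := mul_le_mul_of_nonneg_left e4 (by linarith)
    linarith
  refine ⟨δ, hδ0, ?_⟩
  have key := det_localizer_add_ne_zero gamN_isClifford (F := symb (of f)) (b := 4 * B)
    (fun x => by rw [evalAt_symb]; exact offDiag_isHermitian _)
    (fun j x => by rw [evalAt_symb]; exact gamN_mul_offDiag _ _)
    (F' := fun j => of fun p q => F' p q j) (fun j p q => hF' p q j)
    (r := ∑ p, ∑ q, r p q) (fun p q => (hr p q).mono ?_) (by positivity) hfb
  · filter_upwards [key] with lam hlam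
    filter_upwards [hlam] with ρ hρ g' hg'
    have e1 : symb g' = symb (of f) + symb (g' - of f) := by
      rw [← symb_add]
      congr 1
      abel
    rw [loc, e1]
    refine hρ _ fun x v => ?_
    refine (nsq_symb_le (δ := 2 * δ) (fun i j => ?_) x v).trans ?_
    · rw [Matrix.sub_apply, of_apply, two_mul, ← sub_add_sub_cancel (g' i j) (g i j)]
      refine (norm_add_le _ _).trans (add_le_add (hg' i j) ?_)
      rw [norm_sub_rev]
      exact hfg i j
    · refine mul_le_mul_of_nonneg_right ?_ (nsq_nonneg v)
      rw [le_div_iff₀ (by positivity)]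
      calc _ = 256 * B * S * δ ^ 2 := by rw [← hS]; ring
        _ ≤ 1 := hδ1
  · exact (Finset.single_le_sum (f := fun q => r p q) (fun _ _ => Nat.zero_le _)
      (Finset.mem_univ q)).trans (Finset.single_le_sum (f := fun p => ∑ q, r p q)
      (fun _ _ => Nat.zero_le _) (Finset.mem_univ p))

end Homotopy

section LocDet

open UnitAddTorus MeasureTheory
open Matrix
open scoped Kronecker

variable {N N₁ : Type*} [Fintype N] [DecidableEq N] [Fintype N₁] [DecidableEq N₁]

/-- The determinant of the localizer, which is a real number. -/
def locDet (ρ : ℕ) (lam : ℝ) (g : Matrix N N CT) : ℝ := (loc ρ lam g).det.re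

/-- Positivity for large `lam` and then for large `ρ`. -/
def EvPos (f : ℝ → ℕ → ℝ) : Prop := ∀ᶠ lam in Filter.atTop, ∀ᶠ ρ in Filter.atTop, 0 < f lam ρ

lemma EvPos.imp₂ {f g h : ℝ → ℕ → ℝ} (hf : EvPos f) (hg : EvPos g)
    (H : ∀ lam ρ, 0 < f lam ρ → 0 < g lam ρ → 0 < h lam ρ) : EvPos h := by
  filter_upwards [hf, hg] with lam h1 h2
  filter_upwards [h1, h2] with ρ h3 h4 using H _ _ h3 h4

omit [Fintype N] [DecidableEq N] in
lemma symb_smul (s : ℝ) (g : Matrix N N CT) : symb ((s : ℂ) • g) = (s : ℂ) • symb g := by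
  ext p q x
  simp only [symb, Matrix.smul_apply, of_apply, ContinuousMap.add_apply, ContinuousMap.smul_apply,
    ContinuousMap.star_apply, smul_eq_mul, star_mul', RCLike.star_def, Complex.conj_ofReal]
  ring

omit [Fintype N] in
lemma loc_add_smul (ρ : ℕ) (lam s : ℝ) (g h : Matrix N N CT) :
    loc ρ lam (g + (s : ℂ) • h) = loc ρ lam g + (s : ℂ) • ((lam : ℂ) • toep ρ (symb h)) := by
  have : toep ρ ((s : ℂ) • symb h) = (s : ℂ) • toep ρ (symb h) := by
    ext p q
    simp [toep]
  rw [loc, localizer, symb_add, symb_smul, toep_add, this, smul_add, loc, localizer, add_assoc,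
    smul_comm]

lemma evPos_of_path {γ : ℝ → Matrix N N CT} (hc : Continuous γ)
    (hu : ∀ t ∈ Set.Icc (0 : ℝ) 1, IsUnit (γ t)) :
    EvPos fun lam ρ => locDet ρ lam (γ 0) * locDet ρ lam (γ 1) := by
  refine isPreconnected_Icc.induction₂
    (fun s t => EvPos fun lam ρ => locDet ρ lam (γ s) * locDet ρ lam (γ t)) ?_ ?_ ?_
    (Set.left_mem_Icc.mpr zero_le_one) (Set.right_mem_Icc.mpr zero_le_one)
  · intro s hs
    obtain ⟨δ, hδ, H⟩ := exists_det_loc_ne_zero (hu s hs)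
    have hnear : ∀ᶠ t in nhdsWithin s (Set.Icc 0 1), ∀ i j, ‖γ t i j - γ s i j‖ ≤ δ := by
      have h : ∀ᶠ t in nhds s, ∀ i j, ‖γ t i j - γ s i j‖ ≤ δ := by
        refine Filter.eventually_all.mpr fun i => Filter.eventually_all.mpr fun j => ?_
        have hij : Continuous fun t => γ t i j := hc.matrix_elem i j
        filter_upwards [Metric.tendsto_nhds.mp (hij.tendsto s) δ hδ] with t ht
        rw [← dist_eq_norm]
        exact ht.le
      exact h.filter_mono nhdsWithin_le_nhds
    filter_upwards [hnear] with t ht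
    filter_upwards [H] with lam hlam
    filter_upwards [hlam] with ρ hρ
    have := det_mul_det_pos_of_path
      (L := fun a : ℝ => loc ρ lam (γ s + (a : ℂ) • (γ t - γ s))) ?_
      (fun a _ => loc_isHermitian _ _ _) (fun a ha => hρ _ fun i j => ?_)
    · have e0 : γ s + ((0 : ℝ) : ℂ) • (γ t - γ s) = γ s := by
        rw [Complex.ofReal_zero, zero_smul ℂ (γ t - γ s), add_zero]
      have e1 : γ s + ((1 : ℝ) : ℂ) • (γ t - γ s) = γ t := by
        rw [Complex.ofReal_one, one_smul ℂ (γ t - γ s), add_sub_cancel]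
      rwa [e0, e1] at this
    · simp_rw [loc_add_smul]
      fun_prop
    · rw [Matrix.add_apply, add_sub_cancel_left, Matrix.smul_apply, norm_smul, Complex.norm_real,
        Real.norm_eq_abs, abs_of_nonneg ha.1]
      exact (mul_le_of_le_one_left (norm_nonneg _) ha.2).trans (ht i j)
  · intro r s t _ _ _ h1 h2
    refine h1.imp₂ h2 fun lam ρ a b => ?_
    have h := mul_pos a b
    rw [mul_mul_mul_comm] at h
    have e : 0 ≤ locDet ρ lam (γ s) * locDet ρ lam (γ s) := mul_self_nonneg _
    by_contra! hle
    nlinarith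
  · intro s t _ _ h
    simpa only [mul_comm] using h

lemma locDet_ofReal (ρ : ℕ) (lam : ℝ) (g : Matrix N N CT) :
    ((locDet ρ lam g : ℝ) : ℂ) = (loc ρ lam g).det :=
  Complex.ext rfl (det_im_eq_zero (loc_isHermitian _ _ _)).symm

/-- Distribution of a direct sum over the box and the spinors. -/
def sumBoxEquiv (ρ : ℕ) (N N₁ : Type*) :
    (Box ρ × Spin × N) ⊕ (Box ρ × Spin × N₁) ≃ Box ρ × Spin × (N ⊕ N₁) where
  toFun := Sum.elim (fun p => (p.1, p.2.1, .inl p.2.2)) (fun p => (p.1, p.2.1, .inr p.2.2))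
  invFun p := p.2.2.elim (fun i => .inl (p.1, p.2.1, i)) (fun i => .inr (p.1, p.2.1, i))
  left_inv p := by rcases p with p | p <;> rfl
  right_inv p := by obtain ⟨k, q, i | i⟩ := p <;> rfl

omit [Fintype N] in
lemma loc_apply (ρ : ℕ) (lam : ℝ) (g : Matrix N N CT) (p p' : Box ρ × Spin × N) :
    loc ρ lam g p p' = (if p.1 = p'.1 then ∑ j, (freq p.1 j : ℂ) *
      (gam j p.2.1 p'.2.1 * (1 : Matrix N N ℂ) p.2.2 p'.2.2) else 0) +
      lam * (raise p.2.1 p'.2.1 * fc (freq p.1 - freq p'.1) (g p.2.2 p'.2.2) +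
        conj (raise p'.2.1 p.2.1) * conj (fc (freq p'.1 - freq p.1) (g p'.2.2 p.2.2))) := by
  rw [loc, localizer, Matrix.add_apply, dirac_apply, Matrix.smul_apply, toep, of_apply, symb,
    of_apply, map_add, map_smul, map_smul, fc_star, neg_sub]
  rfl

set_option synthInstance.maxSize 1000 in
lemma locDet_fromBlocks (ρ : ℕ) (lam : ℝ) (g : Matrix N N CT) (h : Matrix N₁ N₁ CT) :
    locDet ρ lam (fromBlocks g 0 0 h) = locDet ρ lam g * locDet ρ lam h := by
  have key : (loc ρ lam (fromBlocks g 0 0 h)).submatrix (sumBoxEquiv ρ N N₁) (sumBoxEquiv ρ N N₁) =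
      fromBlocks (loc ρ lam g) 0 0 (loc ρ lam h) := by
    ext p p'
    rcases p with p | p <;> rcases p' with p' | p' <;>
      simp [loc_apply, sumBoxEquiv, one_apply]
  have h2 := congrArg det key
  rw [det_submatrix_equiv_self, det_fromBlocks_zero₂₁, ← locDet_ofReal, ← locDet_ofReal,
    ← locDet_ofReal] at h2
  exact_mod_cast h2

/-- The charge conjugation matrix. -/
def conjMat : Matrix Spin Spin ℂ := pauliX ⊗ₖ (1 ⊗ₖ pauliY)

lemma conjMat_mul_self : conjMat * conjMat = 1 := by
  simp [conjMat, ← mul_kronecker_mul, pauliX_mul_self, pauliY_mul_self]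

lemma kronecker_transpose {l m n p : Type*} (A : Matrix l m ℂ) (B : Matrix n p ℂ) :
    (A ⊗ₖ B)ᵀ = Aᵀ ⊗ₖ Bᵀ := rfl

lemma conjMat_mul_gam (j : Fin 5) : conjMat * gam j * conjMat = -(gam j)ᵀ := by
  have hX : pauliXᵀ = pauliX := by ext i j; fin_cases i <;> fin_cases j <;> simp [pauliX]
  have hY : pauliYᵀ = -pauliY := by ext i j; fin_cases i <;> fin_cases j <;> simp [pauliY]
  have hZ : pauliZᵀ = pauliZ := by ext i j; fin_cases i <;> fin_cases j <;> simp [pauliZ]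
  have h1 : pauliX * pauliZ * pauliX = -pauliZ := by
    rw [mul_assoc, pauliZ_mul_pauliX, mul_neg, ← mul_assoc, pauliX_mul_self, one_mul]
  have h2 : pauliY * pauliX * pauliY = -pauliX := by
    rw [pauliY_mul_pauliX, neg_mul, mul_assoc, pauliY_mul_self, mul_one]
  have h3 : pauliY * pauliZ * pauliY = -pauliZ := by
    rw [mul_assoc, pauliZ_mul_pauliY, mul_neg, ← mul_assoc, pauliY_mul_self, one_mul]
  fin_cases j <;> simp [conjMat, gam, ← mul_kronecker_mul, kronecker_transpose, hX, hY, hZ, h1, h2,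
    h3, pauliY_mul_self, neg_kronecker, kronecker_neg]

lemma conjMat_mul_raise : conjMat * raise * conjMat = raiseᵀ := by
  have h : pauliX * pauliP * pauliX = pauliPᵀ := by
    ext i j; fin_cases i <;> fin_cases j <;> simp [pauliX, pauliP]
  simp [conjMat, raise, ← mul_kronecker_mul, kronecker_transpose, h, pauliY_mul_self]

lemma conjMat_mul_conjTranspose_raise : conjMat * raiseᴴ * conjMat = raiseᴴᵀ := by
  have h := congrArg conjTranspose conjMat_mul_raise
  have hc : conjMatᴴ = conjMat := by
    simp [conjMat, conjTranspose_kronecker, pauliX_conjTranspose, pauliY_conjTranspose]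
  rw [conjTranspose_mul, conjTranspose_mul, hc, ← mul_assoc] at h
  rw [h]
  rfl

/-- Negation of frequencies. -/
def revBox (ρ : ℕ) : Box ρ ≃ Box ρ := Equiv.piCongrRight fun _ => Fin.revPerm

lemma freq_revBox {ρ : ℕ} (k : Box ρ) : freq (revBox ρ k) = -freq k := by
  ext j
  simp only [freq, revBox, Equiv.piCongrRight_apply, Pi.map_apply, Fin.revPerm_apply, Fin.val_rev,
    Pi.neg_apply]
  omega

lemma kronecker_mul_mul_kronecker_apply {K : Type*} [Fintype K] [DecidableEq K]
    (V : Matrix Spin Spin ℂ) (M : Matrix (K × Spin × N) (K × Spin × N) ℂ) (k l : K) (q q' : Spin)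
    (i j : N) : (((1 : Matrix K K ℂ) ⊗ₖ (V ⊗ₖ (1 : Matrix N N ℂ))) * M *
      ((1 : Matrix K K ℂ) ⊗ₖ (V ⊗ₖ (1 : Matrix N N ℂ)))) (k, q, i) (l, q', j) =
      (V * (of fun a b => M (k, a, i) (l, b, j)) * V) q q' := by
  simp [mul_apply, Fintype.sum_prod_type, one_apply, mul_ite, ite_mul,
    Finset.sum_ite_eq]

lemma locDet_transpose (ρ : ℕ) (lam : ℝ) (g : Matrix N N CT) :
    locDet ρ lam gᵀ = locDet ρ lam g := by
  set e : Box ρ × Spin × N ≃ Box ρ × Spin × N := (revBox ρ).prodCongr (Equiv.refl _) with he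
  set V : Matrix (Box ρ × Spin × N) (Box ρ × Spin × N) ℂ :=
    (1 : Matrix (Box ρ) (Box ρ) ℂ) ⊗ₖ (conjMat ⊗ₖ (1 : Matrix N N ℂ)) with hV
  have key : V * (loc ρ lam gᵀ).submatrix e e * V = (loc ρ lam g)ᵀ := by
    ext ⟨k, q, i⟩ ⟨l, q', j⟩
    rw [hV, kronecker_mul_mul_kronecker_apply, transpose_apply, loc_apply]
    have h1 : (of fun a b => (loc ρ lam gᵀ).submatrix e e (k, a, i) (l, b, j)) =
        (∑ m, (if l = k then (-freq l m : ℂ) * (1 : Matrix N N ℂ) j i else 0) • gam m) +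
        ((lam : ℂ) * fc (freq l - freq k) (g j i)) • raise +
        ((lam : ℂ) * conj (fc (freq k - freq l) (g i j))) • raiseᴴ := by
      ext a b
      simp only [of_apply, submatrix_apply, he, Equiv.prodCongr_apply, Prod.map_apply,
        Equiv.coe_refl, id_eq, loc_apply, freq_revBox, transpose_apply,
        EmbeddingLike.apply_eq_iff_eq,
        Matrix.add_apply, Matrix.sum_apply, Matrix.smul_apply, smul_eq_mul, conjTranspose_apply,
        RCLike.star_def]
      rw [neg_sub_neg, neg_sub_neg, mul_add, add_assoc]
      congr 1
      · by_cases hkl : k = l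
        · subst hkl
          simp only [if_true, Pi.neg_apply, Int.cast_neg]
          refine Finset.sum_congr rfl fun m _ => ?_
          by_cases hij : i = j
          · subst hij
            simp only [one_apply_eq]
            ring
          · simp [one_apply_ne hij, one_apply_ne (Ne.symm hij)]
        · simp [hkl, Ne.symm hkl]
      · ring
    rw [h1]
    simp only [mul_add, add_mul, Finset.mul_sum, Finset.sum_mul, mul_smul_comm, smul_mul_assoc,
      conjMat_mul_gam, conjMat_mul_raise, conjMat_mul_conjTranspose_raise, Matrix.add_apply,
      Matrix.sum_apply, Matrix.smul_apply, Matrix.neg_apply, transpose_apply, smul_eq_mul,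
      conjTranspose_apply, RCLike.star_def]
    rw [add_assoc]
    congr 1
    · split_ifs with h
      · refine Finset.sum_congr rfl fun m _ => ?_
        ring
      · simp
    · ring
  have hVV : V * V = 1 := by
    rw [hV, ← mul_kronecker_mul, ← mul_kronecker_mul, conjMat_mul_self]
    simp
  have h2 := congrArg det key
  rw [det_mul, det_mul, det_submatrix_equiv_self, det_transpose, mul_right_comm, ← det_mul, hVV,
    det_one, one_mul] at h2
  rw [locDet, h2, locDet]

end LocDet

section Blocks

open UnitAddTorus MeasureTheory
open Matrix
open scoped Kronecker

variable {N : Type*} [Fintype N] [DecidableEq N]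

lemma raise_mul_conjTranspose_mul_raise : raise * raiseᴴ * raise = raise := by
  have h := congrArg (· * raise) raise_add
  simpa [add_mul, mul_assoc, raise_mul_self] using h

lemma offDiag_mul_self {c : Matrix N N ℂ} (hc : c * cᴴ = 1) : offDiag c * offDiag c = 1 := by
  rw [offDiag_mul_offDiag, hc, mul_eq_one_comm.mp hc, ← add_kronecker, raise_add,
    one_kronecker_one]

lemma det_offDiag {c : Matrix N N ℂ} (hc : c * cᴴ = 1) : (offDiag c).det = 1 := by
  set W : Matrix (Spin × N) (Spin × N) ℂ :=
    (raise * raiseᴴ) ⊗ₖ c + (raiseᴴ * raise) ⊗ₖ (1 : Matrix N N ℂ) with hW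
  have h1 := raise_mul_conjTranspose_mul_raise
  have h2 : raiseᴴ * raise * raiseᴴ = raiseᴴ := by
    have := congrArg conjTranspose h1
    rwa [conjTranspose_mul, conjTranspose_mul, conjTranspose_conjTranspose, ← mul_assoc] at this
  have h3 := raise_mul_self
  have h4 := conjTranspose_raise_mul_self
  have hWs : Wᴴ = (raise * raiseᴴ) ⊗ₖ cᴴ + (raiseᴴ * raise) ⊗ₖ (1 : Matrix N N ℂ) := by
    simp [hW, conjTranspose_kronecker]
  have e1 : raise * raiseᴴ * (raiseᴴ * raise) = 0 := by
    rw [mul_assoc, ← mul_assoc raiseᴴ, h4, zero_mul, mul_zero]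
  have e2 : raiseᴴ * raise * (raise * raiseᴴ) = 0 := by
    rw [mul_assoc, ← mul_assoc raise, h3, zero_mul, mul_zero]
  have e3 : raise * raiseᴴ * (raise * raiseᴴ) = raise * raiseᴴ := by rw [← mul_assoc, h1]
  have e4 : raiseᴴ * raise * (raiseᴴ * raise) = raiseᴴ * raise := by rw [← mul_assoc, h2]
  have hWW : W * Wᴴ = 1 := by
    rw [hWs, hW]
    simp only [add_mul, mul_add, ← mul_kronecker_mul, e1, e2, e3, e4, hc, mul_one,
      zero_kronecker, add_zero, zero_add]
    rw [← add_kronecker, raise_add, one_kronecker_one]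
  have key : W * offDiag 1 * Wᴴ = offDiag c := by
    rw [hWs, hW, offDiag, offDiag, conjTranspose_one]
    have f1 : raise * raiseᴴ * raiseᴴ = 0 := by rw [mul_assoc, h4, mul_zero]
    have f2 : raiseᴴ * raise * raise = 0 := by rw [mul_assoc, h3, mul_zero]
    have f3 : raise * (raise * raiseᴴ) = 0 := by rw [← mul_assoc, h3, zero_mul]
    have f4 : raiseᴴ * (raiseᴴ * raise) = 0 := by rw [← mul_assoc, h4, zero_mul]
    simp only [add_mul, mul_add, ← mul_kronecker_mul, h1, h2, f1, f2, f3, f4, mul_one, one_mul,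
      zero_kronecker, add_zero, zero_add, ← mul_assoc]
    rw [add_comm]
  have h5 := congrArg det key
  rw [det_mul, det_mul, mul_right_comm, ← det_mul, hWW, det_one, one_mul] at h5
  rw [← h5]
  have h6 : offDiag (1 : Matrix N N ℂ) =
      (pauliX ⊗ₖ (1 : Matrix (Fin 2 × Fin 2) (Fin 2 × Fin 2) ℂ)) ⊗ₖ 1 := by
    rw [offDiag, conjTranspose_one, ← add_kronecker, raise, conjTranspose_kronecker,
      conjTranspose_one, ← add_kronecker]
    congr 2
    ext i j; fin_cases i <;> fin_cases j <;> simp [pauliX, pauliP]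
  rw [h6, det_kronecker, det_kronecker]
  have h7 : pauliX.det = -1 := by simp [pauliX, det_fin_two_of]
  rw [h7]
  simp [show (-1 : ℂ) ^ 4 = 1 by norm_num]

/-- Matrices of constant functions. -/
def constM {N : Type*} (c : Matrix N N ℂ) : Matrix N N CT := c.map (algebraMap ℂ CT)

omit [Fintype N] in
lemma constM_one : constM (1 : Matrix N N ℂ) = 1 := Matrix.map_one _ (map_zero _) (map_one _)

omit [DecidableEq N] in
lemma constM_mul (c d : Matrix N N ℂ) : constM (c * d) = constM c * constM d := Matrix.map_mul

omit [Fintype N] [DecidableEq N] in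
lemma continuous_constM : Continuous (constM (N := N)) :=
  continuous_id.matrix_map (continuous_algebraMap ℂ CT)

omit [Fintype N] in
lemma loc_const (ρ : ℕ) (lam : ℝ) (c : Matrix N N ℂ) :
    loc ρ lam (constM c) =
      dirac ρ (gamN N) + (lam : ℂ) • ((1 : Matrix (Box ρ) (Box ρ) ℂ) ⊗ₖ offDiag c) := by
  rw [loc, localizer]
  congr 2
  ext p q
  have h (n : Fin 5 → ℤ) (a : ℂ) : fc n (algebraMap ℂ CT a) = if n = 0 then a else 0 := by
    rw [Algebra.algebraMap_eq_smul_one, ← mFourier_zero (d := Fin 5), map_smul, fc_mFourier]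
    simp
  rw [toep, of_apply, symb, of_apply, map_add, map_smul, map_smul, fc_star, constM, map_apply,
    map_apply,
    h, h, kroneckerMap_apply, offDiag, Matrix.add_apply, kroneckerMap_apply, kroneckerMap_apply,
    one_apply]
  simp only [neg_eq_zero, sub_eq_zero, freq_injective.eq_iff]
  split_ifs <;> simp

lemma dirac_mul_offDiag (ρ : ℕ) (c : Matrix N N ℂ) :
    dirac ρ (gamN N) * ((1 : Matrix (Box ρ) (Box ρ) ℂ) ⊗ₖ offDiag c) +
      ((1 : Matrix (Box ρ) (Box ρ) ℂ) ⊗ₖ offDiag c) * dirac ρ (gamN N) = 0 := by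
  rw [dirac, Finset.sum_mul, Finset.mul_sum, ← Finset.sum_add_distrib]
  refine Finset.sum_eq_zero fun j _ => ?_
  rw [← mul_kronecker_mul, ← mul_kronecker_mul, mul_one, one_mul, ← kronecker_add,
    gamN_mul_offDiag, kronecker_zero]

lemma locDet_const_pos {c : Matrix N N ℂ} (hc : c * cᴴ = 1) {lam : ℝ} (hl : 0 < lam) (ρ : ℕ) :
    0 < locDet ρ lam (constM c) := by
  set D := dirac ρ (gamN N) with hD
  set G := (1 : Matrix (Box ρ) (Box ρ) ℂ) ⊗ₖ offDiag c with hG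
  have hGG : G * G = 1 := by
    rw [hG, ← mul_kronecker_mul, offDiag_mul_self hc, mul_one, one_kronecker_one]
  have hGdet : G.det = 1 := by rw [hG, det_kronecker, det_one, det_offDiag hc]; simp
  have hDG : D * G + G * D = 0 := dirac_mul_offDiag ρ c
  have hGH : G.IsHermitian := by
    rw [IsHermitian, hG, conjTranspose_kronecker, offDiag_isHermitian, conjTranspose_one]
  have key := det_mul_det_pos_of_path (L := fun s : ℝ => (s : ℂ) • D + (lam : ℂ) • G) (by fun_prop)
    (fun s _ => by
      rw [IsHermitian, conjTranspose_add, conjTranspose_smul, conjTranspose_smul,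
        (dirac_isHermitian gamN_isClifford).eq, hGH.eq, hD]
      simp) (fun s _ hdet => ?_)
  · simp only [Complex.ofReal_zero, zero_smul, zero_add, Complex.ofReal_one, one_smul] at key
    rw [det_smul, hGdet, mul_one, ← Complex.ofReal_pow, Complex.ofReal_re] at key
    rw [locDet, loc_const]
    exact pos_of_mul_pos_right key (by positivity)
  · have h2 : ((s : ℂ) • D + (lam : ℂ) • G) * ((s : ℂ) • D + (lam : ℂ) • G) =
        diagonal fun p : Box ρ × Spin × N =>
          ((s ^ 2 * ∑ j, (freq p.1 j : ℝ) * freq p.1 j + lam ^ 2 : ℝ) : ℂ) := by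
      have e : ((s : ℂ) • D + (lam : ℂ) • G) * ((s : ℂ) • D + (lam : ℂ) • G) =
          ((s : ℂ) ^ 2) • (D * D) + ((s : ℂ) * lam) • (D * G + G * D) +
          ((lam : ℂ) ^ 2) • (G * G) := by
        simp only [add_mul, mul_add, smul_mul_smul_comm, smul_add]
        rw [mul_comm (lam : ℂ) s, sq, sq]
        abel
      rw [e, hDG, hGG, smul_zero, add_zero, hD, dirac_mul_self gamN_isClifford]
      ext p q
      by_cases hpq : p = q
      · subst hpq
        simp
      · simp [hpq]
    have h3 := congrArg det h2
    rw [det_mul, hdet, zero_mul, det_diagonal, eq_comm, Finset.prod_eq_zero_iff] at h3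
    obtain ⟨p, -, hp⟩ := h3
    have : (0 : ℝ) < s ^ 2 * ∑ j, (freq p.1 j : ℝ) * freq p.1 j + lam ^ 2 := by
      have : 0 ≤ ∑ j, (freq p.1 j : ℝ) * freq p.1 j :=
        Finset.sum_nonneg fun _ _ => mul_self_nonneg _
      positivity
    exact this.ne' (by exact_mod_cast hp)

lemma locDet_one_pos {lam : ℝ} (hl : 0 < lam) (ρ : ℕ) :
    0 < locDet ρ lam (1 : Matrix N N CT) := by
  rw [← constM_one]
  exact locDet_const_pos (by simp) hl ρ

/-- Rotation of the two summands of a direct sum. -/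
def rot (N : Type*) [DecidableEq N] (t : ℝ) : Matrix (N ⊕ N) (N ⊕ N) ℂ :=
  fromBlocks ((Real.cos t : ℂ) • 1) (-((Real.sin t : ℂ) • 1)) ((Real.sin t : ℂ) • 1)
    ((Real.cos t : ℂ) • 1)

lemma rot_mul_rot_neg (t : ℝ) : rot N t * rot N (-t) = 1 := by
  have h : ((Real.cos t : ℂ) * Real.cos t + Real.sin t * Real.sin t) = 1 := by
    rw [← sq, ← sq]
    exact_mod_cast Real.cos_sq_add_sin_sq t
  have h' : ((Real.sin t : ℂ) * Real.sin t + Real.cos t * Real.cos t) = 1 := by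
    rw [add_comm, h]
  rw [rot, rot, fromBlocks_multiply, Real.cos_neg, Real.sin_neg, Complex.ofReal_neg]
  simp only [smul_mul_smul_comm, mul_one, neg_smul, neg_mul, mul_neg, neg_neg, ← add_smul, h, h',
    one_smul]
  rw [mul_comm (Real.sin t : ℂ) (Real.cos t), add_neg_cancel, fromBlocks_one]

omit [Fintype N] in
lemma continuous_rot : Continuous (rot N) := by
  unfold rot
  exact Continuous.matrix_fromBlocks (by fun_prop) (by fun_prop) (by fun_prop) (by fun_prop)

lemma isUnit_constM_rot (t : ℝ) : IsUnit (constM (rot N t)) := isUnit_iff_exists.mpr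
  ⟨constM (rot N (-t)), by rw [← constM_mul, rot_mul_rot_neg, constM_one],
    by simpa [← constM_mul, constM_one] using
      congrArg constM (rot_mul_rot_neg (N := N) (-t))⟩

omit [Fintype N] in
lemma constM_rot_zero : constM (rot N 0) = 1 := by
  rw [← constM_one]
  simp [rot]

omit [Fintype N] in
lemma constM_rot_pi_div_two : constM (rot N (π / 2)) = fromBlocks 0 (-1) 1 0 := by
  have h : rot N (π / 2) = fromBlocks 0 (-1) 1 0 := by simp [rot]
  rw [h, constM, fromBlocks_map]
  congr 1 <;> ext i j <;> by_cases hij : i = j <;> simp [one_apply, hij]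

omit [Fintype N] in
lemma constM_rot_neg_pi_div_two : constM (rot N (-(π / 2))) = fromBlocks 0 1 (-1) 0 := by
  have h : rot N (-(π / 2)) = fromBlocks 0 1 (-1) 0 := by simp [rot]
  rw [h, constM, fromBlocks_map]
  congr 1 <;> ext i j <;> by_cases hij : i = j <;> simp [one_apply, hij]

lemma isUnit_fromBlocks_diag {N' : Type*} [Fintype N'] [DecidableEq N'] {g : Matrix N N CT}
    {h : Matrix N' N' CT} (hg : IsUnit g) (hh : IsUnit h) :
    IsUnit (fromBlocks g 0 0 h) := by
  obtain ⟨g', h1, h2⟩ := isUnit_iff_exists.mp hg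
  obtain ⟨h', h3, h4⟩ := isUnit_iff_exists.mp hh
  refine isUnit_iff_exists.mpr ⟨fromBlocks g' 0 0 h', ?_, ?_⟩ <;>
    simp [fromBlocks_multiply, h1, h2, h3, h4]

lemma evPos_mul {g h : Matrix N N CT} (hg : IsUnit g) (hh : IsUnit h) :
    EvPos fun lam ρ => locDet ρ lam (g * h) * (locDet ρ lam g * locDet ρ lam h) := by
  have hc : Continuous fun t : ℝ => fromBlocks g 0 0 1 * constM (rot N (π / 2 * t)) *
      fromBlocks h 0 0 1 * constM (rot N (-(π / 2 * t))) :=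
    ((continuous_const.matrix_mul (continuous_constM.comp (continuous_rot.comp
      (by fun_prop)))).matrix_mul continuous_const).matrix_mul
      (continuous_constM.comp (continuous_rot.comp (by fun_prop)))
  have key := evPos_of_path hc fun t _ =>
    (((isUnit_fromBlocks_diag hg isUnit_one).mul (isUnit_constM_rot _)).mul
      (isUnit_fromBlocks_diag hh isUnit_one)).mul (isUnit_constM_rot _)
  have e0 : fromBlocks g 0 0 1 * constM (rot N (π / 2 * 0)) * fromBlocks h 0 0 1 *
      constM (rot N (-(π / 2 * 0))) = fromBlocks (g * h) 0 0 1 := by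
    rw [mul_zero, neg_zero, constM_rot_zero]
    simp [fromBlocks_multiply]
  have e1 : fromBlocks g 0 0 1 * constM (rot N (π / 2 * 1)) * fromBlocks h 0 0 1 *
      constM (rot N (-(π / 2 * 1))) = fromBlocks g 0 0 h := by
    rw [mul_one, constM_rot_pi_div_two, constM_rot_neg_pi_div_two]
    simp [fromBlocks_multiply]
  simp only [e0, e1, locDet_fromBlocks] at key
  filter_upwards [key, Filter.eventually_gt_atTop 0] with lam h1 h2
  filter_upwards [h1] with ρ h3
  rw [mul_right_comm] at h3
  exact pos_of_mul_pos_left h3 (locDet_one_pos h2 ρ).le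

end Blocks

section Bordered

open UnitAddTorus MeasureTheory
open Matrix
open scoped Kronecker

section
variable {R : Type*} [CommRing R] [StarRing R]

/-- The matrix of the cross product with the conjugate of `p`, bordered by `p`. It is `‖p‖` times
a unitary matrix. -/
def bordered (p : Fin 3 → R) : Matrix (Fin 3 ⊕ Unit) (Fin 3 ⊕ Unit) R :=
  fromBlocks !![0, -star (p 2), star (p 1); star (p 2), 0, -star (p 0);
    -star (p 1), star (p 0), 0] (of fun i _ => p i) (of fun _ j => p j) 0

omit [StarRing R] in
lemma cross_mul_cross (a b c a' b' c' : R) :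
    !![0, -c', b'; c', 0, -a'; -b', a', 0] * !![0, c, -b; -c, 0, a; b, -a, 0] =
      (a * a' + b * b' + c * c') • (1 : Matrix (Fin 3) (Fin 3) R) -
        (of fun i _ => ![a, b, c] i : Matrix (Fin 3) Unit R) *
          (of fun _ j => ![a', b', c'] j : Matrix Unit (Fin 3) R) := by
  rw [mul_fin_three]
  ext i j
  rw [Matrix.sub_apply, mul_apply, Finset.univ_unique, Finset.sum_singleton, of_apply, of_apply,
    Matrix.smul_apply, one_apply]
  fin_cases i <;> fin_cases j <;> simp <;> ring

lemma bordered_mul_conjTranspose (p : Fin 3 → R) :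
    bordered p * (bordered p)ᴴ = (∑ i, p i * star (p i)) • 1 := by
  have h : (!![0, -star (p 2), star (p 1); star (p 2), 0, -star (p 0);
      -star (p 1), star (p 0), 0] : Matrix (Fin 3) (Fin 3) R)ᴴ =
      !![0, p 2, -p 1; -p 2, 0, p 0; p 1, -p 0, 0] := by
    ext i j
    fin_cases i <;> fin_cases j <;> simp
  rw [bordered, fromBlocks_conjTranspose, fromBlocks_multiply, ← fromBlocks_one, fromBlocks_smul,
    h]
  congr 1
  · rw [cross_mul_cross, Fin.sum_univ_three, sub_add_eq_add_sub, sub_eq_iff_eq_add]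
    congr 2
    · ext i j
      fin_cases i <;> rfl
    · ext i j
      fin_cases j <;> rfl
  · ext i j
    rw [Matrix.add_apply, mul_apply, Fin.sum_univ_three]
    fin_cases i <;> simp <;> ring
  · ext i j
    rw [Matrix.add_apply, mul_apply, Fin.sum_univ_three]
    fin_cases j <;> simp <;> ring
  · ext i j
    rw [Matrix.add_apply, mul_apply, Fin.sum_univ_three, zero_mul, Matrix.zero_apply, add_zero]
    rw [Fin.sum_univ_three, Subsingleton.elim i j, Matrix.smul_apply, one_apply_eq, smul_eq_mul,
      mul_one]
    rfl

lemma conjTranspose_eq_adjugate {M : Matrix (Fin 3) (Fin 3) R} (hM : M * Mᴴ = 1)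
    (hd : M.det = 1) : Mᴴ = adjugate M := by
  have h := adjugate_mul M
  rw [hd, one_smul] at h
  calc Mᴴ = adjugate M * M * Mᴴ := by rw [h, one_mul]
    _ = adjugate M := by rw [mul_assoc, hM, mul_one]

lemma bordered_column {M : Matrix (Fin 3) (Fin 3) R} (hM : M * Mᴴ = 1) (hd : M.det = 1) :
    bordered (fun i => M i 0) = fromBlocks M 0 0 1 * bordered ![1, 0, 0] *
      fromBlocks Mᵀ 0 0 1 := by
  have h := conjTranspose_eq_adjugate hM hd
  have h0 : star (M 0 0) = adjugate M 0 0 := congrFun (congrFun h 0) 0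
  have h1 : star (M 1 0) = adjugate M 0 1 := congrFun (congrFun h 0) 1
  have h2 : star (M 2 0) = adjugate M 0 2 := congrFun (congrFun h 0) 2
  rw [adjugate_fin_three] at h0 h1 h2
  simp only [of_apply, cons_val', cons_val_zero, cons_val_one, cons_val] at h0 h1 h2
  rw [bordered, bordered, fromBlocks_multiply, fromBlocks_multiply]
  simp only [h0, h1, h2]
  congr 1
  · ext i j
    fin_cases i <;> fin_cases j <;> simp [mul_apply, Fin.sum_univ_three] <;> ring
  · ext i j
    fin_cases i <;> simp [mul_apply, Fin.sum_univ_three]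
  · ext i j
    fin_cases j <;> simp [mul_apply, Fin.sum_univ_three]
  · ext i j
    simp
end

lemma continuous_bordered : Continuous (bordered (R := CT)) := by
  refine continuous_matrix fun i j => ?_
  rcases i with i | i <;> rcases j with j | j
  · fin_cases i <;> fin_cases j <;> simp [bordered] <;> fun_prop
  · simp only [bordered, fromBlocks_apply₁₂, of_apply]; fun_prop
  · simp only [bordered, fromBlocks_apply₂₁, of_apply]; fun_prop
  · simp only [bordered, fromBlocks_apply₂₂, Matrix.zero_apply]; fun_prop

lemma isUnit_bordered {p : Fin 3 → CT} (hp : ∀ x, ∃ i, p i x ≠ 0) : IsUnit (bordered p) := by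
  have hu : IsUnit (∑ i, p i * star (p i)) := by
    refine ContinuousMap.isUnit_iff_forall_ne_zero _ |>.mpr fun x h => ?_
    obtain ⟨i, hi⟩ := hp x
    have e : (∑ i, p i * star (p i)) x = ((∑ i, ‖p i x‖ ^ 2 : ℝ) : ℂ) := by
      simp [ContinuousMap.sum_apply, Complex.mul_conj']
    rw [e, Complex.ofReal_eq_zero] at h
    have := (Finset.sum_eq_zero_iff_of_nonneg fun _ _ => sq_nonneg _).mp h i (Finset.mem_univ i)
    exact hi (by simpa using this)
  rw [isUnit_iff_isUnit_det]
  refine isUnit_of_mul_isUnit_left (y := (bordered p)ᴴ.det) ?_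
  rw [← det_mul, bordered_mul_conjTranspose, det_smul, det_one, mul_one]
  exact hu.pow _

lemma evPos_bordered_column {M : Matrix (Fin 3) (Fin 3) CT} (hM : M * Mᴴ = 1)
    (hd : M.det = 1) : EvPos fun lam ρ => locDet ρ lam (bordered fun i => M i 0) := by
  have hMu : IsUnit M := IsUnit.of_mul_eq_one Mᴴ hM
  have hMt : IsUnit Mᵀ := (isUnit_transpose M).mpr hMu
  have hb : IsUnit (bordered (![1, 0, 0] : Fin 3 → CT)) :=
    isUnit_bordered fun x => ⟨0, by simp⟩
  have h1 := isUnit_fromBlocks_diag hMu (h := (1 : Matrix Unit Unit CT)) isUnit_one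
  have h2 := isUnit_fromBlocks_diag hMt (h := (1 : Matrix Unit Unit CT)) isUnit_one
  have hc : bordered (![1, 0, 0] : Fin 3 → CT) = constM (bordered ![1, 0, 0]) := by
    rw [constM, bordered, bordered, fromBlocks_map]
    congr 1
    · ext i j; fin_cases i <;> fin_cases j <;> simp
    · ext i j; fin_cases i <;> simp
    · ext i j; fin_cases j <;> simp
  rw [bordered_column hM hd]
  filter_upwards [evPos_mul h1 hb, evPos_mul (h1.mul hb) h2, Filter.eventually_gt_atTop 0]
    with lam k1 k2 hl
  filter_upwards [k1, k2] with ρ k3 k4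
  have k5 : 0 < locDet ρ lam (bordered (![1, 0, 0] : Fin 3 → CT)) := by
    rw [hc]
    exact locDet_const_pos (by rw [bordered_mul_conjTranspose]; simp [Fin.sum_univ_three]) hl ρ
  rw [locDet_fromBlocks] at k3 k4
  rw [locDet_transpose] at k4
  have k6 := locDet_one_pos (N := Unit) hl ρ
  rw [← mul_assoc] at k3
  exact pos_of_mul_pos_left k4 (pos_of_mul_pos_left k3 k5.le).le

/-- A nowhere vanishing vector of functions proportional to the first column of a unitary matrix of
functions has positive localizer determinants. -/
lemma evPos_of_column {M : Matrix (Fin 3) (Fin 3) CT} (hM : M * Mᴴ = 1) {h : Fin 3 → CT}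
    (hh : ∀ x, ∃ i, h i x ≠ 0) (hr : ∀ x, ∃ r : ℝ, 0 < r ∧ ∀ i, M i 0 x = r * h i x) :
    EvPos fun lam ρ => locDet ρ lam (bordered h) := by
  set M' := M * diagonal ![1, star M.det, 1] with hM'
  have hdd : M.det * star M.det = 1 := by
    have := congrArg det hM
    rwa [det_mul, det_conjTranspose, det_one] at this
  have hM1 : M' * M'ᴴ = 1 := by
    rw [hM', conjTranspose_mul, diagonal_conjTranspose, mul_assoc, ← mul_assoc (diagonal _),
      diagonal_mul_diagonal]
    have : (fun i => (![1, star M.det, 1] : Fin 3 → CT) i *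
        star (![1, star M.det, 1] : Fin 3 → CT) i) = fun _ => 1 := by
      ext i : 1
      fin_cases i <;> simp [mul_comm, hdd]
    rw [this, diagonal_one, one_mul, hM]
  have hd1 : M'.det = 1 := by
    rw [hM', det_mul, det_diagonal]
    simp [Fin.prod_univ_three, hdd]
  have hcol : (fun i => M' i 0) = fun i => M i 0 := by
    ext i : 1
    simp [hM', mul_diagonal]
  have h1 := evPos_bordered_column hM1 hd1
  rw [hcol] at h1
  have h2 := evPos_of_path (γ := fun t : ℝ => bordered fun i =>
    ((1 - t : ℝ) : ℂ) • M i 0 + (t : ℂ) • h i)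
    (continuous_bordered.comp (by fun_prop)) fun t ht => isUnit_bordered fun x => by
      obtain ⟨i, hi⟩ := hh x
      obtain ⟨r, hr0, hr⟩ := hr x
      refine ⟨i, ?_⟩
      have e : (((1 - t : ℝ) : ℂ) • M i 0 + (t : ℂ) • h i) x =
          (((1 - t) * r + t : ℝ) : ℂ) * h i x := by
        simp [hr i]
        ring
      rw [e]
      refine mul_ne_zero (Complex.ofReal_ne_zero.mpr (ne_of_gt ?_)) hi
      rcases ht.1.eq_or_lt with h0 | h0
      · subst h0
        simpa using hr0
      · have := mul_nonneg (sub_nonneg.mpr ht.2) hr0.le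
        linarith
  refine h1.imp₂ h2 fun lam ρ k1 k2 => ?_
  have e0 : (fun i => ((1 - 0 : ℝ) : ℂ) • M i 0 + ((0 : ℝ) : ℂ) • h i) = fun i => M i 0 := by
    ext i x
    simp
  have e1 : (fun i => ((1 - 1 : ℝ) : ℂ) • M i 0 + ((1 : ℝ) : ℂ) • h i) = h := by
    ext i x
    simp
  simp only [e0, e1] at k2
  exact pos_of_mul_pos_right k2 k1.le

end Bordered

section Slots

open UnitAddTorus MeasureTheory
open Matrix
open scoped Kronecker ComplexOrder MatrixOrder

variable {κ σ : Type*} [Fintype κ] [DecidableEq κ] [Fintype σ] [DecidableEq σ]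

/-- Separate the `j`-th coordinate of a multi-index. -/
def slotEquiv (κ σ : Type*) (j : Fin 5) :
    (Fin 5 → κ) × σ ≃ (κ × σ) × ({i : Fin 5 // i ≠ j} → κ) :=
  ((Equiv.funSplitAt j κ).prodCongr (Equiv.refl σ)).trans
    ⟨fun p => ((p.1.1, p.2), p.1.2), fun p => ((p.1.1, p.2), p.1.2), fun _ => rfl, fun _ => rfl⟩

/-- A matrix acting on the `j`-th coordinate of a multi-index and on the spinor index. -/
def slot (j : Fin 5) :
    Matrix (κ × σ) (κ × σ) ℂ →ₐ[ℂ] Matrix ((Fin 5 → κ) × σ) ((Fin 5 → κ) × σ) ℂ :=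
  AlgHom.ofLinearMap
    { toFun M := (M ⊗ₖ (1 : Matrix ({i : Fin 5 // i ≠ j} → κ) _ ℂ)).submatrix
        (slotEquiv κ σ j) (slotEquiv κ σ j)
      map_add' M N := by rw [add_kronecker, submatrix_add]; rfl
      map_smul' c M := by rw [smul_kronecker, submatrix_smul]; rfl }
    (by
      show submatrix _ _ _ = _
      rw [one_kronecker_one, submatrix_one_equiv])
    (fun M N => by
      show submatrix _ _ _ = submatrix _ _ _ * submatrix _ _ _
      rw [submatrix_mul_equiv, ← mul_kronecker_mul, one_mul])

lemma slot_eq (j : Fin 5) (M : Matrix (κ × σ) (κ × σ) ℂ) :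
    slot j M = (M ⊗ₖ (1 : Matrix ({i : Fin 5 // i ≠ j} → κ) _ ℂ)).submatrix
        (slotEquiv κ σ j) (slotEquiv κ σ j) := rfl

lemma slot_apply (j : Fin 5) (M : Matrix (κ × σ) (κ × σ) ℂ) (p q : (Fin 5 → κ) × σ) :
    slot j M p q = if ∀ i, i ≠ j → p.1 i = q.1 i then M (p.1 j, p.2) (q.1 j, q.2) else 0 := by
  rw [slot_eq, submatrix_apply, kroneckerMap_apply, one_apply]
  have h : (slotEquiv κ σ j p).2 = (slotEquiv κ σ j q).2 ↔ ∀ i, i ≠ j → p.1 i = q.1 i :=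
    ⟨fun h i hi => congrFun h ⟨i, hi⟩, fun h => funext fun i => h i.1 i.2⟩
  simp only [h, mul_ite, mul_one, mul_zero]
  rfl

lemma slot_posSemidef (j : Fin 5) {M : Matrix (κ × σ) (κ × σ) ℂ} (hM : M.PosSemidef) :
    (slot j M).PosSemidef :=
  (hM.kronecker PosSemidef.one).submatrix _

lemma slot_conjTranspose (j : Fin 5) (M : Matrix (κ × σ) (κ × σ) ℂ) :
    (slot j M)ᴴ = slot j Mᴴ := by
  rw [slot_eq, slot_eq, conjTranspose_submatrix, conjTranspose_kronecker, conjTranspose_one]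

lemma slot_diagonal (j : Fin 5) (d : κ → ℂ) (P : Matrix σ σ ℂ) :
    slot j (diagonal d ⊗ₖ P) = diagonal (fun k : Fin 5 → κ => d (k j)) ⊗ₖ P := by
  ext p q
  rw [slot_apply, kroneckerMap_apply, kroneckerMap_apply, diagonal_apply, diagonal_apply]
  by_cases h : p.1 = q.1
  · simp [h]
  · rw [if_neg h, zero_mul]
    refine ite_eq_right_iff.mpr fun h' => ?_
    rw [if_neg, zero_mul]
    refine fun hj => h (funext fun i => ?_)
    by_cases hi : i = j
    · rw [hi]; exact hj
    · exact h' i hi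

lemma slot_one_kronecker (j : Fin 5) (P : Matrix σ σ ℂ) :
    slot j ((1 : Matrix κ κ ℂ) ⊗ₖ P) = (1 : Matrix (Fin 5 → κ) (Fin 5 → κ) ℂ) ⊗ₖ P := by
  rw [← diagonal_one, slot_diagonal, diagonal_one]

lemma slot_mul_slot_apply {i j : Fin 5} (hij : i ≠ j) (A B : Matrix κ κ ℂ)
    (p q : (Fin 5 → κ) × σ) :
    (slot i (A ⊗ₖ (1 : Matrix σ σ ℂ)) * slot j (B ⊗ₖ (1 : Matrix σ σ ℂ))) p q =
      if (∀ a, a ≠ i → a ≠ j → p.1 a = q.1 a) ∧ p.2 = q.2 then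
        A (p.1 i) (q.1 i) * B (p.1 j) (q.1 j) else 0 := by
  rw [mul_apply, Finset.sum_eq_single (Function.update p.1 i (q.1 i), p.2)]
  · simp only [slot_apply, kroneckerMap_apply, one_apply, Function.update_self, mul_ite, mul_one,
      mul_zero, if_true]
    rw [if_pos fun a ha => (Function.update_of_ne ha _ _).symm,
      Function.update_of_ne hij.symm]
    have h : (∀ a, a ≠ j → Function.update p.1 i (q.1 i) a = q.1 a) ↔
        ∀ a, a ≠ i → a ≠ j → p.1 a = q.1 a := by
      refine forall_congr' fun a => ?_
      by_cases ha : a = i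
      · subst ha; simp
      · simp [ha]
    rw [ite_and]
    simp only [h]
  · intro m _ hm
    rw [slot_apply, slot_apply]
    by_contra hne
    have h1 := left_ne_zero_of_mul hne
    have h2 := right_ne_zero_of_mul hne
    rw [Ne, ite_eq_right_iff] at h1 h2
    push Not at h1 h2
    obtain ⟨h1, h1'⟩ := h1
    obtain ⟨h2, h2'⟩ := h2
    refine hm (Prod.ext (funext fun a => ?_) ?_)
    · by_cases ha : a = i
      · subst ha
        simpa using h2 a hij
      · simpa [ha] using (h1 a ha).symm
    · rw [kroneckerMap_apply] at h1'
      have := right_ne_zero_of_mul h1'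
      rw [one_apply] at this
      by_contra hc
      exact this (if_neg fun h => hc h.symm)
  · simp

lemma slot_commute {i j : Fin 5} (hij : i ≠ j) (A B : Matrix κ κ ℂ) :
    Commute (slot i (A ⊗ₖ (1 : Matrix σ σ ℂ))) (slot j (B ⊗ₖ (1 : Matrix σ σ ℂ))) := by
  ext p q
  rw [slot_mul_slot_apply hij, slot_mul_slot_apply hij.symm]
  simp only [mul_comm (A _ _)]
  congr 1
  refine propext (and_congr_left fun _ => ⟨fun h a h1 h2 => h a h2 h1, fun h a h1 h2 => h a h2 h1⟩)

lemma slot_kronecker (j : Fin 5) (A : Matrix κ κ ℂ) (P : Matrix σ σ ℂ) :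
    slot j (A ⊗ₖ P) = slot j (A ⊗ₖ (1 : Matrix σ σ ℂ)) *
      ((1 : Matrix (Fin 5 → κ) (Fin 5 → κ) ℂ) ⊗ₖ P) := by
  rw [← slot_one_kronecker j, ← map_mul, ← mul_kronecker_mul, mul_one, one_mul]

lemma slot_commute_kronecker (j : Fin 5) (A : Matrix κ κ ℂ) (P : Matrix σ σ ℂ) :
    Commute (slot j (A ⊗ₖ (1 : Matrix σ σ ℂ)))
      ((1 : Matrix (Fin 5 → κ) (Fin 5 → κ) ℂ) ⊗ₖ P) := by
  rw [← slot_one_kronecker j, commute_iff_eq, ← map_mul, ← map_mul, ← mul_kronecker_mul,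
    ← mul_kronecker_mul, mul_one, one_mul, mul_one, one_mul]

lemma slot_mul_slot_posSemidef {i j : Fin 5} (hij : i ≠ j) {A B : Matrix κ κ ℂ}
    (hA : A.PosSemidef) (hB : B.PosSemidef) :
    (slot i (A ⊗ₖ (1 : Matrix σ σ ℂ)) * slot j (B ⊗ₖ (1 : Matrix σ σ ℂ))).PosSemidef := by
  obtain ⟨a, rfl⟩ := CStarAlgebra.nonneg_iff_eq_star_mul_self.mp hA.nonneg
  obtain ⟨b, rfl⟩ := CStarAlgebra.nonneg_iff_eq_star_mul_self.mp hB.nonneg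
  rw [star_eq_conjTranspose, star_eq_conjTranspose]
  have h : slot i ((aᴴ * a) ⊗ₖ (1 : Matrix σ σ ℂ)) * slot j ((bᴴ * b) ⊗ₖ (1 : Matrix σ σ ℂ)) =
      (slot i (a ⊗ₖ (1 : Matrix σ σ ℂ)) * slot j (b ⊗ₖ (1 : Matrix σ σ ℂ)))ᴴ *
      (slot i (a ⊗ₖ (1 : Matrix σ σ ℂ)) * slot j (b ⊗ₖ (1 : Matrix σ σ ℂ))) := by
    have h1 (j : Fin 5) (c : Matrix κ κ ℂ) : slot j ((cᴴ * c) ⊗ₖ (1 : Matrix σ σ ℂ)) =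
        slot j (cᴴ ⊗ₖ (1 : Matrix σ σ ℂ)) * slot j (c ⊗ₖ (1 : Matrix σ σ ℂ)) := by
      rw [← map_mul, ← mul_kronecker_mul, one_mul]
    rw [h1, h1, conjTranspose_mul, slot_conjTranspose, slot_conjTranspose, conjTranspose_kronecker,
      conjTranspose_kronecker, conjTranspose_one, ← (slot_commute hij aᴴ bᴴ).eq, mul_assoc,
      ← mul_assoc _ (slot j (bᴴ ⊗ₖ _)), (slot_commute hij a bᴴ).eq]
    simp only [mul_assoc]
  rw [h]
  exact posSemidef_conjTranspose_mul_self _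

end Slots

section Frames

open UnitAddTorus MeasureTheory
open Matrix
open scoped Kronecker ComplexOrder MatrixOrder

variable {κ σ : Type*} [Fintype κ] [DecidableEq κ] [Fintype σ] [DecidableEq σ]

omit [DecidableEq σ] in
lemma nonneg_of_isHermitian_sq {W : Matrix σ σ ℂ} (hW : Wᴴ = W) : 0 ≤ W * W := by
  simpa only [hW] using (posSemidef_conjTranspose_mul_self W).nonneg

lemma half_one_add_nonneg {W : Matrix σ σ ℂ} (hW : Wᴴ = W) (hW' : W * W = 1) :
    0 ≤ (1 / 2 : ℂ) • (1 + W) := by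
  have h : (1 / 2 : ℂ) • (1 + W) = ((1 / 2 : ℂ) • (1 + W)) * ((1 / 2 : ℂ) • (1 + W)) := by
    rw [smul_mul_smul_comm, add_mul, mul_add, mul_add, hW', mul_one, mul_one, one_mul]
    module
  rw [h]
  refine nonneg_of_isHermitian_sq ?_
  rw [conjTranspose_smul, conjTranspose_add, hW, conjTranspose_one]
  simp

lemma half_one_sub_nonneg {W : Matrix σ σ ℂ} (hW : Wᴴ = W) (hW' : W * W = 1) :
    0 ≤ (1 / 2 : ℂ) • (1 - W) := by
  rw [sub_eq_add_neg]
  refine half_one_add_nonneg ?_ ?_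
  · rw [conjTranspose_neg, hW]
  · rw [neg_mul_neg, hW']

omit [DecidableEq κ] in
lemma kronecker_one_add_nonneg {P X : Matrix κ κ ℂ} {W : Matrix σ σ ℂ} (hp : 0 ≤ P + X)
    (hm : 0 ≤ P - X) (hW : Wᴴ = W) (hW' : W * W = 1) : 0 ≤ P ⊗ₖ (1 : Matrix σ σ ℂ) + X ⊗ₖ W := by
  have h : P ⊗ₖ (1 : Matrix σ σ ℂ) + X ⊗ₖ W = (P + X) ⊗ₖ ((1 / 2 : ℂ) • (1 + W)) +
      (P - X) ⊗ₖ ((1 / 2 : ℂ) • (1 - W)) := by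
    simp only [add_kronecker, sub_eq_add_neg, kronecker_smul, kronecker_add, neg_kronecker,
      kronecker_neg]
    module
  rw [h]
  exact add_nonneg
    (hp.posSemidef.kronecker (half_one_add_nonneg hW hW').posSemidef).nonneg
    (hm.posSemidef.kronecker (half_one_sub_nonneg hW hW').posSemidef).nonneg

/-- Three Hermitian matrices whose first member almost generates rotations of the other two,
with the bounds that keep the associated localizer invertible. -/
structure IsTriple (lam : ℝ) (K S C : Matrix κ κ ℂ) : Prop where
  hK : Kᴴ = K
  hS : Sᴴ = S
  hC : Cᴴ = C
  KS : K * S - S * K = -(Complex.I • C)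
  KC : K * C - C * K = Complex.I • S
  add_S : 0 ≤ (lam : ℂ) • 1 + S
  sub_S : 0 ≤ (lam : ℂ) • 1 - S
  add_C : 0 ≤ (lam : ℂ) • 1 + C
  sub_C : 0 ≤ (lam : ℂ) • 1 - C
  add_comm : 0 ≤ K * K + S * S + C * C - ((lam : ℂ) ^ 2 - lam) • 1 + Complex.I • (S * C - C * S)
  sub_comm : 0 ≤ K * K + S * S + C * C - ((lam : ℂ) ^ 2 - lam) • 1 - Complex.I • (S * C - C * S)

/-- Eleven anticommuting Hermitian square roots of one. -/
structure IsFrame (A B : Fin 5 → Matrix σ σ ℂ) (G : Matrix σ σ ℂ) : Prop where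
  hA : IsClifford A
  hB : IsClifford B
  herm : Gᴴ = G
  sq : G * G = 1
  AB : ∀ i j, A i * B j + B j * A i = 0
  AG : ∀ i, A i * G + G * A i = 0
  BG : ∀ i, B i * G + G * B i = 0

section anticommuting
variable {A B : Matrix σ σ ℂ} (hA : Aᴴ = A) (hB : Bᴴ = B) (hA' : A * A = 1) (hB' : B * B = 1)
  (h : A * B + B * A = 0)
omit [DecidableEq σ] in
include hA hB h in
lemma conjTranspose_I_smul_mul : (Complex.I • (A * B))ᴴ = Complex.I • (A * B) := by
  rw [conjTranspose_smul, conjTranspose_mul, hA, hB, eq_neg_of_add_eq_zero_left h]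
  simp

include hA' hB' h in
lemma I_smul_mul_sq : (Complex.I • (A * B)) * (Complex.I • (A * B)) = 1 := by
  rw [smul_mul_smul_comm, Complex.I_mul_I]
  nth_rewrite 1 [eq_neg_of_add_eq_zero_left h]
  rw [neg_mul, mul_assoc, ← mul_assoc A, hA', one_mul, hB', smul_neg, neg_smul, neg_neg, one_smul]

omit [DecidableEq κ] [DecidableEq σ] in
include h in
lemma kronecker_mul_kronecker_add (K S : Matrix κ κ ℂ) :
    (K ⊗ₖ A) * (S ⊗ₖ B) + (S ⊗ₖ B) * (K ⊗ₖ A) = (K * S - S * K) ⊗ₖ (A * B) := by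
  rw [← mul_kronecker_mul, ← mul_kronecker_mul, eq_neg_of_add_eq_zero_right h, kronecker_neg,
    sub_eq_add_neg, add_kronecker, neg_kronecker]

end anticommuting

lemma IsTriple.site_sq {lam : ℝ} {K S C : Matrix κ κ ℂ} (hT : IsTriple lam K S C)
    {A B : Fin 5 → Matrix σ σ ℂ} {G : Matrix σ σ ℂ} (hF : IsFrame A B G) (j : Fin 5) :
    ((lam : ℂ) ^ 2 - 3 * lam) • (1 : Matrix (κ × σ) (κ × σ) ℂ) ≤
      (K ⊗ₖ A j + S ⊗ₖ B j + C ⊗ₖ G) * (K ⊗ₖ A j + S ⊗ₖ B j + C ⊗ₖ G) := by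
  have e1 := kronecker_mul_kronecker_add (hF.AB j j) K S
  have e2 := kronecker_mul_kronecker_add (hF.AG j) K C
  have e3 := kronecker_mul_kronecker_add (hF.BG j) S C
  rw [hT.KS] at e1
  rw [hT.KC] at e2
  have s1 : (K ⊗ₖ A j) * (K ⊗ₖ A j) = (K * K) ⊗ₖ (1 : Matrix σ σ ℂ) := by
    rw [← mul_kronecker_mul, hF.hA.sq]
  have s2 : (S ⊗ₖ B j) * (S ⊗ₖ B j) = (S * S) ⊗ₖ (1 : Matrix σ σ ℂ) := by
    rw [← mul_kronecker_mul, hF.hB.sq]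
  have s3 : (C ⊗ₖ G) * (C ⊗ₖ G) = (C * C) ⊗ₖ (1 : Matrix σ σ ℂ) := by
    rw [← mul_kronecker_mul, hF.sq]
  have n1 := kronecker_one_add_nonneg (W := Complex.I • (A j * B j))
    (X := -C) (P := (lam : ℂ) • 1) (by simpa [← sub_eq_add_neg] using hT.sub_C)
    (by simpa using hT.add_C)
    (conjTranspose_I_smul_mul (hF.hA.herm j) (hF.hB.herm j) (hF.AB j j))
    (I_smul_mul_sq (hF.hA.sq j) (hF.hB.sq j) (hF.AB j j))
  have n2 := kronecker_one_add_nonneg (W := Complex.I • (A j * G)) hT.add_S hT.sub_S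
    (conjTranspose_I_smul_mul (hF.hA.herm j) hF.herm (hF.AG j))
    (I_smul_mul_sq (hF.hA.sq j) hF.sq (hF.AG j))
  have n3 := kronecker_one_add_nonneg (W := Complex.I • (B j * G))
    (X := -(Complex.I • (S * C - C * S)))
    (P := K * K + S * S + C * C - ((lam : ℂ) ^ 2 - lam) • 1)
    (by simpa only [← sub_eq_add_neg] using hT.sub_comm)
    (by simpa only [sub_neg_eq_add] using hT.add_comm)
    (conjTranspose_I_smul_mul (hF.hB.herm j) hF.herm (hF.BG j))
    (I_smul_mul_sq (hF.hB.sq j) hF.sq (hF.BG j))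
  rw [← sub_nonneg]
  convert add_nonneg (add_nonneg n1 n2) n3 using 1
  have hx : (K ⊗ₖ A j + S ⊗ₖ B j + C ⊗ₖ G) * (K ⊗ₖ A j + S ⊗ₖ B j + C ⊗ₖ G) =
      (K ⊗ₖ A j) * (K ⊗ₖ A j) + (S ⊗ₖ B j) * (S ⊗ₖ B j) + (C ⊗ₖ G) * (C ⊗ₖ G) +
      ((K ⊗ₖ A j) * (S ⊗ₖ B j) + (S ⊗ₖ B j) * (K ⊗ₖ A j)) +
      ((K ⊗ₖ A j) * (C ⊗ₖ G) + (C ⊗ₖ G) * (K ⊗ₖ A j)) +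
      ((S ⊗ₖ B j) * (C ⊗ₖ G) + (C ⊗ₖ G) * (S ⊗ₖ B j)) := by noncomm_ring
  rw [hx, e1, e2, e3, s1, s2, s3]
  simp only [neg_kronecker, sub_eq_add_neg, add_kronecker, kronecker_smul, smul_kronecker,
    smul_add, smul_neg, one_kronecker_one, smul_smul, Complex.I_mul_I]
  module

lemma sq_add_mul {R : Type*} [Ring R] {Q g T : R} (hg : g * g = 1) (hQ : Q * g + g * Q = 0)
    (hT : T * g = g * T) : (Q + g * T) * (Q + g * T) = Q * Q + T * T + g * (T * Q - Q * T) := by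
  have h1 : Q * (g * T) = -(g * (Q * T)) := by
    rw [← mul_assoc, eq_neg_of_add_eq_zero_left hQ, neg_mul, mul_assoc]
  have h2 : g * T * (g * T) = T * T := by
    rw [mul_assoc, ← mul_assoc T, hT, mul_assoc g T T, ← mul_assoc g, hg, one_mul]
  rw [add_mul, mul_add, mul_add, h1, h2, mul_assoc, mul_sub]
  abel

lemma sum_commutator {R : Type*} [Ring R] (c q : Fin 5 → R)
    (h : ∀ i j, i ≠ j → c i * q j = q j * c i) :
    (∑ i, c i) * (∑ j, q j) - (∑ j, q j) * ∑ i, c i = ∑ i, (c i * q i - q i * c i) := by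
  rw [Finset.sum_mul_sum, Finset.sum_mul_sum,
    Finset.sum_comm (γ := Fin 5) (f := fun i j => q i * c j),
    ← Finset.sum_sub_distrib]
  refine Finset.sum_congr rfl fun i _ => ?_
  rw [← Finset.sum_sub_distrib]
  refine Finset.sum_eq_single_of_mem i (Finset.mem_univ i) fun j _ hj => ?_
  rw [h i j hj.symm, sub_self]

lemma sum_sq_add {R : Type*} [Ring R] [Algebra ℂ R] (q c : Fin 5 → R) {g : R} (lam : ℂ)
    (hg : g * g = 1) (hq : ∀ i j, i ≠ j → q i * q j + q j * q i = 0)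
    (hqg : ∀ j, q j * g + g * q j = 0) (hcg : ∀ j, c j * g = g * c j)
    (hcq : ∀ i j, i ≠ j → c i * q j = q j * c i) :
    (∑ j, (q j + g * c j) + (4 * lam) • g) * (∑ j, (q j + g * c j) + (4 * lam) • g) =
      ∑ j, (q j + g * c j) * (q j + g * c j) +
      ∑ i, ∑ j ∈ Finset.univ.erase i, (lam • 1 + c i) * (lam • 1 + c j) - (4 * lam ^ 2) • 1 := by
  have h0 : ∑ j, (q j + g * c j) + (4 * lam) • g = ∑ j, q j + g * (∑ j, c j + (4 * lam) • 1) := by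
    rw [Finset.sum_add_distrib, mul_add, Finset.mul_sum, mul_smul_comm, mul_one, add_assoc]
  have hQ : (∑ j, q j) * g + g * ∑ j, q j = 0 := by
    rw [Finset.sum_mul, Finset.mul_sum, ← Finset.sum_add_distrib]
    exact Finset.sum_eq_zero fun j _ => hqg j
  have hT : (∑ j, c j + (4 * lam) • 1) * g = g * (∑ j, c j + (4 * lam) • 1) := by
    rw [add_mul, mul_add, Finset.sum_mul, Finset.mul_sum, smul_mul_assoc, mul_smul_comm, one_mul,
      mul_one]
    simp only [hcg]
  rw [h0, sq_add_mul hg hQ hT, sum_sq_of_anticommute _ _ fun i _ j _ hij => hq i j hij]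
  have h1 : (∑ j, c j + (4 * lam) • 1) * (∑ j, q j) - (∑ j, q j) * (∑ j, c j + (4 * lam) • 1) =
      ∑ i, (c i * q i - q i * c i) := by
    rw [← sum_commutator c q hcq, add_mul, mul_add, smul_mul_assoc, mul_smul_comm, one_mul, mul_one]
    abel
  have h2 : ∀ j, (q j + g * c j) * (q j + g * c j) =
      q j * q j + c j * c j + g * (c j * q j - q j * c j) := fun j =>
    sq_add_mul hg (hqg j) (hcg j)
  have h3 : ∀ i, ∑ j ∈ Finset.univ.erase i, (lam • 1 + c i) * (lam • 1 + c j) =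
      (lam • 1 + c i) * ((5 * lam) • 1 + ∑ j, c j) - (lam • 1 + c i) * (lam • 1 + c i) := by
    intro i
    rw [← Finset.mul_sum, ← mul_sub]
    congr 1
    rw [Finset.sum_erase_eq_sub (Finset.mem_univ i), Finset.sum_add_distrib, Finset.sum_const,
      Finset.card_univ, Fintype.card_fin]
    module
  have h4 : ∀ i, (lam • 1 + c i) * (lam • 1 + c i) = c i * c i + (2 * lam) • c i + lam ^ 2 • 1 := by
    intro i
    simp only [add_mul, mul_add, smul_mul_assoc, mul_smul_comm, one_mul, mul_one]
    module
  simp only [h1, h2, h3, h4]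
  simp only [Finset.sum_sub_distrib, ← Finset.sum_mul]
  simp only [Finset.sum_add_distrib, Finset.sum_const, Finset.card_univ, Fintype.card_fin,
    ← Finset.smul_sum, ← Finset.mul_sum, add_mul, mul_add, smul_mul_assoc, mul_smul_comm, one_mul,
    mul_one, mul_sub, smul_add, Finset.sum_sub_distrib]
  simp only [← Nat.cast_smul_eq_nsmul ℂ, Nat.cast_ofNat]
  module

/-- The localizer assembled from one-dimensional data. -/
def assemble (lam : ℝ) (K S C : Matrix κ κ ℂ) (A B : Fin 5 → Matrix σ σ ℂ) (G : Matrix σ σ ℂ) :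
    Matrix ((Fin 5 → κ) × σ) ((Fin 5 → κ) × σ) ℂ :=
  ∑ j, slot j (K ⊗ₖ A j + S ⊗ₖ B j + C ⊗ₖ G) + (4 * lam : ℂ) • (1 ⊗ₖ G)

end Frames

section Assembly

open UnitAddTorus MeasureTheory
open Matrix
open scoped Kronecker ComplexOrder MatrixOrder

variable {κ σ : Type*} [Fintype κ] [DecidableEq κ] [Fintype σ] [DecidableEq σ]

lemma slot_mul_slot (i j : Fin 5) (X Y : Matrix κ κ ℂ) (P R : Matrix σ σ ℂ) :
    slot i (X ⊗ₖ P) * slot j (Y ⊗ₖ R) =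
      slot i (X ⊗ₖ (1 : Matrix σ σ ℂ)) * slot j (Y ⊗ₖ (1 : Matrix σ σ ℂ)) *
        ((1 : Matrix (Fin 5 → κ) (Fin 5 → κ) ℂ) ⊗ₖ (P * R)) := by
  rw [slot_kronecker i X, slot_kronecker j Y, mul_assoc, ← mul_assoc (_ ⊗ₖ P),
    ← (slot_commute_kronecker j Y P).eq, mul_assoc (slot j _), ← mul_kronecker_mul, one_mul,
    mul_assoc]

lemma slot_anticommute {i j : Fin 5} (hij : i ≠ j) (X Y : Matrix κ κ ℂ) {P R : Matrix σ σ ℂ}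
    (h : P * R + R * P = 0) :
    slot i (X ⊗ₖ P) * slot j (Y ⊗ₖ R) + slot j (Y ⊗ₖ R) * slot i (X ⊗ₖ P) = 0 := by
  rw [slot_mul_slot i, slot_mul_slot j, ← (slot_commute hij X Y).eq, ← mul_add,
    ← kronecker_add, h, kronecker_zero, mul_zero]

lemma slot_commute' {i j : Fin 5} (hij : i ≠ j) (X Y : Matrix κ κ ℂ) {P R : Matrix σ σ ℂ}
    (h : P * R = R * P) :
    slot i (X ⊗ₖ P) * slot j (Y ⊗ₖ R) = slot j (Y ⊗ₖ R) * slot i (X ⊗ₖ P) := by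
  rw [slot_mul_slot i, slot_mul_slot j, ← (slot_commute hij X Y).eq, h]

variable {A B : Fin 5 → Matrix σ σ ℂ} {G : Matrix σ σ ℂ}

lemma IsFrame.slot_anticommute (hF : IsFrame A B G) (K S : Matrix κ κ ℂ) {i j : Fin 5}
    (hij : i ≠ j) : slot i (K ⊗ₖ A i + S ⊗ₖ B i) * slot j (K ⊗ₖ A j + S ⊗ₖ B j) +
      slot j (K ⊗ₖ A j + S ⊗ₖ B j) * slot i (K ⊗ₖ A i + S ⊗ₖ B i) = 0 := by
  have h1 := Lowpass.slot_anticommute hij K K (hF.hA.anti i j hij)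
  have h2 := Lowpass.slot_anticommute hij K S (hF.AB i j)
  have h3 := Lowpass.slot_anticommute hij S K ((add_comm _ _).trans (hF.AB j i))
  have h4 := Lowpass.slot_anticommute hij S S (hF.hB.anti i j hij)
  simp only [map_add, add_mul, mul_add]
  calc _ = _ := ?_
    _ = _ := congrArg₂ (· + ·) (congrArg₂ (· + ·) h1 h2) (congrArg₂ (· + ·) h3 h4)
    _ = _ := by simp
  abel

lemma IsFrame.slot_anticommute_kronecker (hF : IsFrame A B G) (K S : Matrix κ κ ℂ) (j : Fin 5) :
    slot j (K ⊗ₖ A j + S ⊗ₖ B j) * (1 ⊗ₖ G) + (1 ⊗ₖ G) * slot j (K ⊗ₖ A j + S ⊗ₖ B j) = 0 := by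
  rw [← slot_one_kronecker j, ← map_mul, ← map_mul, ← map_add, add_mul, mul_add]
  simp only [← mul_kronecker_mul, one_mul, mul_one]
  rw [eq_neg_of_add_eq_zero_left (hF.AG j), eq_neg_of_add_eq_zero_left (hF.BG j), kronecker_neg,
    kronecker_neg]
  refine (congrArg (slot j) ?_).trans (map_zero _)
  abel

lemma isUnit_of_smul_one_le_sq {ι : Type*} [Fintype ι] [DecidableEq ι] {L : Matrix ι ι ℂ} {c : ℝ}
    (hc : 0 < c) (h : (c : ℂ) • (1 : Matrix ι ι ℂ) ≤ L * L) : L.det ≠ 0 := by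
  have h1 : (L * L).PosDef := by
    have h2 : ((c : ℂ) • (1 : Matrix ι ι ℂ)).PosDef := by
      rw [smul_one_eq_diagonal]
      exact PosDef.diagonal fun _ => by exact_mod_cast hc
    simpa using h2.add_posSemidef (le_iff.mp h)
  intro h0
  have := h1.det_pos.ne'
  rw [det_mul, h0, zero_mul] at this
  exact this rfl

lemma IsTriple.det_assemble_ne_zero {lam : ℝ} {K S C : Matrix κ κ ℂ} (hT : IsTriple lam K S C)
    (hlam : 15 < lam) (hF : IsFrame A B G) : (assemble lam K S C A B G).det ≠ 0 := by
  refine isUnit_of_smul_one_le_sq (c := lam ^ 2 - 15 * lam) (by nlinarith) ?_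
  have hc (j : Fin 5) : slot j (C ⊗ₖ G) =
      ((1 : Matrix (Fin 5 → κ) (Fin 5 → κ) ℂ) ⊗ₖ G) * slot j (C ⊗ₖ (1 : Matrix σ σ ℂ)) := by
    rw [slot_kronecker, (slot_commute_kronecker j C G).eq]
  have h0 : assemble lam K S C A B G = ∑ j, (slot j (K ⊗ₖ A j + S ⊗ₖ B j) +
      (1 ⊗ₖ G) * slot j (C ⊗ₖ (1 : Matrix σ σ ℂ))) + (4 * lam : ℂ) • (1 ⊗ₖ G) := by
    simp only [assemble, map_add, hc]
  have hg : ((1 : Matrix (Fin 5 → κ) (Fin 5 → κ) ℂ) ⊗ₖ G) * (1 ⊗ₖ G) = 1 := by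
    rw [← mul_kronecker_mul, hF.sq, one_mul, one_kronecker_one]
  have hcq : ∀ i j : Fin 5, i ≠ j → slot i (C ⊗ₖ (1 : Matrix σ σ ℂ)) *
      slot j (K ⊗ₖ A j + S ⊗ₖ B j) = slot j (K ⊗ₖ A j + S ⊗ₖ B j) *
      slot i (C ⊗ₖ (1 : Matrix σ σ ℂ)) := fun i j hij => by
    rw [map_add, mul_add, add_mul, slot_commute' hij _ _ (by simp), slot_commute' hij _ _ (by simp)]
  rw [h0,
    sum_sq_add _ _ _ hg (fun i j => hF.slot_anticommute K S) (hF.slot_anticommute_kronecker K S)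
    (fun j => slot_commute_kronecker j C G) hcq]
  have h1 : ∀ j, ((lam : ℂ) ^ 2 - 3 * lam) • 1 ≤ (slot j (K ⊗ₖ A j + S ⊗ₖ B j) +
      (1 ⊗ₖ G) * slot j (C ⊗ₖ (1 : Matrix σ σ ℂ))) * (slot j (K ⊗ₖ A j + S ⊗ₖ B j) +
      (1 ⊗ₖ G) * slot j (C ⊗ₖ (1 : Matrix σ σ ℂ))) := by
    intro j
    rw [← hc, ← map_add, ← map_mul]
    have := slot_posSemidef j (le_iff.mp (hT.site_sq hF j))
    rw [map_sub, map_smul, map_one] at this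
    exact le_iff.mpr this
  have h2 : 0 ≤ ∑ i, ∑ j ∈ Finset.univ.erase i, ((lam : ℂ) • 1 + slot i (C ⊗ₖ (1 : Matrix σ σ ℂ))) *
      ((lam : ℂ) • 1 + slot j (C ⊗ₖ (1 : Matrix σ σ ℂ))) := by
    refine Finset.sum_nonneg fun i _ => Finset.sum_nonneg fun j hj => ?_
    have h3 : ∀ j, (lam : ℂ) • 1 + slot j (C ⊗ₖ (1 : Matrix σ σ ℂ)) =
        slot j (((lam : ℂ) • 1 + C) ⊗ₖ (1 : Matrix σ σ ℂ)) := fun j => by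
      rw [add_kronecker, smul_kronecker, one_kronecker_one, map_add, map_smul, map_one]
    rw [h3, h3]
    exact (slot_mul_slot_posSemidef (Finset.ne_of_mem_erase hj).symm hT.add_C.posSemidef
      hT.add_C.posSemidef).nonneg
  have h3 := add_le_add (Finset.sum_le_sum fun j (_ : j ∈ Finset.univ) => h1 j) h2
  rw [Finset.sum_const, Finset.card_univ, Fintype.card_fin, ← Nat.cast_smul_eq_nsmul ℂ] at h3
  refine le_trans (le_of_eq ?_) (sub_le_sub_right h3 _)
  push_cast
  module

lemma assemble_isHermitian (hF : IsFrame A B G) (lam : ℝ) {K S C : Matrix κ κ ℂ} (hK : Kᴴ = K)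
    (hS : Sᴴ = S) (hC : Cᴴ = C) : (assemble lam K S C A B G).IsHermitian := by
  rw [IsHermitian, assemble, conjTranspose_add, conjTranspose_sum, conjTranspose_smul,
    conjTranspose_kronecker, conjTranspose_one, hF.herm]
  simp only [slot_conjTranspose, conjTranspose_add, conjTranspose_kronecker, hK, hS, hC, hF.herm,
    hF.hA.herm, hF.hB.herm]
  simp

lemma assemble_path (hF : IsFrame A B G) {lam : ℝ → ℝ} {K S C : ℝ → Matrix κ κ ℂ}
    (hl : Continuous lam) (hK : Continuous K) (hS : Continuous S) (hC : Continuous C)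
    (hT : ∀ t ∈ Set.Icc (0 : ℝ) 1, IsTriple (lam t) (K t) (S t) (C t))
    (hlam : ∀ t ∈ Set.Icc (0 : ℝ) 1, 15 < lam t) :
    0 < (assemble (lam 0) (K 0) (S 0) (C 0) A B G).det.re *
      (assemble (lam 1) (K 1) (S 1) (C 1) A B G).det.re := by
  refine det_mul_det_pos_of_path (L := fun t => assemble (lam t) (K t) (S t) (C t) A B G) ?_
    (fun t ht => assemble_isHermitian hF _ (hT t ht).hK (hT t ht).hS (hT t ht).hC)
    fun t ht => (hT t ht).det_assemble_ne_zero (hlam t ht) hF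
  have hk (X : ℝ → Matrix κ κ ℂ) (P : Matrix σ σ ℂ) (hX : Continuous X) :
      Continuous fun t => X t ⊗ₖ P :=
    continuous_matrix fun p q => (hX.matrix_elem p.1 q.1).mul continuous_const
  have hs (j : Fin 5) (X : ℝ → Matrix (κ × σ) (κ × σ) ℂ) (hX : Continuous X) :
      Continuous fun t => slot j (X t) := by
    refine continuous_matrix fun p q => ?_
    simp only [slot_apply]
    split_ifs
    · exact hX.matrix_elem _ _
    · exact continuous_const
  have hl' : Continuous fun t => (4 * lam t : ℂ) := by fun_prop
  refine (continuous_finsetSum _ fun j _ => hs j _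
    (((hk _ _ hK).add (hk _ _ hS)).add (hk _ _ hC))).add
    (hl'.smul continuous_const)

end Assembly

section Su2

open UnitAddTorus MeasureTheory
open Matrix
open scoped Kronecker ComplexOrder MatrixOrder

variable {κ : Type*} [Fintype κ] [DecidableEq κ]

lemma smul_one_add_nonneg {lam : ℝ} (hlam : 0 < lam) {X : Matrix κ κ ℂ} (hX : Xᴴ = X)
    (h : X * X ≤ (lam : ℂ) ^ 2 • 1) : 0 ≤ (lam : ℂ) • 1 + X := by
  have h1 : (lam : ℂ) • 1 + X = (1 / (2 * lam) : ℂ) •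
      (((lam : ℂ) • 1 + X) * ((lam : ℂ) • 1 + X) + ((lam : ℂ) ^ 2 • 1 - X * X)) := by
    have h2 : ((lam : ℂ) • 1 + X) * ((lam : ℂ) • 1 + X) + ((lam : ℂ) ^ 2 • 1 - X * X) =
        (2 * lam : ℂ) • ((lam : ℂ) • 1 + X) := by
      simp only [add_mul, mul_add, smul_mul_assoc, mul_smul_comm, one_mul, mul_one]
      module
    rw [h2, smul_smul, one_div_mul_cancel, one_smul]
    exact mul_ne_zero two_ne_zero (by exact_mod_cast hlam.ne')
  rw [h1]
  refine (PosSemidef.smul (add_nonneg (nonneg_of_isHermitian_sq ?_)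
    (sub_nonneg.mpr h)).posSemidef ?_).nonneg
  · rw [conjTranspose_add, conjTranspose_smul, conjTranspose_one, hX]
    simp
  · have : (0 : ℝ) ≤ 1 / (2 * lam) := by positivity
    exact_mod_cast this

lemma smul_one_sub_nonneg {lam : ℝ} (hlam : 0 < lam) {X : Matrix κ κ ℂ} (hX : Xᴴ = X)
    (h : X * X ≤ (lam : ℂ) ^ 2 • 1) : 0 ≤ (lam : ℂ) • 1 - X := by
  rw [sub_eq_add_neg]
  exact smul_one_add_nonneg hlam (by rw [conjTranspose_neg, hX]) (by rwa [neg_mul_neg])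

/-- A Hermitian representation of `su(2)` with Casimir `lam ^ 2`. -/
structure IsSu2 (lam : ℝ) (K S C : Matrix κ κ ℂ) : Prop where
  hK : Kᴴ = K
  hS : Sᴴ = S
  hC : Cᴴ = C
  KS : K * S - S * K = -(Complex.I • C)
  KC : K * C - C * K = Complex.I • S
  SC : S * C - C * S = -(Complex.I • K)
  casimir : K * K + S * S + C * C = (lam : ℂ) ^ 2 • 1

lemma IsSu2.isTriple {lam : ℝ} {K S C : Matrix κ κ ℂ} (h : IsSu2 lam K S C) (hlam : 0 < lam) :
    IsTriple lam K S C := by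
  have hKK := nonneg_of_isHermitian_sq h.hK
  have hSS := nonneg_of_isHermitian_sq h.hS
  have hCC := nonneg_of_isHermitian_sq h.hC
  have hK' : K * K ≤ (lam : ℂ) ^ 2 • 1 := by
    rw [← h.casimir, add_assoc]
    exact le_add_of_nonneg_right (add_nonneg hSS hCC)
  have hS' : S * S ≤ (lam : ℂ) ^ 2 • 1 := by
    rw [← h.casimir, add_comm (K * K), add_assoc]
    exact le_add_of_nonneg_right (add_nonneg hKK hCC)
  have hC' : C * C ≤ (lam : ℂ) ^ 2 • 1 := by
    rw [← h.casimir]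
    exact le_add_of_nonneg_left (add_nonneg hKK hSS)
  refine ⟨h.hK, h.hS, h.hC, h.KS, h.KC, smul_one_add_nonneg hlam h.hS hS',
    smul_one_sub_nonneg hlam h.hS hS', smul_one_add_nonneg hlam h.hC hC',
    smul_one_sub_nonneg hlam h.hC hC', ?_, ?_⟩
  · convert smul_one_add_nonneg hlam h.hK hK' using 1
    rw [h.casimir, h.SC, smul_neg, smul_smul, Complex.I_mul_I]
    module
  · convert smul_one_sub_nonneg hlam h.hK hK' using 1
    rw [h.casimir, h.SC, smul_neg, smul_smul, Complex.I_mul_I]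
    module

lemma IsSu2.rotate {lam : ℝ} {K S C : Matrix κ κ ℂ} (h : IsSu2 lam K S C) {c s : ℝ}
    (hcs : c ^ 2 + s ^ 2 = 1) :
    IsSu2 lam ((c : ℂ) • K + (s : ℂ) • C) S ((c : ℂ) • C - (s : ℂ) • K) := by
  have e1 := eq_add_of_sub_eq h.KS
  have e2 := eq_add_of_sub_eq h.KC
  have e3 := eq_add_of_sub_eq h.SC
  have hcs' (X : Matrix κ κ ℂ) : X = ((c : ℂ) ^ 2 + (s : ℂ) ^ 2) • X := by
    rw [show (c : ℂ) ^ 2 + (s : ℂ) ^ 2 = 1 by exact_mod_cast hcs, one_smul]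
  refine ⟨?_, h.hS, ?_, ?_, ?_, ?_, ?_⟩
  · rw [conjTranspose_add, conjTranspose_smul, conjTranspose_smul, h.hK, h.hC]
    simp
  · rw [conjTranspose_sub, conjTranspose_smul, conjTranspose_smul, h.hK, h.hC]
    simp
  · simp only [add_mul, mul_add, smul_mul_assoc, mul_smul_comm, e1, e3]
    module
  · rw [hcs' (Complex.I • S)]
    simp only [add_mul, mul_add, sub_mul, mul_sub, smul_mul_assoc, mul_smul_comm, e2]
    module
  · simp only [sub_mul, mul_sub, smul_mul_assoc, mul_smul_comm, e1, e3]
    module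
  · rw [← h.casimir, hcs' (K * K), hcs' (C * C)]
    simp only [add_mul, mul_add, sub_mul, mul_sub, smul_mul_assoc, mul_smul_comm]
    module

section ladder
variable {K Z : Matrix κ κ ℂ}

/-- The real part of a matrix. -/
def rePart (Z : Matrix κ κ ℂ) : Matrix κ κ ℂ := (1 / 2 : ℂ) • (Z + Zᴴ)

/-- The imaginary part of a matrix. -/
def imPart (Z : Matrix κ κ ℂ) : Matrix κ κ ℂ := (Complex.I / 2) • (Zᴴ - Z)

omit [Fintype κ] [DecidableEq κ] in
lemma rePart_conjTranspose (Z : Matrix κ κ ℂ) : (rePart Z)ᴴ = rePart Z := by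
  simp [rePart, conjTranspose_smul, add_comm]

omit [Fintype κ] [DecidableEq κ] in
lemma imPart_conjTranspose (Z : Matrix κ κ ℂ) : (imPart Z)ᴴ = imPart Z := by
  simp only [imPart, conjTranspose_smul, conjTranspose_sub, conjTranspose_conjTranspose]
  simp only [star_div₀, RCLike.star_def, Complex.conj_I, map_ofNat]
  module

lemma commutator_imPart (hK : Kᴴ = K) (hZ : K * Z - Z * K = Z) :
    K * imPart Z - imPart Z * K = -(Complex.I • rePart Z) := by
  have hZ' := congrArg conjTranspose hZ
  rw [conjTranspose_sub, conjTranspose_mul, conjTranspose_mul, hK] at hZ'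
  simp only [imPart, rePart, mul_smul_comm, smul_mul_assoc, mul_sub, sub_mul]
  rw [eq_add_of_sub_eq hZ, eq_add_of_sub_eq hZ']
  module

lemma commutator_rePart (hK : Kᴴ = K) (hZ : K * Z - Z * K = Z) :
    K * rePart Z - rePart Z * K = Complex.I • imPart Z := by
  have hZ' := congrArg conjTranspose hZ
  rw [conjTranspose_sub, conjTranspose_mul, conjTranspose_mul, hK] at hZ'
  simp only [imPart, rePart, mul_smul_comm, smul_mul_assoc, mul_add, add_mul, smul_smul,
    mul_div_assoc', Complex.I_mul_I]
  rw [eq_add_of_sub_eq hZ, eq_add_of_sub_eq hZ']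
  module

lemma imPart_sq_add_rePart_sq (Z : Matrix κ κ ℂ) :
    imPart Z * imPart Z + rePart Z * rePart Z = (1 / 2 : ℂ) • (Z * Zᴴ + Zᴴ * Z) := by
  simp only [imPart, rePart, mul_smul_comm, smul_mul_assoc, add_mul, mul_add, sub_mul, mul_sub]
  match_scalars <;> ring_nf <;> simp only [Complex.I_sq] <;> ring

lemma commutator_imPart_rePart (Z : Matrix κ κ ℂ) :
    Complex.I • (imPart Z * rePart Z - rePart Z * imPart Z) =
      (1 / 2 : ℂ) • (Z * Zᴴ - Zᴴ * Z) := by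
  simp only [imPart, rePart, mul_smul_comm, smul_mul_assoc, smul_smul, add_mul, mul_add, sub_mul,
    mul_sub, smul_sub, smul_add]
  match_scalars <;> ring_nf <;> simp only [Complex.I_sq] <;> ring

end ladder

end Su2

section Ladder

open UnitAddTorus MeasureTheory
open Matrix
open scoped Kronecker ComplexOrder MatrixOrder

variable {κ : Type*} [Fintype κ] [DecidableEq κ]

lemma isTriple_ladder {lam : ℝ} (hlam : 0 < lam) {K Z : Matrix κ κ ℂ} (hK : Kᴴ = K)
    (hZ : K * Z - Z * K = Z) (hU : Z * Zᴴ ≤ (lam : ℂ) ^ 2 • 1) (hD : Zᴴ * Z ≤ (lam : ℂ) ^ 2 • 1)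
    (hU' : ((lam : ℂ) ^ 2 - lam) • 1 ≤ K * K + Z * Zᴴ)
    (hD' : ((lam : ℂ) ^ 2 - lam) • 1 ≤ K * K + Zᴴ * Z) :
    IsTriple lam K (imPart Z) (rePart Z) := by
  have h0 : (0 : ℂ) ≤ 1 / 2 := by
    rw [show (1 / 2 : ℂ) = ((1 / 2 : ℝ) : ℂ) by push_cast; rfl]
    exact Complex.zero_le_real.mpr (by norm_num)
  have hle : imPart Z * imPart Z + rePart Z * rePart Z ≤ (lam : ℂ) ^ 2 • 1 := by
    rw [imPart_sq_add_rePart_sq, ← sub_nonneg]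
    have := ((add_nonneg (sub_nonneg.mpr hU) (sub_nonneg.mpr hD)).posSemidef.smul h0).nonneg
    convert this using 1
    module
  have hS := (le_add_of_nonneg_right
    (nonneg_of_isHermitian_sq (rePart_conjTranspose Z))).trans hle
  have hC := (le_add_of_nonneg_left
    (nonneg_of_isHermitian_sq (imPart_conjTranspose Z))).trans hle
  refine ⟨hK, imPart_conjTranspose Z, rePart_conjTranspose Z, commutator_imPart hK hZ,
    commutator_rePart hK hZ, smul_one_add_nonneg hlam (imPart_conjTranspose Z) hS,
    smul_one_sub_nonneg hlam (imPart_conjTranspose Z) hS,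
    smul_one_add_nonneg hlam (rePart_conjTranspose Z) hC,
    smul_one_sub_nonneg hlam (rePart_conjTranspose Z) hC, ?_, ?_⟩
  · rw [add_assoc (K * K), imPart_sq_add_rePart_sq, commutator_imPart_rePart]
    convert sub_nonneg.mpr hU' using 1
    module
  · rw [add_assoc (K * K), imPart_sq_add_rePart_sq, commutator_imPart_rePart]
    convert sub_nonneg.mpr hD' using 1
    module

lemma isSu2_ladder {lam : ℝ} {K Z : Matrix κ κ ℂ} (hK : Kᴴ = K)
    (hZ : K * Z - Z * K = Z) (h1 : K * K + (1 / 2 : ℂ) • (Z * Zᴴ + Zᴴ * Z) = (lam : ℂ) ^ 2 • 1)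
    (h2 : (1 / 2 : ℂ) • (Z * Zᴴ - Zᴴ * Z) = K) : IsSu2 lam K (imPart Z) (rePart Z) where
  hK := hK
  hS := imPart_conjTranspose Z
  hC := rePart_conjTranspose Z
  KS := commutator_imPart hK hZ
  KC := commutator_rePart hK hZ
  SC := by
    rw [← h2, ← commutator_imPart_rePart, smul_smul, Complex.I_mul_I, neg_one_smul, neg_neg]
  casimir := by rw [add_assoc, imPart_sq_add_rePart_sq, h1]

/-- The frequency operator in one dimension. -/
def numOp (ρ : ℕ) : Matrix (Fin (2 * ρ + 1)) (Fin (2 * ρ + 1)) ℂ :=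
  diagonal fun i => (((i : ℤ) - ρ : ℤ) : ℂ)

/-- A weighted shift. -/
def shift (n : ℕ) (w : ℕ → ℝ) : Matrix (Fin n) (Fin n) ℂ :=
  of fun a b => if (a : ℕ) = b + 1 then (w b : ℂ) else 0

lemma numOp_conjTranspose (ρ : ℕ) : (numOp ρ)ᴴ = numOp ρ := by
  rw [numOp, diagonal_conjTranspose]
  congr
  ext i
  simp

lemma numOp_commutator (ρ : ℕ) (w : ℕ → ℝ) :
    numOp ρ * shift (2 * ρ + 1) w - shift (2 * ρ + 1) w * numOp ρ = shift (2 * ρ + 1) w := by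
  ext a b
  rw [Matrix.sub_apply, numOp, diagonal_mul, mul_diagonal, shift, of_apply]
  split_ifs with h
  · rw [h]
    push_cast
    ring
  · simp

lemma shift_mul_conjTranspose (n : ℕ) (w : ℕ → ℝ) : shift n w * (shift n w)ᴴ =
    diagonal fun i : Fin n => ((if (i : ℕ) = 0 then 0 else w (i - 1) ^ 2 : ℝ) : ℂ) := by
  ext a b
  simp only [mul_apply, conjTranspose_apply, shift, of_apply, diagonal_apply]
  by_cases ha : (a : ℕ) = 0
  · rw [if_pos ha, Complex.ofReal_zero, ite_self]
    exact Finset.sum_eq_zero fun m _ => by rw [if_neg (by omega), zero_mul]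
  · rw [if_neg ha, Finset.sum_eq_single ⟨a - 1, by omega⟩]
    · rw [if_pos (by simp; omega)]
      simp only [Fin.ext_iff]
      by_cases hab : (a : ℕ) = b
      · rw [if_pos hab, if_pos (by omega)]
        simp [sq]
      · rw [if_neg hab, if_neg (by omega)]
        simp
    · intro m _ hm
      rw [if_neg, zero_mul]
      exact fun h => hm (Fin.ext (by simp; omega))
    · simp

lemma conjTranspose_mul_shift (n : ℕ) (w : ℕ → ℝ) : (shift n w)ᴴ * shift n w =
    diagonal fun i : Fin n => ((if (i : ℕ) + 1 < n then w i ^ 2 else 0 : ℝ) : ℂ) := by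
  ext a b
  simp only [mul_apply, conjTranspose_apply, shift, of_apply, diagonal_apply]
  by_cases ha : (a : ℕ) + 1 < n
  · rw [if_pos ha, Finset.sum_eq_single ⟨a + 1, ha⟩]
    · simp only [Fin.ext_iff]
      rw [if_pos trivial]
      by_cases hab : (a : ℕ) = b
      · rw [if_pos hab, if_pos (by omega), hab]
        simp [sq]
      · rw [if_neg hab, if_neg (by omega)]
        simp
    · intro m _ hm
      rw [if_neg, star_zero, zero_mul]
      exact fun h => hm (Fin.ext (by simp; omega))
    · simp
  · rw [if_neg ha, Complex.ofReal_zero, ite_self]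
    exact Finset.sum_eq_zero fun m _ => by rw [if_neg (by omega), star_zero, zero_mul]

omit [Fintype κ] in
lemma diagonal_ofReal_le {x y : κ → ℝ} (h : ∀ i, x i ≤ y i) :
    (diagonal fun i => (x i : ℂ)) ≤ diagonal fun i => (y i : ℂ) := by
  rw [le_iff, diagonal_sub]
  refine PosSemidef.diagonal fun i => ?_
  show (0 : ℂ) ≤ (y i : ℂ) - x i
  rw [← Complex.ofReal_sub]
  exact Complex.zero_le_real.mpr (sub_nonneg.mpr (h i))

omit [Fintype κ] in
lemma smul_one_eq_diagonal_ofReal (c : ℝ) :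
    (c : ℂ) • (1 : Matrix κ κ ℂ) = diagonal fun _ => (c : ℂ) := smul_one_eq_diagonal _

lemma numOp_mul_self (ρ : ℕ) :
    numOp ρ * numOp ρ =
      diagonal fun i : Fin (2 * ρ + 1) => (((((i : ℕ) : ℝ) - ρ) ^ 2 : ℝ) : ℂ) := by
  rw [numOp, diagonal_mul_diagonal]
  congr
  ext i
  push_cast
  ring

/-- The bond weights interpolating between the shift and the ladder operator of `su(2)`. -/
def weight (ρ : ℕ) (lam t : ℝ) (i : ℕ) : ℝ :=
  √((1 - t) * lam ^ 2 + t * ((i + 1) * (2 * ρ - i)))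

/-- The scale matching `weight`. -/
def scale (ρ : ℕ) (lam t : ℝ) : ℝ := √((1 - t) * lam ^ 2 + t * (ρ * (ρ + 1)))

section path
variable {ρ : ℕ} {lam t : ℝ}

lemma sq_weight (ht : t ∈ Set.Icc (0 : ℝ) 1) {i : ℕ} (hi : i ≤ 2 * ρ) :
    weight ρ lam t i ^ 2 = (1 - t) * lam ^ 2 + t * ((i + 1) * (2 * ρ - i)) := by
  have h1 : (i : ℝ) ≤ 2 * ρ := by exact_mod_cast hi
  have := sub_nonneg.mpr ht.2
  have := ht.1
  have := sub_nonneg.mpr h1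
  exact Real.sq_sqrt (by positivity)

lemma sq_scale (ht : t ∈ Set.Icc (0 : ℝ) 1) :
    scale ρ lam t ^ 2 = (1 - t) * lam ^ 2 + t * (ρ * (ρ + 1)) := by
  have := sub_nonneg.mpr ht.2
  have := ht.1
  exact Real.sq_sqrt (by positivity)

lemma le_scale (ht : t ∈ Set.Icc (0 : ℝ) 1) (hlam : 0 ≤ lam) (hρ : lam ≤ ρ) :
    lam ≤ scale ρ lam t := by
  refine Real.le_sqrt_of_sq_le ?_
  have := ht.1
  nlinarith [mul_nonneg this hlam, mul_nonneg this (sub_nonneg.mpr hρ), mul_nonneg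
    (mul_nonneg this hlam) (sub_nonneg.mpr hρ), mul_nonneg
    (mul_nonneg this (hlam.trans hρ)) (sub_nonneg.mpr hρ)]

lemma mul_le_scale (ht : t ∈ Set.Icc (0 : ℝ) 1) : t * ρ ≤ scale ρ lam t := by
  refine Real.le_sqrt_of_sq_le ?_
  have h1 := ht.1
  have h2 := sub_nonneg.mpr ht.2
  have h3 : (0 : ℝ) ≤ ρ := Nat.cast_nonneg ρ
  nlinarith [mul_nonneg h2 (sq_nonneg lam), mul_nonneg h1 h3, mul_nonneg (mul_nonneg h1 h2)
    (sq_nonneg (ρ : ℝ))]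

lemma isTriple_path (ht : t ∈ Set.Icc (0 : ℝ) 1) (hlam : 0 < lam) (hρ : lam ≤ ρ) :
    IsTriple (scale ρ lam t) (numOp ρ) (imPart (shift (2 * ρ + 1) (weight ρ lam t)))
      (rePart (shift (2 * ρ + 1) (weight ρ lam t))) := by
  have h1 := ht.1
  have h2 := sub_nonneg.mpr ht.2
  have hs := mul_le_scale (ρ := ρ) (lam := lam) ht
  have hss := sq_scale (ρ := ρ) (lam := lam) ht
  have hρ0 : (0 : ℝ) ≤ ρ := Nat.cast_nonneg ρ
  have e1 : (scale ρ lam t : ℂ) ^ 2 = ((scale ρ lam t ^ 2 : ℝ) : ℂ) := by push_cast; rfl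
  have e2 : (scale ρ lam t : ℂ) ^ 2 - scale ρ lam t =
    ((scale ρ lam t ^ 2 - scale ρ lam t : ℝ) : ℂ) := by push_cast; rfl
  have hprod (k : ℤ) : 0 ≤ (k : ℝ) * (k + 1) := by
    have : 0 ≤ k * (k + 1) := by
      rcases le_or_gt 0 k with h | h
      · positivity
      · nlinarith
    exact_mod_cast this
  have hlam2 : lam ^ 2 ≤ ρ ^ 2 := by gcongr
  refine isTriple_ladder (hlam.trans_le (le_scale ht hlam.le hρ)) (numOp_conjTranspose ρ)
    (numOp_commutator ρ _) ?_ ?_ ?_ ?_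
  · rw [shift_mul_conjTranspose, e1, smul_one_eq_diagonal_ofReal]
    refine diagonal_ofReal_le fun i => ?_
    split_ifs with hi
    · positivity
    · obtain ⟨m, hm⟩ := Nat.exists_eq_succ_of_ne_zero hi
      have := i.2
      rw [hm, Nat.succ_sub_one, sq_weight ht (by omega), hss]
      have := hprod (m - ρ)
      push_cast at this
      nlinarith [mul_nonneg h1 this]
  · rw [conjTranspose_mul_shift, e1, smul_one_eq_diagonal_ofReal]
    refine diagonal_ofReal_le fun i => ?_
    split_ifs with hi
    · rw [sq_weight ht (by omega), hss]
      have := hprod ((i : ℕ) - ρ)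
      push_cast at this
      nlinarith [mul_nonneg h1 this]
    · positivity
  · rw [shift_mul_conjTranspose, numOp_mul_self, e2, smul_one_eq_diagonal_ofReal, diagonal_add]
    simp only [← Complex.ofReal_add]
    refine diagonal_ofReal_le fun i => ?_
    split_ifs with hi
    · rw [hi, hss]
      push_cast
      nlinarith [mul_nonneg h2 (sub_nonneg.mpr hlam2)]
    · obtain ⟨m, hm⟩ := Nat.exists_eq_succ_of_ne_zero hi
      have := i.2
      have hm' : (m : ℝ) ≤ 2 * ρ := by exact_mod_cast (by omega : m ≤ 2 * ρ)
      rw [hm, Nat.succ_sub_one, sq_weight ht (by omega), hss]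
      push_cast
      nlinarith [mul_nonneg h2 (sq_nonneg ((m : ℝ) + 1 - ρ)),
        mul_nonneg h1 (m.cast_nonneg (α := ℝ)),
        mul_nonneg h1 (sub_nonneg.mpr hm')]
  · rw [conjTranspose_mul_shift, numOp_mul_self, e2, smul_one_eq_diagonal_ofReal, diagonal_add]
    simp only [← Complex.ofReal_add]
    refine diagonal_ofReal_le fun i => ?_
    have hi' : ((i : ℕ) : ℝ) ≤ 2 * ρ := by exact_mod_cast (by omega : (i : ℕ) ≤ 2 * ρ)
    split_ifs with hi
    · rw [sq_weight ht (by omega), hss]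
      nlinarith [mul_nonneg h2 (sq_nonneg ((i : ℕ) - ρ : ℝ)),
        mul_nonneg h1 ((i : ℕ).cast_nonneg (α := ℝ)),
        mul_nonneg h1 (sub_nonneg.mpr hi')]
    · rw [show ((i : ℕ) : ℝ) = 2 * ρ by exact_mod_cast (by omega : (i : ℕ) = 2 * ρ), hss]
      nlinarith [mul_nonneg h2 (sub_nonneg.mpr hlam2)]

lemma isSu2_path_one : IsSu2 (scale ρ lam 1) (numOp ρ)
    (imPart (shift (2 * ρ + 1) (weight ρ lam 1)))
    (rePart (shift (2 * ρ + 1) (weight ρ lam 1))) := by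
  have ht : (1 : ℝ) ∈ Set.Icc (0 : ℝ) 1 := by simp
  have hu (i : Fin (2 * ρ + 1)) : (if (i : ℕ) = 0 then 0 else weight ρ lam 1 (i - 1) ^ 2) =
      (i : ℝ) * (2 * ρ + 1 - i) := by
    split_ifs with hi
    · simp [hi]
    · obtain ⟨m, hm⟩ := Nat.exists_eq_succ_of_ne_zero hi
      have := i.2
      rw [hm, Nat.succ_sub_one, sq_weight ht (by omega)]
      push_cast
      ring
  have hd (i : Fin (2 * ρ + 1)) : (if (i : ℕ) + 1 < 2 * ρ + 1 then weight ρ lam 1 i ^ 2 else 0) =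
      ((i : ℝ) + 1) * (2 * ρ - i) := by
    split_ifs with hi
    · rw [sq_weight ht (by omega)]
      ring
    · rw [show ((i : ℕ) : ℝ) = 2 * ρ by exact_mod_cast (by omega : (i : ℕ) = 2 * ρ)]
      ring
  refine isSu2_ladder (numOp_conjTranspose ρ) (numOp_commutator ρ _) ?_ ?_
  · rw [shift_mul_conjTranspose, conjTranspose_mul_shift, numOp_mul_self,
      show (scale ρ lam 1 : ℂ) ^ 2 = ((scale ρ lam 1 ^ 2 : ℝ) : ℂ) by push_cast; rfl,
      smul_one_eq_diagonal_ofReal, diagonal_add, ← diagonal_smul, diagonal_add]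
    congr
    ext i
    rw [Pi.smul_apply, hu, hd, sq_scale ht, smul_eq_mul]
    push_cast
    ring
  · rw [shift_mul_conjTranspose, conjTranspose_mul_shift, numOp, diagonal_sub, ← diagonal_smul]
    congr
    ext i
    rw [Pi.smul_apply, hu, hd, smul_eq_mul]
    push_cast
    ring

end path

end Ladder

section Target

open UnitAddTorus MeasureTheory
open Matrix
open scoped Kronecker ComplexOrder MatrixOrder

lemma bordered_add (p q : Fin 3 → ℂ) : bordered (p + q) = bordered p + bordered q := by
  ext i j
  rcases i with i | i <;> rcases j with j | j
  · fin_cases i <;> fin_cases j <;> simp [bordered] <;> ring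
  all_goals simp [bordered]

lemma bordered_smul (r : ℝ) (p : Fin 3 → ℂ) : bordered (r • p) = r • bordered p := by
  ext i j
  rcases i with i | i <;> rcases j with j | j
  · fin_cases i <;> fin_cases j <;> simp [bordered]
  all_goals simp [bordered]

/-- The Hermitian matrices attached to the points of `ℂ³`. -/
def cliff : (Fin 3 → ℂ) →ₗ[ℝ] Matrix (Spin × (Fin 3 ⊕ Unit)) (Spin × (Fin 3 ⊕ Unit)) ℂ where
  toFun p := offDiag (bordered p)
  map_add' p q := by
    simp only [offDiag, bordered_add, conjTranspose_add, kronecker_add]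
    abel
  map_smul' r p := by
    simp only [offDiag, bordered_smul, conjTranspose_smul, star_trivial, kronecker_smul, smul_add,
      RingHom.id_apply]

lemma cliff_apply (p : Fin 3 → ℂ) : cliff p = offDiag (bordered p) := rfl

lemma cliff_mul_self {p : Fin 3 → ℂ} (hp : ∑ i, p i * star (p i) = 1) : cliff p * cliff p = 1 :=
  offDiag_mul_self (by rw [bordered_mul_conjTranspose, hp, one_smul])

lemma cliff_anticommute {p q : Fin 3 → ℂ} (hp : ∑ i, p i * star (p i) = 1)
    (hq : ∑ i, q i * star (q i) = 1) (hpq : ∑ i, (p i * star (q i) + q i * star (p i)) = 0) :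
    cliff p * cliff q + cliff q * cliff p = 0 := by
  have h1 := cliff_mul_self (p := (3 / 5 : ℝ) • p + (4 / 5 : ℝ) • q) <| by
    simp only [Fin.sum_univ_three, Pi.add_apply, Pi.smul_apply, map_add, map_mul, RCLike.star_def,
      Complex.real_smul, Complex.conj_ofReal] at hp hq hpq ⊢
    push_cast
    linear_combination (9 / 25 : ℂ) * hp + (16 / 25 : ℂ) * hq + (12 / 25 : ℂ) * hpq
  rw [map_add, map_smul, map_smul] at h1
  simp only [add_mul, mul_add, smul_mul_assoc, mul_smul_comm, cliff_mul_self hp,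
    cliff_mul_self hq] at h1
  have h2 : (12 / 25 : ℝ) • (cliff p * cliff q + cliff q * cliff p) = 0 := by
    rw [← sub_eq_zero] at h1
    rw [← h1]
    module
  exact (smul_eq_zero.mp h2).resolve_left (by norm_num)

/-- The first coordinate vector. -/
def poleVec : Fin 3 → ℂ := ![1, 0, 0]

/-- The real-orthonormal complement of `poleVec`. -/
def dirVec : Fin 5 → Fin 3 → ℂ :=
  ![![Complex.I, 0, 0], ![0, 1, 0], ![0, Complex.I, 0], ![0, 0, 1], ![0, 0, Complex.I]]

lemma poleVec_unit : ∑ i, poleVec i * star (poleVec i) = 1 := by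
  simp [poleVec, Fin.sum_univ_three]

lemma dirVec_unit (j : Fin 5) : ∑ i, dirVec j i * star (dirVec j i) = 1 := by
  fin_cases j <;> simp [dirVec, Fin.sum_univ_three]

lemma isFrame_cliff : IsFrame (gamN (Fin 3 ⊕ Unit)) (fun j => cliff (dirVec j))
    (cliff poleVec) where
  hA := gamN_isClifford
  hB := {
    herm := fun _ => offDiag_isHermitian _
    sq := fun j => cliff_mul_self (dirVec_unit j)
    anti := fun i j hij => cliff_anticommute (dirVec_unit i) (dirVec_unit j) <| by
      fin_cases i <;> fin_cases j <;> simp [dirVec, Fin.sum_univ_three] at hij ⊢ }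
  herm := offDiag_isHermitian _
  sq := cliff_mul_self poleVec_unit
  AB i j := gamN_mul_offDiag i _
  AG i := gamN_mul_offDiag i _
  BG i := cliff_anticommute (dirVec_unit i) poleVec_unit <| by
    fin_cases i <;> simp [dirVec, poleVec, Fin.sum_univ_three]

/-- `sin (2 π x_j)`. -/
def sinF (j : Fin 5) : CT :=
  (Complex.I / 2) • (mFourier (-Pi.single j 1) - mFourier (Pi.single j 1))

/-- `4 + ∑ cos (2 π x_j)`. -/
def cosF : CT :=
  4 + ∑ j : Fin 5, (1 / 2 : ℂ) • (mFourier (Pi.single j 1) + mFourier (-Pi.single j 1))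

/-- The unnormalized low-pass data. -/
def hFun (i : Fin 3) : CT := ∑ j, dirVec j i • sinF j + poleVec i • cosF

lemma star_mFourier_apply (n : Fin 5 → ℤ) (x : Torus 5) :
    conj (mFourier n x) = mFourier (-n) x :=
  congrArg (fun f : CT => f x) (star_mFourier n)

lemma sinF_apply (j : Fin 5) (x : Torus 5) :
    sinF j x = (((mFourier (Pi.single j 1 : Fin 5 → ℤ) x).im : ℝ) : ℂ) := by
  rw [sinF, ContinuousMap.smul_apply, ContinuousMap.sub_apply, ← star_mFourier_apply, smul_eq_mul]
  apply Complex.ext <;> simp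
  ring

lemma cosF_apply (x : Torus 5) :
    cosF x = ((4 + ∑ j, (mFourier (Pi.single j 1 : Fin 5 → ℤ) x).re : ℝ) : ℂ) := by
  rw [cosF, ContinuousMap.add_apply, ContinuousMap.sum_apply]
  push_cast
  congr 1
  refine Finset.sum_congr rfl fun j _ => ?_
  change (1 / 2 : ℂ) * ((mFourier (Pi.single j 1) : CT) x + (mFourier (-Pi.single j 1) : CT) x) = _
  rw [← star_mFourier_apply]
  apply Complex.ext <;> simp
  ring

lemma hFun_apply (x : Torus 5) : (fun i => hFun i x) =
    ∑ j, (mFourier (Pi.single j 1 : Fin 5 → ℤ) x).im • dirVec j +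
      (4 + ∑ j, (mFourier (Pi.single j 1 : Fin 5 → ℤ) x).re) • poleVec := by
  ext i
  simp only [hFun, ContinuousMap.add_apply, ContinuousMap.sum_apply, ContinuousMap.smul_apply,
    sinF_apply, cosF_apply, Pi.add_apply, Finset.sum_apply, Pi.smul_apply, smul_eq_mul,
    Complex.real_smul, mul_comm]

lemma evalAt_bordered (h : Fin 3 → CT) (x : Torus 5) :
    evalAt (bordered h) x = bordered fun i => h i x := by
  ext i j
  rcases i with i | i <;> rcases j with j | j
  · fin_cases i <;> fin_cases j <;> simp [bordered]
  all_goals simp [bordered]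

lemma symb_hFun (p q : Spin × (Fin 3 ⊕ Unit)) : symb (bordered hFun) p q =
    ∑ j, cliff (dirVec j) p q • sinF j + cliff poleVec p q • cosF := by
  ext x
  rw [← evalAt_apply, evalAt_symb, evalAt_bordered, hFun_apply, ← cliff_apply, map_add, map_sum,
    Matrix.add_apply, Matrix.sum_apply]
  simp only [map_smul, Matrix.smul_apply, ContinuousMap.add_apply, ContinuousMap.sum_apply,
    ContinuousMap.smul_apply, sinF_apply, cosF_apply, smul_eq_mul, Complex.real_smul, mul_comm]

lemma freq_sub_freq_eq_single {ρ : ℕ} (k l : Box ρ) (j : Fin 5) :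
    freq k - freq l = Pi.single j 1 ↔ (∀ i, i ≠ j → k i = l i) ∧ (k j : ℕ) = l j + 1 := by
  constructor
  · intro h
    refine ⟨fun i hi => ?_, ?_⟩
    · have := congrFun h i
      simp only [freq, Pi.sub_apply, Pi.single_eq_of_ne hi] at this
      omega
    · have := congrFun h j
      simp only [freq, Pi.sub_apply, Pi.single_eq_same] at this
      omega
  · rintro ⟨h1, h2⟩
    ext i
    by_cases hi : i = j
    · subst hi
      simp only [freq, Pi.sub_apply, Pi.single_eq_same]
      omega
    · simp [freq, hi, h1 i hi]

lemma freq_sub_freq_eq_neg_single {ρ : ℕ} (k l : Box ρ) (j : Fin 5) :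
    freq k - freq l = -Pi.single j 1 ↔ (∀ i, i ≠ j → k i = l i) ∧ (l j : ℕ) = k j + 1 := by
  rw [← neg_inj, neg_sub, neg_neg, freq_sub_freq_eq_single]
  simp only [eq_comm]

lemma weight_zero {ρ : ℕ} {lam : ℝ} (hlam : 0 ≤ lam) (i : ℕ) : weight ρ lam 0 i = lam := by
  simp [weight, Real.sqrt_sq hlam]

lemma scale_zero {ρ : ℕ} {lam : ℝ} (hlam : 0 ≤ lam) : scale ρ lam 0 = lam := by
  simp [scale, Real.sqrt_sq hlam]

variable {ρ : ℕ} {lam : ℝ}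

lemma slot_imPart_apply (hlam : 0 ≤ lam) (j : Fin 5) (p q : Box ρ × Spin × (Fin 3 ⊕ Unit))
    (W : Matrix (Spin × (Fin 3 ⊕ Unit)) (Spin × (Fin 3 ⊕ Unit)) ℂ) :
    slot j (imPart (shift (2 * ρ + 1) (weight ρ lam 0)) ⊗ₖ W) p q =
      lam * (W p.2 q.2 * fc (freq p.1 - freq q.1) (sinF j)) := by
  rw [slot_apply, kroneckerMap_apply, sinF, map_smul, map_sub, fc_mFourier, fc_mFourier]
  simp only [freq_sub_freq_eq_single, freq_sub_freq_eq_neg_single, imPart, shift,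
    Matrix.smul_apply, Matrix.sub_apply, conjTranspose_apply, of_apply, weight_zero hlam]
  by_cases h : ∀ i, i ≠ j → p.1 i = q.1 i
  · rw [if_pos h]
    simp only [and_iff_right h, smul_eq_mul]
    split_ifs <;> simp <;> ring
  · simp [h]

lemma slot_rePart_apply (hlam : 0 ≤ lam) (j : Fin 5) (p q : Box ρ × Spin × (Fin 3 ⊕ Unit))
    (W : Matrix (Spin × (Fin 3 ⊕ Unit)) (Spin × (Fin 3 ⊕ Unit)) ℂ) :
    slot j (rePart (shift (2 * ρ + 1) (weight ρ lam 0)) ⊗ₖ W) p q =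
      lam * (W p.2 q.2 * fc (freq p.1 - freq q.1)
        ((1 / 2 : ℂ) • (mFourier (Pi.single j 1) + mFourier (-Pi.single j 1)))) := by
  rw [slot_apply, kroneckerMap_apply, map_smul, map_add, fc_mFourier, fc_mFourier]
  simp only [freq_sub_freq_eq_single, freq_sub_freq_eq_neg_single, rePart, shift,
    Matrix.smul_apply, Matrix.add_apply, conjTranspose_apply, of_apply, weight_zero hlam]
  by_cases h : ∀ i, i ≠ j → p.1 i = q.1 i
  · rw [if_pos h]
    simp only [and_iff_right h, smul_eq_mul]
    split_ifs <;> simp <;> ring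
  · simp [h]

lemma loc_hFun (hlam : 0 ≤ lam) : loc ρ lam (bordered hFun) =
    assemble lam (numOp ρ) (imPart (shift (2 * ρ + 1) (weight ρ lam 0)))
      (rePart (shift (2 * ρ + 1) (weight ρ lam 0))) (gamN (Fin 3 ⊕ Unit))
      (fun j => cliff (dirVec j)) (cliff poleVec) := by
  have h4 (n : Fin 5 → ℤ) : fc n 4 = if n = 0 then 4 else 0 := by
    have : (4 : CT) = (4 : ℂ) • mFourier (0 : Fin 5 → ℤ) := by
      rw [mFourier_zero]
      ext x
      exact (mul_one _).symm
    rw [this, map_smul, fc_mFourier]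
    simp
  rw [loc, localizer, assemble, dirac]
  simp only [map_add, Finset.sum_add_distrib]
  rw [add_assoc, add_assoc]
  congr 1
  · refine Finset.sum_congr rfl fun j _ => ?_
    rw [numOp, slot_diagonal]
    rfl
  · ext p q
    simp only [Matrix.smul_apply, Matrix.add_apply, Matrix.sum_apply, slot_imPart_apply hlam,
      slot_rePart_apply hlam, toep, of_apply, symb_hFun, map_add, map_sum, map_smul, cosF, h4,
      kroneckerMap_apply, one_apply, sub_eq_zero, freq_injective.eq_iff, smul_eq_mul,
      ← Finset.mul_sum]
    split_ifs <;> ring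

end Target

section Reduction

open UnitAddTorus MeasureTheory
open Matrix
open scoped Kronecker ComplexOrder MatrixOrder

variable {ρ : ℕ} {lam : ℝ} {σ : Type*} [Fintype σ] [DecidableEq σ]
  {A B : Fin 5 → Matrix σ σ ℂ} {G : Matrix σ σ ℂ}

lemma mul_pos_trans {a b c : ℝ} (h1 : 0 < a * b) (h2 : 0 < b * c) : 0 < a * c := by
  have h3 : 0 < a * c * (b * b) := by
    linarith [mul_pos h1 h2, (by ring : a * b * (b * c) = a * c * (b * b))]
  exact pos_of_mul_pos_left h3 (mul_self_nonneg b)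

lemma continuous_shift_weight :
    Continuous fun t => shift (2 * ρ + 1) (weight ρ lam t) := by
  refine continuous_matrix fun a b => ?_
  simp only [shift, weight, of_apply]
  split_ifs <;> fun_prop

lemma assemble_shift_path (hF : IsFrame A B G) (hlam : 15 < lam) (hρ : lam ≤ ρ) :
    0 < (assemble lam (numOp ρ) (imPart (shift (2 * ρ + 1) (weight ρ lam 0)))
        (rePart (shift (2 * ρ + 1) (weight ρ lam 0))) A B G).det.re *
      (assemble (scale ρ lam 1) (numOp ρ) (imPart (shift (2 * ρ + 1) (weight ρ lam 1)))
        (rePart (shift (2 * ρ + 1) (weight ρ lam 1))) A B G).det.re := by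
  have hZ := continuous_shift_weight (ρ := ρ) (lam := lam)
  have h := assemble_path hF (lam := scale ρ lam) (K := fun _ => numOp ρ)
    (S := fun t => imPart (shift (2 * ρ + 1) (weight ρ lam t)))
    (C := fun t => rePart (shift (2 * ρ + 1) (weight ρ lam t)))
    (by unfold scale; fun_prop) continuous_const
    (by unfold imPart; fun_prop)
    (by unfold rePart; fun_prop)
    (fun t ht => isTriple_path ht (by linarith) hρ)
    (fun t ht => hlam.trans_le (le_scale ht (by linarith) hρ))
  simpa only [scale_zero (by linarith : (0 : ℝ) ≤ lam)] using h

lemma IsSu2.assemble_path {κ : Type*} [Fintype κ] [DecidableEq κ] {K S C : Matrix κ κ ℂ}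
    (h : IsSu2 lam K S C) (hF : IsFrame A B G) (hlam : 15 < lam) :
    0 < (assemble lam K S C A B G).det.re * (assemble lam C S (-K) A B G).det.re := by
  have h := Lowpass.assemble_path hF (lam := fun _ => lam)
    (K := fun t => (Real.cos (t * (π / 2)) : ℂ) • K + (Real.sin (t * (π / 2)) : ℂ) • C)
    (S := fun _ => S)
    (C := fun t => (Real.cos (t * (π / 2)) : ℂ) • C - (Real.sin (t * (π / 2)) : ℂ) • K)
    continuous_const (by fun_prop) continuous_const (by fun_prop)
    (fun t _ => (h.rotate (Real.cos_sq_add_sin_sq _)).isTriple (by linarith)) (fun _ _ => hlam)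
  simpa using h

lemma locDet_hFun_mul_pos (hlam : 15 < lam) (hρ : lam ≤ ρ) :
    0 < locDet ρ lam (bordered hFun) *
      (assemble (scale ρ lam 1) (rePart (shift (2 * ρ + 1) (weight ρ lam 1)))
        (imPart (shift (2 * ρ + 1) (weight ρ lam 1))) (-numOp ρ) (gamN (Fin 3 ⊕ Unit))
        (fun j => cliff (dirVec j)) (cliff poleVec)).det.re := by
  have h1 := assemble_shift_path isFrame_cliff hlam hρ
  have h2 := isSu2_path_one.assemble_path isFrame_cliff
    (hlam.trans_le (le_scale (ρ := ρ) (t := 1) (by simp) (by linarith) hρ))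
  rw [← loc_hFun (by linarith)] at h1
  exact mul_pos_trans h1 h2

end Reduction

section Projection

open UnitAddTorus MeasureTheory
open Matrix
open scoped Kronecker ComplexOrder MatrixOrder

variable {κ σ : Type*} [Fintype κ] [DecidableEq κ] [Fintype σ] [DecidableEq σ]

lemma det_eq_neg_one_of_trace {H : Matrix σ σ ℂ} (hH : H.IsHermitian) (hHH : H * H = 1)
    (htr : H.trace = Fintype.card σ - 2) : H.det = -1 := by
  have h1 (i : σ) : hH.eigenvalues i ^ 2 = 1 := by
    have h2 := hH.mulVec_eigenvectorBasis i
    have h3 : H *ᵥ (H *ᵥ hH.eigenvectorBasis i) =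
      (hH.eigenvalues i ^ 2) • ⇑(hH.eigenvectorBasis i) := by
      rw [h2, mulVec_smul, h2, smul_smul, sq]
    rw [mulVec_mulVec, hHH, one_mulVec] at h3
    have h4 : (hH.eigenvectorBasis i : σ → ℂ) ≠ 0 := fun h =>
      hH.eigenvectorBasis.toBasis.ne_zero i (by ext j; simpa using congrFun h j)
    have h5 : (1 - hH.eigenvalues i ^ 2) • (hH.eigenvectorBasis i : σ → ℂ) = 0 := by
      rw [sub_smul, one_smul, ← h3, sub_self]
    have := (smul_eq_zero.mp h5).resolve_right h4
    linarith
  have h2 (i : σ) : ∃ n : ℕ, hH.eigenvalues i = 1 - 2 * n ∧ hH.eigenvalues i = (-1) ^ n := by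
    rcases mul_self_eq_one_iff.mp ((sq _).symm.trans (h1 i)) with h | h
    · exact ⟨0, by simp [h], by simp [h]⟩
    · exact ⟨1, by rw [h]; norm_num, by simp [h]⟩
  choose n hn hn' using h2
  have h3 : ∑ i, n i = 1 := by
    rw [hH.trace_eq_sum_eigenvalues] at htr
    have h4 : ∑ i, (hH.eigenvalues i) = (Fintype.card σ : ℝ) - 2 := by
      have h5 : ((∑ i, hH.eigenvalues i : ℝ) : ℂ) = (((Fintype.card σ : ℝ) - 2 : ℝ) : ℂ) := by
        push_cast
        exact htr
      exact_mod_cast h5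
    simp only [hn, Finset.sum_sub_distrib, Finset.sum_const, Finset.card_univ, nsmul_eq_mul,
      mul_one,
      ← Finset.mul_sum] at h4
    have h5 : ((∑ i, n i : ℕ) : ℝ) = 1 := by
      push_cast
      linarith
    exact_mod_cast h5
  rw [hH.det_eq_prod_eigenvalues]
  simp only [hn']
  push_cast
  rw [Finset.prod_pow_eq_pow_sum, h3, pow_one]

/-- Simultaneous spectral projection of commuting involutions, each anticommuting with some
involution commuting with the others. -/
lemma exists_joint_projection {ι : Type*} [DecidableEq ι] {χ A : ι → Matrix σ σ ℂ}
    (hχ : ∀ i, (χ i)ᴴ = χ i) (hχχ : ∀ i, χ i * χ i = 1) (hc : ∀ i j, χ i * χ j = χ j * χ i)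
    (hA : ∀ i, A i * A i = 1) (hAχ : ∀ i, A i * χ i = -(χ i * A i))
    (hAχ' : ∀ i j, i ≠ j → A i * χ j = χ j * A i) (s : Finset ι) :
    ∃ e : Matrix σ σ ℂ, eᴴ = e ∧ e * e = e ∧ (∀ j ∈ s, χ j * e = -e) ∧
      (∀ v : σ → ℂ, (∀ j ∈ s, χ j *ᵥ v = -v) → e *ᵥ v = v) ∧
      (∀ x, (∀ j ∈ s, x * χ j = χ j * x) → x * e = e * x) ∧
      2 ^ s.card * e.trace = Fintype.card σ := by
  induction s using Finset.induction_on with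
  | empty => exact ⟨1, by simp, by simp, by simp, by simp, by simp, by simp⟩
  | insert j s hj ih =>
    obtain ⟨e, h1, h2, h3, h4, h5, h6⟩ := ih
    have hχe : χ j * e = e * χ j := h5 _ fun i _ => hc j i
    have hAe : A j * e = e * A j := h5 _ fun i hi => hAχ' j i (by rintro rfl; exact hj hi)
    have htr : (χ j * e).trace = 0 := by
      have h7 : (χ j * e).trace = -(χ j * e).trace := by
        calc (χ j * e).trace = (A j * (A j * (χ j * e))).trace := by
              rw [← mul_assoc, hA, one_mul]
          _ = -(A j * (χ j * e * A j)).trace := by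
              rw [← mul_assoc (A j) (χ j), hAχ, neg_mul, mul_neg, trace_neg, mul_assoc (χ j), hAe,
                ← mul_assoc (χ j)]
          _ = -(χ j * e).trace := by
              rw [trace_mul_comm, mul_assoc, hA, mul_one]
      exact self_eq_neg.mp h7
    refine ⟨(1 / 2 : ℂ) • (e - χ j * e), ?_, ?_, ?_, ?_, ?_, ?_⟩
    · rw [conjTranspose_smul, conjTranspose_sub, conjTranspose_mul, h1, hχ, ← hχe]
      simp
    · have e1 : e * (χ j * e) = χ j * e := by rw [hχe, ← mul_assoc, h2]
      have e2 : χ j * e * e = χ j * e := by rw [mul_assoc, h2]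
      have e3 : χ j * e * (χ j * e) = e := by
        rw [mul_assoc, e1, ← mul_assoc, hχχ, one_mul]
      rw [smul_mul_smul_comm, sub_mul, mul_sub, mul_sub, e1, e2, e3, h2]
      module
    · intro i hi
      rw [mul_smul_comm, mul_sub, ← mul_assoc]
      rcases Finset.mem_insert.mp hi with rfl | hi
      · rw [hχχ, one_mul, ← smul_neg, neg_sub]
      · rw [hc i j, mul_assoc, h3 i hi, mul_neg]
        module
    · intro v hv
      have hev := h4 v fun i hi => hv i (Finset.mem_insert_of_mem hi)
      rw [smul_mulVec, sub_mulVec, ← mulVec_mulVec, hev, hv j (Finset.mem_insert_self _ _)]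
      module
    · intro x hx
      have := h5 x fun i hi => hx i (Finset.mem_insert_of_mem hi)
      rw [mul_smul_comm, smul_mul_assoc, mul_sub, sub_mul, ← mul_assoc,
        hx j (Finset.mem_insert_self _ _), mul_assoc, mul_assoc, this]
    · rw [Finset.card_insert_of_notMem hj, trace_smul, trace_sub, htr, sub_zero, pow_succ, ← h6,
        smul_eq_mul]
      ring

end Projection

section Chiral

open UnitAddTorus MeasureTheory
open Matrix
open scoped Kronecker ComplexOrder MatrixOrder

section chiralDiagonal

variable {κ σ : Type*} [Fintype κ] [DecidableEq κ] [Fintype σ] [DecidableEq σ]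

/-- The operator acting as `a` on the `+1` eigenspace of the involution `X` and as `b` on the
`-1` eigenspace. -/
def chiralDiagonal (X : Matrix σ σ ℂ) (a b : κ → ℝ) : Matrix (κ × σ) (κ × σ) ℂ :=
  diagonal (fun i => (a i : ℂ)) ⊗ₖ ((1 / 2 : ℂ) • (1 + X)) +
    diagonal (fun i => (b i : ℂ)) ⊗ₖ ((1 / 2 : ℂ) • (1 - X))

variable {X : Matrix σ σ ℂ}

omit [Fintype κ] [Fintype σ] in
lemma chiralDiagonal_conjTranspose (hX : Xᴴ = X) (a b : κ → ℝ) :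
    (chiralDiagonal X a b)ᴴ = chiralDiagonal X a b := by
  rw [chiralDiagonal, conjTranspose_add, conjTranspose_kronecker, conjTranspose_kronecker,
    diagonal_conjTranspose, diagonal_conjTranspose, conjTranspose_smul, conjTranspose_smul,
    conjTranspose_add, conjTranspose_sub, hX, conjTranspose_one]
  have h (a : κ → ℝ) : star (fun i => (a i : ℂ)) = fun i => (a i : ℂ) :=
    funext fun i => Complex.conj_ofReal _
  rw [h, h, show star (1 / 2 : ℂ) = 1 / 2 by simp]

lemma chiralDiagonal_mul (hX : X * X = 1) (a b a' b' : κ → ℝ) :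
    chiralDiagonal X a b * chiralDiagonal X a' b' = chiralDiagonal X (a * a') (b * b') := by
  have h1 : ((1 / 2 : ℂ) • (1 + X)) * ((1 / 2 : ℂ) • (1 + X)) = (1 / 2 : ℂ) • (1 + X) := by
    rw [smul_mul_smul_comm, add_mul, mul_add, mul_add, hX, mul_one, mul_one, one_mul]
    module
  have h2 : ((1 / 2 : ℂ) • (1 - X)) * ((1 / 2 : ℂ) • (1 - X)) = (1 / 2 : ℂ) • (1 - X) := by
    rw [smul_mul_smul_comm, sub_mul, mul_sub, mul_sub, hX, mul_one, mul_one, one_mul]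
    module
  have h3 : ((1 / 2 : ℂ) • (1 + X)) * ((1 / 2 : ℂ) • (1 - X)) = 0 := by
    rw [smul_mul_smul_comm, add_mul, mul_sub, mul_sub, hX, mul_one, mul_one, one_mul]
    module
  have h4 : ((1 / 2 : ℂ) • (1 - X)) * ((1 / 2 : ℂ) • (1 + X)) = 0 := by
    rw [smul_mul_smul_comm, sub_mul, mul_add, mul_add, hX, mul_one, mul_one, one_mul]
    module
  simp only [chiralDiagonal, add_mul, mul_add, ← mul_kronecker_mul, h1, h2, h3, h4,
    diagonal_mul_diagonal, kronecker_zero, add_zero, zero_add, Pi.mul_apply, Complex.ofReal_mul]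

omit [Fintype κ] [Fintype σ] in
lemma chiralDiagonal_one : chiralDiagonal X (1 : κ → ℝ) 1 = 1 := by
  simp only [chiralDiagonal, Pi.one_apply, Complex.ofReal_one, diagonal_one, ← kronecker_add]
  rw [← smul_add, show (1 : Matrix σ σ ℂ) + X + (1 - X) = (2 : ℂ) • 1 by module, smul_smul]
  norm_num

omit [Fintype κ] [Fintype σ] in
lemma chiralDiagonal_sub (a b a' b' : κ → ℝ) :
    chiralDiagonal X a b - chiralDiagonal X a' b' = chiralDiagonal X (a - a') (b - b') := by
  simp only [chiralDiagonal, Pi.sub_apply, Complex.ofReal_sub, ← diagonal_sub]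
  simp only [sub_eq_add_neg, add_kronecker, neg_kronecker]
  module

omit [Fintype κ] [Fintype σ] in
lemma chiralDiagonal_smul (c : ℝ) (a b : κ → ℝ) :
    (c : ℂ) • chiralDiagonal X a b = chiralDiagonal X (c • a) (c • b) := by
  simp only [chiralDiagonal, smul_add, ← smul_kronecker, ← diagonal_smul, Pi.smul_apply,
    smul_eq_mul, Complex.ofReal_mul]
  rfl

lemma chiralDiagonal_nonneg (hX : Xᴴ = X) (hX' : X * X = 1) {a b : κ → ℝ} (ha : 0 ≤ a)
    (hb : 0 ≤ b) : 0 ≤ chiralDiagonal X a b :=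
  add_nonneg
    ((PosSemidef.diagonal fun i => Complex.zero_le_real.mpr (ha i)).kronecker
      (half_one_add_nonneg hX hX').posSemidef).nonneg
    ((PosSemidef.diagonal fun i => Complex.zero_le_real.mpr (hb i)).kronecker
      (half_one_sub_nonneg hX hX').posSemidef).nonneg

omit [Fintype κ] [Fintype σ] in
lemma eq_chiralDiagonal (a b : κ → ℝ) :
    diagonal (fun i => (a i : ℂ)) ⊗ₖ (1 : Matrix σ σ ℂ) + diagonal (fun i => (b i : ℂ)) ⊗ₖ X =
      chiralDiagonal X (a + b) (a - b) := by
  simp only [chiralDiagonal, Pi.add_apply, Pi.sub_apply, Complex.ofReal_sub, Complex.ofReal_add,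
    ← diagonal_sub, ← diagonal_add]
  simp only [sub_eq_add_neg, add_kronecker, neg_kronecker, kronecker_smul, kronecker_add,
    kronecker_neg]
  module

end chiralDiagonal

/-- The eigenvalues of `numOp`. -/
def level (ρ : ℕ) (i : Fin (2 * ρ + 1)) : ℝ := (i : ℕ) - ρ

lemma numOp_eq_diagonal (ρ : ℕ) : numOp ρ = diagonal fun i => (level ρ i : ℂ) := by
  rw [numOp]
  congr
  ext i
  simp [level]

lemma level_mem (ρ : ℕ) (i : Fin (2 * ρ + 1)) : -(ρ : ℝ) ≤ level ρ i ∧ level ρ i ≤ ρ := by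
  have h : ((i : ℕ) : ℝ) ≤ 2 * ρ := by exact_mod_cast Nat.lt_succ_iff.mp i.2
  rw [level]
  constructor
  · linarith [(Nat.cast_nonneg i : (0 : ℝ) ≤ ((i : ℕ) : ℝ))]
  · linarith

lemma level_eq_or (ρ : ℕ) (i : Fin (2 * ρ + 1)) : level ρ i = -ρ ∨ 1 - (ρ : ℝ) ≤ level ρ i := by
  rcases Nat.eq_zero_or_pos (i : ℕ) with h | h
  · left
    simp [level, h]
  · right
    have : (1 : ℝ) ≤ (i : ℕ) := by exact_mod_cast h
    rw [level]
    linarith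

lemma level_eq_or' (ρ : ℕ) (i : Fin (2 * ρ + 1)) : level ρ i = ρ ∨ level ρ i ≤ ρ - 1 := by
  rcases Nat.lt_or_ge (i : ℕ) (2 * ρ) with h | h
  · right
    have : ((i : ℕ) : ℝ) + 1 ≤ 2 * ρ := by exact_mod_cast h
    rw [level]
    linarith
  · left
    have : (i : ℕ) = 2 * ρ := by omega
    rw [level, this]
    push_cast
    ring

/-- The eigenvalues of the squared site operator on the two chiral sectors. -/
def gapPos (ρ : ℕ) : Fin (2 * ρ + 1) → ℝ := fun i => (ρ + level ρ i) * (ρ - level ρ i + 1)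

/-- See `gapPos`. -/
def gapNeg (ρ : ℕ) : Fin (2 * ρ + 1) → ℝ := fun i => (ρ - level ρ i) * (ρ + level ρ i + 1)

/-- Indicator of the levels other than the lowest one. -/
def offBot (ρ : ℕ) : Fin (2 * ρ + 1) → ℝ := fun i => if level ρ i = -ρ then 0 else 1

/-- Indicator of the levels other than the highest one. -/
def offTop (ρ : ℕ) : Fin (2 * ρ + 1) → ℝ := fun i => if level ρ i = ρ then 0 else 1

lemma gapPos_mul (ρ : ℕ) : gapPos ρ * (1 - offBot ρ) = 0 := by
  ext i
  simp only [gapPos, offBot, Pi.mul_apply, Pi.sub_apply, Pi.one_apply, Pi.zero_apply]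
  split_ifs with h <;> simp [h]

lemma gapNeg_mul (ρ : ℕ) : gapNeg ρ * (1 - offTop ρ) = 0 := by
  ext i
  simp only [gapNeg, offTop, Pi.mul_apply, Pi.sub_apply, Pi.one_apply, Pi.zero_apply]
  split_ifs with h <;> simp [h]

lemma smul_offBot_le (ρ : ℕ) : (2 * ρ : ℝ) • offBot ρ ≤ gapPos ρ := by
  intro i
  have h := level_mem ρ i
  simp only [gapPos, offBot, Pi.smul_apply, smul_eq_mul]
  split_ifs with hi
  · simp [hi]
  · have := (level_eq_or ρ i).resolve_left hi
    nlinarith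

lemma smul_offTop_le (ρ : ℕ) : (2 * ρ : ℝ) • offTop ρ ≤ gapNeg ρ := by
  intro i
  have h := level_mem ρ i
  simp only [gapNeg, offTop, Pi.smul_apply, smul_eq_mul]
  split_ifs with hi
  · simp [hi]
  · have := (level_eq_or' ρ i).resolve_left hi
    nlinarith

end Chiral

section Site

open UnitAddTorus MeasureTheory
open Matrix
open scoped Kronecker ComplexOrder MatrixOrder

variable {ρ : ℕ} {lam : ℝ} {σ : Type*} [Fintype σ] [DecidableEq σ]

section site

variable {C S : Matrix (Fin (2 * ρ + 1)) (Fin (2 * ρ + 1)) ℂ} {P R G : Matrix σ σ ℂ}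

/-- The projection onto the range of the site operator `C ⊗ₖ P + S ⊗ₖ R`. -/
def siteProj (ρ : ℕ) (P R : Matrix σ σ ℂ) :
    Matrix (Fin (2 * ρ + 1) × σ) (Fin (2 * ρ + 1) × σ) ℂ :=
  chiralDiagonal (Complex.I • (P * R)) (offBot ρ) (offTop ρ)

lemma IsSu2.kronecker_eq (h : IsSu2 lam (numOp ρ) S C) (hl : lam ^ 2 = ρ * (ρ + 1)) :
    (C * C + S * S) ⊗ₖ (1 : Matrix σ σ ℂ) + (C * S - S * C) ⊗ₖ (P * R) =
      chiralDiagonal (Complex.I • (P * R)) (gapPos ρ) (gapNeg ρ) := by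
  have h1 : C * C + S * S = (lam : ℂ) ^ 2 • 1 - numOp ρ * numOp ρ := by
    rw [← h.casimir]
    abel
  have h2 : C * S - S * C = Complex.I • numOp ρ := by
    rw [← neg_sub, h.SC, neg_neg]
  have h3 : (lam : ℂ) ^ 2 • 1 - numOp ρ * numOp ρ =
      diagonal fun i => ((lam ^ 2 - level ρ i ^ 2 : ℝ) : ℂ) := by
    rw [← Complex.ofReal_pow, smul_one_eq_diagonal_ofReal, numOp_mul_self, diagonal_sub]
    congr
    ext i
    rw [level]
    push_cast
    rfl
  rw [h1, h2, h3, smul_kronecker, ← kronecker_smul, numOp_eq_diagonal,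
    eq_chiralDiagonal (fun i => lam ^ 2 - level ρ i ^ 2) (level ρ)]
  congr 1 <;> ext i <;> simp only [gapPos, gapNeg, Pi.add_apply, Pi.sub_apply, hl] <;> ring

variable (hP : P * P = 1) (hR : R * R = 1) (hPR : P * R + R * P = 0)

include hP hR hPR in
lemma IsSu2.site_sq (h : IsSu2 lam (numOp ρ) S C) (hl : lam ^ 2 = ρ * (ρ + 1)) :
    (C ⊗ₖ P + S ⊗ₖ R) * (C ⊗ₖ P + S ⊗ₖ R) =
      chiralDiagonal (Complex.I • (P * R)) (gapPos ρ) (gapNeg ρ) := by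
  rw [← h.kronecker_eq hl, ← kronecker_mul_kronecker_add hPR, add_mul, mul_add, mul_add,
    ← mul_kronecker_mul C C, ← mul_kronecker_mul S S, hP, hR, add_kronecker]
  abel

variable (hPH : Pᴴ = P) (hRH : Rᴴ = R)

include hP hR hPR hPH hRH in
/-- A Hermitian square root of the site operator's square is supported on `siteProj`. -/
lemma mul_siteProj {q : Matrix (Fin (2 * ρ + 1) × σ) (Fin (2 * ρ + 1) × σ) ℂ} (hq : qᴴ = q)
    (hqq : q * q = chiralDiagonal (Complex.I • (P * R)) (gapPos ρ) (gapNeg ρ)) :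
    q * siteProj ρ P R = q := by
  have hX := conjTranspose_I_smul_mul hPH hRH hPR
  have hXX := I_smul_mul_sq hP hR hPR
  have h1 : q * (1 - siteProj ρ P R) = 0 := by
    rw [← conjTranspose_mul_self_eq_zero, conjTranspose_mul, hq, siteProj, ← chiralDiagonal_one,
      chiralDiagonal_sub, chiralDiagonal_conjTranspose hX, mul_assoc, ← mul_assoc q, hqq,
      chiralDiagonal_mul hXX, gapPos_mul, gapNeg_mul, chiralDiagonal_mul hXX, mul_zero, mul_zero]
    simp [chiralDiagonal]
  rw [mul_sub, mul_one, sub_eq_zero] at h1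
  exact h1.symm

include hP hR hPR hPH hRH in
lemma siteProj_le {b : Matrix (Fin (2 * ρ + 1) × σ) (Fin (2 * ρ + 1) × σ) ℂ} (hb : bᴴ = b)
    (hbb : b * b = chiralDiagonal (Complex.I • (P * R)) (gapPos ρ) (gapNeg ρ)) (hρ : 2 ≤ ρ)
    {τ : ℝ} (h0 : 0 ≤ τ) (h1 : τ ≤ 1) : siteProj ρ P R ≤ b * b - (τ : ℂ) • b := by
  have hX := conjTranspose_I_smul_mul hPH hRH hPR
  have hXX := I_smul_mul_sq hP hR hPR
  have e0 : (siteProj ρ P R)ᴴ = siteProj ρ P R := chiralDiagonal_conjTranspose hX _ _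
  have e1 : b * siteProj ρ P R = b := mul_siteProj hP hR hPR hPH hRH hb hbb
  have e2 : siteProj ρ P R * b = b := by
    have := congrArg conjTranspose e1
    rwa [conjTranspose_mul, e0, hb] at this
  have e3 : siteProj ρ P R * siteProj ρ P R = siteProj ρ P R := by
    rw [siteProj, chiralDiagonal_mul hXX]
    congr 1 <;> ext i <;> simp [offBot, offTop]
  have e4 : 0 ≤ b * b - (2 * ρ : ℂ) • siteProj ρ P R := by
    have e5 : (2 * ρ : ℂ) = ((2 * ρ : ℝ) : ℂ) := by push_cast; rfl
    rw [hbb, siteProj, e5, chiralDiagonal_smul, chiralDiagonal_sub]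
    exact chiralDiagonal_nonneg hX hXX (sub_nonneg.mpr (smul_offBot_le ρ))
      (sub_nonneg.mpr (smul_offTop_le ρ))
  have e6 : 0 ≤ (b - (τ : ℂ) • siteProj ρ P R) * (b - (τ : ℂ) • siteProj ρ P R) := by
    refine nonneg_of_isHermitian_sq ?_
    rw [conjTranspose_sub, conjTranspose_smul, hb, e0]
    simp
  have e7 : 0 ≤ siteProj ρ P R := by
    rw [← e3]
    exact nonneg_of_isHermitian_sq e0
  have e8 : 0 ≤ (ρ - 1 - τ ^ 2 / 2 : ℝ) := by
    have : (2 : ℝ) ≤ ρ := by exact_mod_cast hρ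
    nlinarith
  have half : (0 : ℂ) ≤ 1 / 2 := by
    rw [show (1 / 2 : ℂ) = ((1 / 2 : ℝ) : ℂ) by simp]
    exact Complex.zero_le_real.mpr (by norm_num)
  rw [← sub_nonneg]
  have key : b * b - (τ : ℂ) • b - siteProj ρ P R =
      (1 / 2 : ℂ) • (b * b - (2 * ρ : ℂ) • siteProj ρ P R) +
      (1 / 2 : ℂ) • ((b - (τ : ℂ) • siteProj ρ P R) * (b - (τ : ℂ) • siteProj ρ P R)) +
      ((ρ - 1 - τ ^ 2 / 2 : ℝ) : ℂ) • siteProj ρ P R := by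
    simp only [sub_mul, mul_sub, smul_mul_assoc, mul_smul_comm, e1, e2, e3]
    push_cast
    module
  rw [key]
  exact add_nonneg (add_nonneg (e4.posSemidef.smul half).nonneg (e6.posSemidef.smul half).nonneg)
    (e7.posSemidef.smul (Complex.zero_le_real.mpr e8)).nonneg

variable (hG : G * G = 1) (hGH : Gᴴ = G) (hPG : P * G + G * P = 0) (hRG : R * G + G * R = 0)

include hP hR hPR hPH hRH hG hGH hPG hRG in
lemma IsSu2.siteProj_le (h : IsSu2 lam (numOp ρ) S C) (hl : lam ^ 2 = ρ * (ρ + 1)) (hρ : 2 ≤ ρ)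
    {τ : ℝ} (h0 : 0 ≤ τ) (h1 : τ ≤ 1) :
    siteProj ρ P R ≤ (C ⊗ₖ P + S ⊗ₖ R) * (C ⊗ₖ P + S ⊗ₖ R) - (τ : ℂ) • ((1 ⊗ₖ G) *
      ((numOp ρ ⊗ₖ 1) * (C ⊗ₖ P + S ⊗ₖ R) - (C ⊗ₖ P + S ⊗ₖ R) * (numOp ρ ⊗ₖ 1))) := by
  have e1 : (1 ⊗ₖ G) * ((numOp ρ ⊗ₖ 1) * (C ⊗ₖ P + S ⊗ₖ R) -
      (C ⊗ₖ P + S ⊗ₖ R) * (numOp ρ ⊗ₖ 1)) =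
      Complex.I • (S ⊗ₖ (G * P)) - Complex.I • (C ⊗ₖ (G * R)) := by
    have e2 : (numOp ρ ⊗ₖ 1) * (C ⊗ₖ P + S ⊗ₖ R) - (C ⊗ₖ P + S ⊗ₖ R) * (numOp ρ ⊗ₖ 1) =
        (numOp ρ * C - C * numOp ρ) ⊗ₖ P + (numOp ρ * S - S * numOp ρ) ⊗ₖ R := by
      simp only [mul_add, add_mul, ← mul_kronecker_mul, one_mul, mul_one, sub_eq_add_neg,
        add_kronecker, neg_kronecker]
      abel
    rw [e2, h.KC, h.KS, mul_add, neg_kronecker, mul_neg, smul_kronecker, smul_kronecker,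
      mul_smul_comm, mul_smul_comm, ← mul_kronecker_mul, ← mul_kronecker_mul, one_mul, one_mul,
      sub_eq_add_neg]
  have hPG' : P * G = -(G * P) := eq_neg_of_add_eq_zero_left hPG
  have hRG' : R * G = -(G * R) := eq_neg_of_add_eq_zero_left hRG
  have hRP' : R * P = -(P * R) := eq_neg_of_add_eq_zero_right hPR
  have g (X Y : Matrix σ σ ℂ) (hX : X * G = -(G * X)) : G * X * (G * Y) = -(X * Y) := by
    rw [mul_assoc, ← mul_assoc X, hX, neg_mul, mul_neg, mul_assoc G X, ← mul_assoc G, hG, one_mul]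
  rw [e1, h.site_sq hP hR hPR hl]
  set b := Complex.I • (S ⊗ₖ (G * P)) - Complex.I • (C ⊗ₖ (G * R)) with hb
  have hbH : bᴴ = b := by
    rw [hb, conjTranspose_sub, conjTranspose_smul, conjTranspose_smul, conjTranspose_kronecker,
      conjTranspose_kronecker, conjTranspose_mul, conjTranspose_mul, hPH, hRH, hGH, h.hS, h.hC,
      hPG', hRG', kronecker_neg, kronecker_neg, Complex.star_def, Complex.conj_I]
    module
  have hbb : b * b = chiralDiagonal (Complex.I • (P * R)) (gapPos ρ) (gapNeg ρ) := by
    rw [← h.kronecker_eq hl, hb, sub_mul, mul_sub, mul_sub]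
    simp only [smul_mul_smul_comm, Complex.I_mul_I, ← mul_kronecker_mul, g _ _ hPG', g _ _ hRG', hP,
      hR, hRP', kronecker_neg, sub_eq_add_neg, add_kronecker, neg_kronecker]
    module
  rw [← hbb]
  exact Lowpass.siteProj_le hP hR hPR hPH hRH hbH hbb hρ h0 h1

end site

end Site

section Corner

open UnitAddTorus MeasureTheory
open Matrix
open scoped Kronecker ComplexOrder MatrixOrder

variable {ρ : ℕ} {lam : ℝ} {σ : Type*} [Fintype σ] [DecidableEq σ]
  {C S : Matrix (Fin (2 * ρ + 1)) (Fin (2 * ρ + 1)) ℂ}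
  {A B : Fin 5 → Matrix σ σ ℂ} {G : Matrix σ σ ℂ} {e : Matrix σ σ ℂ}

lemma level_eq_iff (i : Fin (2 * ρ + 1)) : level ρ i = ρ ↔ i = Fin.last _ := by
  rw [level, Fin.ext_iff, Fin.val_last, sub_eq_iff_eq_add, ← two_mul]
  exact_mod_cast Iff.rfl

omit [DecidableEq σ] in
lemma diagonal_kronecker_mulVec_apply {α : Type*} [Fintype α] [DecidableEq α] (d : α → ℂ)
    (P : Matrix σ σ ℂ) (v : α × σ → ℂ) (k : α) :
    (fun s => ((diagonal d ⊗ₖ P) *ᵥ v) (k, s)) = d k • (P *ᵥ fun s => v (k, s)) := by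
  ext s
  simp only [mulVec, dotProduct, Fintype.sum_prod_type, kroneckerMap_apply, diagonal_apply,
    Pi.smul_apply, smul_eq_mul, Finset.mul_sum]
  rw [Finset.sum_eq_single_of_mem k (Finset.mem_univ k)]
  · simp [mul_assoc]
  · intro b _ hb
    simp [hb.symm]

/-- The projection onto the kernel vector sitting at the top corner of the box. -/
def cornerProj (ρ : ℕ) (e : Matrix σ σ ℂ) :
    Matrix ((Fin 5 → Fin (2 * ρ + 1)) × σ) ((Fin 5 → Fin (2 * ρ + 1)) × σ) ℂ :=
  diagonal (fun k => if k = fun _ => Fin.last _ then (1 : ℂ) else 0) ⊗ₖ e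

/-- The many-body Dirac part. -/
def diracPart (C S : Matrix (Fin (2 * ρ + 1)) (Fin (2 * ρ + 1)) ℂ) (A B : Fin 5 → Matrix σ σ ℂ) :
    Matrix ((Fin 5 → Fin (2 * ρ + 1)) × σ) ((Fin 5 → Fin (2 * ρ + 1)) × σ) ℂ :=
  ∑ j, slot j (C ⊗ₖ A j + S ⊗ₖ B j)

/-- The diagonal mass term. -/
def massPart (σ : Type*) [Fintype σ] [DecidableEq σ] (ρ : ℕ) (lam : ℝ) :
    Matrix ((Fin 5 → Fin (2 * ρ + 1)) × σ) ((Fin 5 → Fin (2 * ρ + 1)) × σ) ℂ :=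
  diagonal (fun k => ((4 * lam - ∑ j, level ρ (k j) : ℝ) : ℂ)) ⊗ₖ (1 : Matrix σ σ ℂ)

lemma massPart_eq : massPart σ ρ lam = (4 * lam : ℂ) • 1 -
    ∑ j, slot j (numOp ρ ⊗ₖ (1 : Matrix σ σ ℂ)) := by
  rw [massPart, numOp_eq_diagonal]
  simp only [slot_diagonal]
  rw [← one_kronecker_one, ← smul_kronecker, smul_one_eq_diagonal]
  ext p q
  by_cases h : p.1 = q.1
  · simp [Matrix.sum_apply, Matrix.sub_apply, kroneckerMap_apply, h, sub_mul, Finset.sum_mul]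
  · simp [Matrix.sum_apply, Matrix.sub_apply, kroneckerMap_apply, h]

lemma assemble_eq_diracPart_add : assemble lam C S (-numOp ρ) A B G =
    diracPart C S A B + (1 ⊗ₖ G) * massPart σ ρ lam := by
  have h1 (j : Fin 5) : slot j ((-numOp ρ) ⊗ₖ G) =
      -((1 ⊗ₖ G) * slot j (numOp ρ ⊗ₖ (1 : Matrix σ σ ℂ))) := by
    rw [neg_kronecker, map_neg, slot_kronecker, (slot_commute_kronecker j (numOp ρ) G).eq]
  simp only [assemble, map_add _ (_ + _) (_ ⊗ₖ _), h1, Finset.sum_add_distrib, massPart_eq, mul_sub,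
    mul_smul_comm, mul_one, Finset.mul_sum, Finset.sum_neg_distrib, diracPart]
  abel

lemma diracPart_conjTranspose (hF : IsFrame A B G) (hC : Cᴴ = C) (hS : Sᴴ = S) :
    (diracPart C S A B)ᴴ = diracPart C S A B := by
  simp only [diracPart, conjTranspose_sum, slot_conjTranspose, conjTranspose_add,
    conjTranspose_kronecker, hC, hS, hF.hA.herm, hF.hB.herm]

lemma diracPart_sq (hF : IsFrame A B G) : diracPart C S A B * diracPart C S A B =
    ∑ j, slot j ((C ⊗ₖ A j + S ⊗ₖ B j) * (C ⊗ₖ A j + S ⊗ₖ B j)) := by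
  simp only [map_mul]
  exact sum_sq_of_anticommute _ _ fun i _ j _ hij => hF.slot_anticommute C S hij

lemma diracPart_anticommute (hF : IsFrame A B G) :
    diracPart C S A B * (1 ⊗ₖ G) + (1 ⊗ₖ G) * diracPart C S A B = 0 := by
  rw [diracPart, Finset.sum_mul, Finset.mul_sum, ← Finset.sum_add_distrib]
  exact Finset.sum_eq_zero fun j _ => hF.slot_anticommute_kronecker C S j

lemma massPart_commutator : massPart σ ρ lam * diracPart C S A B -
    diracPart C S A B * massPart σ ρ lam = -∑ j, slot j ((numOp ρ ⊗ₖ 1) *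
      (C ⊗ₖ A j + S ⊗ₖ B j) - (C ⊗ₖ A j + S ⊗ₖ B j) * (numOp ρ ⊗ₖ 1)) := by
  have h := sum_commutator (fun j => slot j (numOp ρ ⊗ₖ (1 : Matrix σ σ ℂ)))
    (fun j => slot j (C ⊗ₖ A j + S ⊗ₖ B j)) fun i j hij => by
      simp only [map_add, mul_add, add_mul]
      rw [slot_commute' hij _ C (P := 1) (R := A j) (by rw [one_mul, mul_one]),
        slot_commute' hij _ S (P := 1) (R := B j) (by rw [one_mul, mul_one])]
  simp only [map_sub, map_mul, ← h, massPart_eq, diracPart]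
  rw [sub_mul, mul_sub, smul_one_mul, mul_smul_one]
  abel

lemma massPart_conjTranspose : (massPart σ ρ lam)ᴴ = massPart σ ρ lam := by
  rw [massPart, conjTranspose_kronecker, diagonal_conjTranspose, conjTranspose_one]
  congr
  ext k
  exact Complex.conj_ofReal _

lemma slot_siteProj (j : Fin 5) (P R : Matrix σ σ ℂ) : slot j (siteProj ρ P R) =
    diagonal (fun k : Fin 5 → Fin (2 * ρ + 1) => (offBot ρ (k j) : ℂ)) ⊗ₖ
      ((1 / 2 : ℂ) • (1 + Complex.I • (P * R))) +
    diagonal (fun k => (offTop ρ (k j) : ℂ)) ⊗ₖ ((1 / 2 : ℂ) • (1 - Complex.I • (P * R))) := by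
  rw [siteProj, chiralDiagonal, map_add, slot_diagonal, slot_diagonal]

section corner

variable (he : eᴴ = e) (hee : e * e = e) (hχe : ∀ j, (Complex.I • (A j * B j)) * e = -e)
  (hev : ∀ v : σ → ℂ, (∀ j, (Complex.I • (A j * B j)) *ᵥ v = -v) → e *ᵥ v = v)
  (heG : G * e = e * G)

include he in
omit [Fintype σ] [DecidableEq σ] in
lemma cornerProj_conjTranspose : (cornerProj ρ e)ᴴ = cornerProj ρ e := by
  rw [cornerProj, conjTranspose_kronecker, diagonal_conjTranspose, he]
  congr
  ext k
  simp [apply_ite]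

include hee in
omit [DecidableEq σ] in
lemma cornerProj_sq : cornerProj ρ e * cornerProj ρ e = cornerProj ρ e := by
  rw [cornerProj, ← mul_kronecker_mul, diagonal_mul_diagonal, hee]
  congr
  ext k
  simp

include hχe in
lemma slot_siteProj_mul_cornerProj (j : Fin 5) :
    slot j (siteProj ρ (A j) (B j)) * cornerProj ρ e = 0 := by
  have h1 : ((1 / 2 : ℂ) • (1 + Complex.I • (A j * B j))) * e = 0 := by
    rw [smul_mul_assoc, add_mul, hχe, one_mul, add_neg_cancel, smul_zero]
  have h2 : (diagonal fun k : Fin 5 → Fin (2 * ρ + 1) => (offTop ρ (k j) : ℂ) *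
      if k = fun _ => Fin.last _ then (1 : ℂ) else 0) = 0 := by
    rw [← diagonal_zero]
    congr
    ext k
    split_ifs with h
    · simp [h, offTop, level_eq_iff]
    · simp
  rw [slot_siteProj, cornerProj, add_mul, ← mul_kronecker_mul, ← mul_kronecker_mul, h1,
    diagonal_mul_diagonal, diagonal_mul_diagonal, h2, kronecker_zero, zero_kronecker, add_zero]

include hχe in
lemma diracPart_mul_cornerProj (hF : IsFrame A B G) (h : IsSu2 lam (numOp ρ) S C)
    (hl : lam ^ 2 = ρ * (ρ + 1)) : diracPart C S A B * cornerProj ρ e = 0 := by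
  rw [diracPart, Finset.sum_mul]
  refine Finset.sum_eq_zero fun j _ => ?_
  have hq : (C ⊗ₖ A j + S ⊗ₖ B j)ᴴ = C ⊗ₖ A j + S ⊗ₖ B j := by
    rw [conjTranspose_add, conjTranspose_kronecker, conjTranspose_kronecker, h.hC, h.hS,
      hF.hA.herm, hF.hB.herm]
  rw [← mul_siteProj (hF.hA.sq j) (hF.hB.sq j) (hF.AB j j) (hF.hA.herm j) (hF.hB.herm j) hq
    (h.site_sq (hF.hA.sq j) (hF.hB.sq j) (hF.AB j j) hl), map_mul, mul_assoc,
    slot_siteProj_mul_cornerProj hχe, mul_zero]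

include he hχe in
lemma cornerProj_mul_diracPart (hF : IsFrame A B G) (h : IsSu2 lam (numOp ρ) S C)
    (hl : lam ^ 2 = ρ * (ρ + 1)) : cornerProj ρ e * diracPart C S A B = 0 := by
  have := congrArg conjTranspose (diracPart_mul_cornerProj hχe hF h hl)
  rwa [conjTranspose_mul, cornerProj_conjTranspose he, diracPart_conjTranspose hF h.hC h.hS,
    conjTranspose_zero] at this

end corner

end Corner

section Deformation

open UnitAddTorus MeasureTheory
open Matrix
open scoped Kronecker ComplexOrder MatrixOrder

variable {ρ : ℕ} {lam : ℝ} {σ : Type*} [Fintype σ] [DecidableEq σ]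
  {C S : Matrix (Fin (2 * ρ + 1)) (Fin (2 * ρ + 1)) ℂ}
  {A B : Fin 5 → Matrix σ σ ℂ} {G : Matrix σ σ ℂ} {e : Matrix σ σ ℂ}

lemma mulVec_eq_zero_of_le {ι : Type*} [Fintype ι] {L N : Matrix ι ι ℂ} (hN : 0 ≤ N)
    (hle : N ≤ L * L) {v : ι → ℂ} (hv : L *ᵥ v = 0) : N *ᵥ v = 0 := by
  have h1 := (le_iff.mp hle).dotProduct_mulVec_nonneg v
  have h2 := hN.posSemidef.dotProduct_mulVec_nonneg v
  rw [sub_mulVec, ← mulVec_mulVec, hv, mulVec_zero, zero_sub, dotProduct_neg] at h1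
  exact (hN.posSemidef.dotProduct_mulVec_zero_iff v).mp (le_antisymm (neg_nonneg.mp h1) h2)

/-- The deformation of the mass term into a reflection that is trivial off the corner. -/
def massPath (lam : ℝ) (ρ : ℕ) (e : Matrix σ σ ℂ) (s : ℝ) :
    Matrix ((Fin 5 → Fin (2 * ρ + 1)) × σ) ((Fin 5 → Fin (2 * ρ + 1)) × σ) ℂ :=
  ((1 - s : ℝ) : ℂ) • massPart σ ρ lam + (s : ℂ) • (1 - (2 : ℂ) • cornerProj ρ e)

variable (he : eᴴ = e) (hee : e * e = e) (hχe : ∀ j, (Complex.I • (A j * B j)) * e = -e)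
  (hev : ∀ v : σ → ℂ, (∀ j, (Complex.I • (A j * B j)) *ᵥ v = -v) → e *ᵥ v = v)
  (heG : G * e = e * G)

include he in
lemma massPath_conjTranspose (s : ℝ) : (massPath lam ρ e s)ᴴ = massPath lam ρ e s := by
  simp only [massPath, conjTranspose_add, conjTranspose_smul, conjTranspose_sub, conjTranspose_one,
    massPart_conjTranspose, cornerProj_conjTranspose he, Complex.star_def, Complex.conj_ofReal,
    map_ofNat]

include heG in
lemma massPath_commute (s : ℝ) :
    massPath lam ρ e s * (1 ⊗ₖ G) = (1 ⊗ₖ G) * massPath lam ρ e s := by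
  have h1 : massPart σ ρ lam * (1 ⊗ₖ G) = (1 ⊗ₖ G) * massPart σ ρ lam := by
    rw [massPart, ← mul_kronecker_mul, ← mul_kronecker_mul, one_mul, mul_one, one_mul, mul_one]
  have h2 : cornerProj ρ e * (1 ⊗ₖ G) = (1 ⊗ₖ G) * cornerProj ρ e := by
    rw [cornerProj, ← mul_kronecker_mul, ← mul_kronecker_mul, one_mul, mul_one, heG]
  simp only [massPath, add_mul, mul_add, smul_mul_assoc, mul_smul_comm, sub_mul, mul_sub, h1, h2,
    one_mul, mul_one]

include he heG in
lemma massPath_isHermitian (hF : IsFrame A B G) (hC : Cᴴ = C) (hS : Sᴴ = S) (s : ℝ) :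
    (diracPart C S A B + (1 ⊗ₖ G) * massPath lam ρ e s).IsHermitian := by
  rw [IsHermitian, conjTranspose_add, diracPart_conjTranspose hF hC hS, conjTranspose_mul,
    massPath_conjTranspose he, conjTranspose_kronecker, conjTranspose_one, hF.herm,
    massPath_commute heG]

include he hχe in
lemma massPath_commutator (hF : IsFrame A B G) (h : IsSu2 lam (numOp ρ) S C)
    (hl : lam ^ 2 = ρ * (ρ + 1)) (s : ℝ) : massPath lam ρ e s * diracPart C S A B -
    diracPart C S A B * massPath lam ρ e s = -(((1 - s : ℝ) : ℂ) • ∑ j, slot j ((numOp ρ ⊗ₖ 1) *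
      (C ⊗ₖ A j + S ⊗ₖ B j) - (C ⊗ₖ A j + S ⊗ₖ B j) * (numOp ρ ⊗ₖ 1))) := by
  rw [← smul_neg, ← massPart_commutator (lam := lam)]
  simp only [massPath, add_mul, mul_add, smul_mul_assoc, mul_smul_comm, sub_mul, mul_sub,
    diracPart_mul_cornerProj hχe hF h hl, cornerProj_mul_diracPart he hχe hF h hl, one_mul, mul_one]
  module

include he hχe heG in
lemma le_massPath_sq (hF : IsFrame A B G) (h : IsSu2 lam (numOp ρ) S C)
    (hl : lam ^ 2 = ρ * (ρ + 1)) (hρ : 2 ≤ ρ) {s : ℝ} (hs : s ∈ Set.Icc (0 : ℝ) 1) :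
    ∑ j, slot j (siteProj ρ (A j) (B j)) + massPath lam ρ e s * massPath lam ρ e s ≤
      (diracPart C S A B + (1 ⊗ₖ G) * massPath lam ρ e s) *
        (diracPart C S A B + (1 ⊗ₖ G) * massPath lam ρ e s) := by
  have hg : ((1 : Matrix (Fin 5 → Fin (2 * ρ + 1)) (Fin 5 → Fin (2 * ρ + 1)) ℂ) ⊗ₖ G) * (1 ⊗ₖ G) =
      1 := by
    rw [← mul_kronecker_mul, one_mul, hF.sq, one_kronecker_one]
  rw [sq_add_mul hg (diracPart_anticommute hF) (massPath_commute heG s),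
    massPath_commutator he hχe hF h hl, diracPart_sq hF, mul_neg, mul_smul_comm, Finset.mul_sum,
    add_right_comm, ← sub_eq_add_neg, Finset.smul_sum, ← Finset.sum_sub_distrib]
  gcongr with j
  rw [← slot_one_kronecker j, ← map_mul, ← map_smul, ← map_sub, ← sub_nonneg, ← map_sub]
  exact (slot_posSemidef j (sub_nonneg.mpr (h.siteProj_le (hF.hA.sq j) (hF.hB.sq j) (hF.AB j j)
    (hF.hA.herm j) (hF.hB.herm j) hF.sq hF.herm (hF.AG j) (hF.BG j) hl hρ
    (sub_nonneg.mpr hs.2) (sub_le_self _ hs.1))).posSemidef).nonneg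

lemma siteProj_nonneg (hF : IsFrame A B G) (j : Fin 5) : 0 ≤ siteProj ρ (A j) (B j) := by
  refine chiralDiagonal_nonneg
    (conjTranspose_I_smul_mul (hF.hA.herm j) (hF.hB.herm j) (hF.AB j j))
    (I_smul_mul_sq (hF.hA.sq j) (hF.hB.sq j) (hF.AB j j)) (fun i => ?_) fun i => ?_
  · simp only [offBot, Pi.zero_apply]
    split_ifs <;> norm_num
  · simp only [offTop, Pi.zero_apply]
    split_ifs <;> norm_num

/-- The block of a vector killed by the site projection lives on an extreme level and has the
corresponding chirality. -/
lemma block_of_siteProj_mulVec {P R : Matrix σ σ ℂ}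
    (hXX : (Complex.I • (P * R)) * (Complex.I • (P * R)) = 1) {j : Fin 5}
    {v : (Fin 5 → Fin (2 * ρ + 1)) × σ → ℂ} (hv : slot j (siteProj ρ P R) *ᵥ v = 0)
    (k : Fin 5 → Fin (2 * ρ + 1)) (hk : (fun s => v (k, s)) ≠ 0) :
    (level ρ (k j) = ρ ∨ level ρ (k j) = -ρ) ∧
      (level ρ (k j) = ρ → 0 < ρ →
        (Complex.I • (P * R)) *ᵥ (fun s => v (k, s)) = -fun s => v (k, s)) := by
  set X := Complex.I • (P * R) with hX
  set u := fun s => v (k, s) with hu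
  have h1 : (offBot ρ (k j) : ℂ) • (((1 / 2 : ℂ) • (1 + X)) *ᵥ u) +
      (offTop ρ (k j) : ℂ) • (((1 / 2 : ℂ) • (1 - X)) *ᵥ u) = 0 := by
    rw [slot_siteProj, add_mulVec, ← hX] at hv
    have h2 := diagonal_kronecker_mulVec_apply (fun k => (offBot ρ (k j) : ℂ))
      ((1 / 2 : ℂ) • (1 + X)) v k
    have h3 := diagonal_kronecker_mulVec_apply (fun k => (offTop ρ (k j) : ℂ))
      ((1 / 2 : ℂ) • (1 - X)) v k
    rw [← h2, ← h3]
    ext s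
    exact congrFun hv (k, s)
  have h2 : X *ᵥ (X *ᵥ u) = u := by rw [mulVec_mulVec, hXX, one_mulVec]
  simp only [smul_mulVec, add_mulVec, sub_mulVec, one_mulVec] at h1
  by_cases ht : level ρ (k j) = ρ
  · refine ⟨Or.inl ht, fun _ hρ => ?_⟩
    have hb : level ρ (k j) ≠ -ρ := by
      rw [ht]
      have : (0 : ℝ) < ρ := by exact_mod_cast hρ
      linarith
    rw [offBot, offTop, if_neg hb, if_pos ht] at h1
    have h3 : u + X *ᵥ u = 0 := by
      have := congrArg ((2 : ℂ) • ·) h1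
      simpa [smul_smul] using this
    exact eq_neg_of_add_eq_zero_right h3
  · refine ⟨Or.inr ?_, fun h => absurd h ht⟩
    by_contra hb
    rw [offBot, offTop, if_neg hb, if_neg ht] at h1
    refine hk ?_
    rw [← h1]
    push_cast
    module

lemma sum_level_le (k : Fin 5 → Fin (2 * ρ + 1)) (hk : ∀ j, level ρ (k j) = ρ ∨ level ρ (k j) = -ρ)
    (hne : ¬ ∀ j, level ρ (k j) = ρ) : ∑ j, level ρ (k j) ≤ 3 * ρ := by
  push Not at hne
  obtain ⟨i, hi⟩ := hne
  rw [← Finset.add_sum_erase _ _ (Finset.mem_univ i), (hk i).resolve_left hi]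
  have h1 := Finset.sum_le_card_nsmul (Finset.univ.erase i) (fun j => level ρ (k j)) (ρ : ℝ)
    fun j _ => (level_mem ρ (k j)).2
  rw [Finset.card_erase_of_mem (Finset.mem_univ i), nsmul_eq_mul, Finset.card_univ,
    Fintype.card_fin] at h1
  norm_num only at h1
  linarith

include he hχe hev heG in
lemma massPath_det_ne_zero (hF : IsFrame A B G) (h : IsSu2 lam (numOp ρ) S C)
    (hl : lam ^ 2 = ρ * (ρ + 1)) (hlam : 0 < lam) (hρ : 2 ≤ ρ) {s : ℝ}
    (hs : s ∈ Set.Icc (0 : ℝ) 1) :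
    (diracPart C S A B + (1 ⊗ₖ G) * massPath lam ρ e s).det ≠ 0 := by
  intro h0
  obtain ⟨v, hv0, hv⟩ := exists_mulVec_eq_zero_iff.mpr h0
  have hle := le_massPath_sq he hχe heG hF h hl hρ hs
  have hH := massPath_isHermitian (lam := lam) he heG hF h.hC h.hS s
  have hN (j : Fin 5) : 0 ≤ slot j (siteProj ρ (A j) (B j)) :=
    (slot_posSemidef j (siteProj_nonneg hF j).posSemidef).nonneg
  have hM : 0 ≤ massPath lam ρ e s * massPath lam ρ e s :=
    nonneg_of_isHermitian_sq (massPath_conjTranspose he s)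
  have h1 (j : Fin 5) : slot j (siteProj ρ (A j) (B j)) *ᵥ v = 0 := by
    refine mulVec_eq_zero_of_le (hN j) (le_trans ?_ hle) hv
    exact (Finset.single_le_sum (f := fun j => slot j (siteProj ρ (A j) (B j))) (fun i _ => hN i)
      (Finset.mem_univ j)).trans (le_add_of_nonneg_right hM)
  have h2 : massPath lam ρ e s *ᵥ v = 0 := by
    have h3 := mulVec_eq_zero_of_le hM
      (le_trans (le_add_of_nonneg_left (Finset.sum_nonneg fun j _ => hN j)) hle) hv
    rwa [← conjTranspose_mul_self_mulVec_eq_zero, massPath_conjTranspose he]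
  refine hv0 (funext fun ⟨k, i⟩ => ?_)
  suffices hk : (fun s => v (k, s)) = 0 from congrFun hk i
  by_contra hk
  have hext := fun j => block_of_siteProj_mulVec
    (I_smul_mul_sq (hF.hA.sq j) (hF.hB.sq j) (hF.AB j j)) (h1 j) k hk
  have h3 : ((1 - s : ℝ) : ℂ) • (((4 * lam - ∑ j, level ρ (k j) : ℝ) : ℂ) • fun s => v (k, s)) +
      (s : ℂ) • ((fun s => v (k, s)) - (2 : ℂ) • ((if k = fun _ => Fin.last _ then (1 : ℂ) else 0) •
        (e *ᵥ fun s => v (k, s)))) = 0 := by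
    have h4 := diagonal_kronecker_mulVec_apply
      (fun k => ((4 * lam - ∑ j, level ρ (k j) : ℝ) : ℂ)) (1 : Matrix σ σ ℂ) v k
    have h5 := diagonal_kronecker_mulVec_apply
      (fun k => if k = fun _ => Fin.last (2 * ρ) then (1 : ℂ) else 0) e v k
    rw [one_mulVec] at h4
    rw [← h4, ← h5]
    ext s'
    have := congrFun h2 (k, s')
    simp only [massPath, add_mulVec, smul_mulVec, sub_mulVec, one_mulVec] at this
    exact this
  have hρ' : (2 : ℝ) ≤ ρ := by exact_mod_cast hρ
  obtain ⟨c, hc, hcv⟩ : ∃ c : ℝ, c ≠ 0 ∧ (c : ℂ) • (fun s => v (k, s)) = 0 := by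
    by_cases htop : k = fun _ => Fin.last (2 * ρ)
    · have hlev (j : Fin 5) : level ρ (k j) = ρ := by rw [htop, level_eq_iff]
      have hev' := hev _ fun j => (hext j).2 (hlev j) (by omega)
      rw [if_pos htop, one_smul, hev'] at h3
      refine ⟨(1 - s) * (4 * lam - ∑ j, level ρ (k j)) - s, ?_, ?_⟩
      · simp only [hlev, Finset.sum_const, Finset.card_univ, Fintype.card_fin, nsmul_eq_mul]
        have hneg : 4 * lam < 5 * ρ := by nlinarith
        have : (1 - s) * (4 * lam - (5 : ℕ) * ρ) - s < 0 := by
          push_cast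
          rcases hs.2.eq_or_lt with hs1 | hs1
          · rw [hs1]
            norm_num
          · nlinarith [hs.1, mul_pos (sub_pos.mpr hs1) (sub_pos.mpr hneg)]
        exact this.ne
      · rw [← h3]
        push_cast
        module
    · rw [if_neg htop, zero_smul, smul_zero, sub_zero] at h3
      refine ⟨(1 - s) * (4 * lam - ∑ j, level ρ (k j)) + s, ?_, ?_⟩
      · have hsum := sum_level_le k (fun j => (hext j).1) fun hall =>
          htop (funext fun j => (level_eq_iff _).mp (hall j))
        have hpos : 0 < 4 * lam - ∑ j, level ρ (k j) := by nlinarith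
        have : 0 < (1 - s) * (4 * lam - ∑ j, level ρ (k j)) + s := by
          rcases hs.1.eq_or_lt with hs1 | hs1
          · rw [← hs1]
            linarith
          · nlinarith [mul_nonneg (sub_nonneg.mpr hs.2) hpos.le]
        exact this.ne'
      · rw [← h3]
        push_cast
        module
  exact hk ((smul_eq_zero.mp hcv).resolve_left (by exact_mod_cast hc))

end Deformation

section Sign

open UnitAddTorus MeasureTheory
open Matrix
open scoped Kronecker ComplexOrder MatrixOrder

section sign

variable {ρ : ℕ} {lam : ℝ} {σ : Type*} [Fintype σ] [DecidableEq σ]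
  {C S : Matrix (Fin (2 * ρ + 1)) (Fin (2 * ρ + 1)) ℂ}
  {A B : Fin 5 → Matrix σ σ ℂ} {G : Matrix σ σ ℂ} {e : Matrix σ σ ℂ}

lemma det_diracPart_add_pos (hF : IsFrame A B G) (hC : Cᴴ = C) (hS : Sᴴ = S) (hG : G.det = 1) :
    0 < (diracPart C S A B + (1 ⊗ₖ G)).det.re := by
  set Q := diracPart C S A B with hQ
  have hQH : Qᴴ = Q := diracPart_conjTranspose hF hC hS
  have hgH : ((1 : Matrix (Fin 5 → Fin (2 * ρ + 1)) (Fin 5 → Fin (2 * ρ + 1)) ℂ) ⊗ₖ G)ᴴ =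
      1 ⊗ₖ G := by
    rw [conjTranspose_kronecker, conjTranspose_one, hF.herm]
  have hg : ((1 : Matrix (Fin 5 → Fin (2 * ρ + 1)) (Fin 5 → Fin (2 * ρ + 1)) ℂ) ⊗ₖ G) * (1 ⊗ₖ G) =
      1 := by
    rw [← mul_kronecker_mul, one_mul, hF.sq, one_kronecker_one]
  have hH (r : ℝ) : ((r : ℂ) • Q + (1 ⊗ₖ G)).IsHermitian := by
    rw [IsHermitian, conjTranspose_add, conjTranspose_smul, hQH, hgH, Complex.star_def,
      Complex.conj_ofReal]
  have h := det_mul_det_pos_of_path (L := fun r : ℝ => (r : ℂ) • Q + (1 ⊗ₖ G))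
    (by fun_prop) (fun r _ => hH r) fun r _ => by
      refine isUnit_of_smul_one_le_sq (c := 1) one_pos ?_
      have h1 : ((r : ℂ) • Q + (1 ⊗ₖ G)) * ((r : ℂ) • Q + (1 ⊗ₖ G)) =
          ((r : ℂ) • Q) * ((r : ℂ) • Q) + 1 := by
        have h2 := diracPart_anticommute (C := C) (S := S) hF
        rw [← hQ] at h2
        rw [add_mul, mul_add, mul_add, hg, smul_mul_assoc _ _ (1 ⊗ₖ G), mul_smul_comm _ (1 ⊗ₖ G),
          eq_neg_of_add_eq_zero_left h2, smul_neg]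
        abel
      rw [h1, Complex.ofReal_one, one_smul]
      refine le_add_of_nonneg_left (nonneg_of_isHermitian_sq ?_)
      rw [conjTranspose_smul, hQH, Complex.star_def, Complex.conj_ofReal]
  simpa [det_kronecker, hG] using h

/-- The deformed assembled matrix has an odd number of negative eigenvalues. -/
lemma IsSu2.det_assemble_neg (h : IsSu2 lam (numOp ρ) S C) (hF : IsFrame A B G)
    (hl : lam ^ 2 = ρ * (ρ + 1)) (hlam : 0 < lam) (hρ : 2 ≤ ρ) (hG : G.det = 1)
    (hσ : Fintype.card σ = 32) : (assemble lam C S (-numOp ρ) A B G).det.re < 0 := by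
  have hcomm (i j : Fin 5) (hij : i ≠ j) : A i * (Complex.I • (A j * B j)) =
      Complex.I • (A j * B j) * A i := by
    rw [mul_smul_comm, smul_mul_assoc, ← mul_assoc, eq_neg_of_add_eq_zero_left (hF.hA.anti i j hij),
      neg_mul, mul_assoc, eq_neg_of_add_eq_zero_left (hF.AB i j), mul_neg, neg_neg, mul_assoc]
  have hcomm' (i j : Fin 5) (hij : i ≠ j) : B i * (Complex.I • (A j * B j)) =
      Complex.I • (A j * B j) * B i := by
    rw [mul_smul_comm, smul_mul_assoc, ← mul_assoc, eq_neg_of_add_eq_zero_right (hF.AB j i),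
      neg_mul, mul_assoc, eq_neg_of_add_eq_zero_left (hF.hB.anti i j hij), mul_neg, neg_neg,
      mul_assoc]
  obtain ⟨e, he, hee, hχe, hev, hec, htr⟩ := exists_joint_projection (A := A)
    (χ := fun j => Complex.I • (A j * B j))
    (fun j => conjTranspose_I_smul_mul (hF.hA.herm j) (hF.hB.herm j) (hF.AB j j))
    (fun j => I_smul_mul_sq (hF.hA.sq j) (hF.hB.sq j) (hF.AB j j))
    (fun i j => by
      rcases eq_or_ne i j with rfl | hij
      · rfl
      · rw [smul_mul_assoc, mul_assoc, hcomm' i j hij, ← mul_assoc, hcomm i j hij, mul_assoc,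
          ← mul_smul_comm])
    (fun j => hF.hA.sq j)
    (fun j => by
      rw [mul_smul_comm, smul_mul_assoc, ← smul_neg, mul_assoc (A j) (B j),
        eq_neg_of_add_eq_zero_right (hF.AB j j), mul_neg, neg_neg])
    hcomm Finset.univ
  have heG : G * e = e * G := hec G fun j _ => by
    rw [mul_smul_comm, smul_mul_assoc, ← mul_assoc, eq_neg_of_add_eq_zero_right (hF.AG j),
      neg_mul, mul_assoc, eq_neg_of_add_eq_zero_right (hF.BG j), mul_neg, neg_neg, mul_assoc]
  have htr' : e.trace = 1 := by
    rw [Finset.card_univ, Fintype.card_fin, hσ] at htr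
    push_cast at htr
    linear_combination htr / 32
  have hχe' (j : Fin 5) := hχe j (Finset.mem_univ j)
  have hev' (v : σ → ℂ) (hv : ∀ j, (Complex.I • (A j * B j)) *ᵥ v = -v) := hev v fun j _ => hv j
  have hpath := det_mul_det_pos_of_path
    (L := fun s => diracPart C S A B + (1 ⊗ₖ G) * massPath lam ρ e s)
    (by unfold massPath; fun_prop)
    (fun s _ => massPath_isHermitian he heG hF h.hC h.hS s)
    fun s hs => massPath_det_ne_zero he hχe' hev' heG hF h hl hlam hρ hs
  have e0 : massPath lam ρ e 0 = massPart σ ρ lam := by simp [massPath]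
  have e1 : massPath lam ρ e 1 = 1 - (2 : ℂ) • cornerProj ρ e := by simp [massPath]
  have e2 : diracPart C S A B + (1 ⊗ₖ G) * (1 - (2 : ℂ) • cornerProj ρ e) =
      (diracPart C S A B + (1 ⊗ₖ G)) * (1 - (2 : ℂ) • cornerProj ρ e) := by
    rw [add_mul, mul_sub (diracPart C S A B), mul_smul_comm, diracPart_mul_cornerProj hχe' hF h hl,
      smul_zero, mul_one, sub_zero]
  have e3 : (1 - (2 : ℂ) • cornerProj ρ e).det = -1 := by
    refine det_eq_neg_one_of_trace ?_ ?_ ?_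
    · rw [IsHermitian, conjTranspose_sub, conjTranspose_smul, cornerProj_conjTranspose he,
        conjTranspose_one, Complex.star_def, map_ofNat]
    · rw [sub_mul, mul_sub, mul_sub, smul_mul_smul_comm, cornerProj_sq hee, mul_one, one_mul,
        mul_one]
      module
    · rw [trace_sub, trace_one, trace_smul, cornerProj, trace_kronecker, htr', trace_diagonal]
      simp
  simp only [e0, e1, e2, det_mul, e3, mul_neg, mul_one, Complex.neg_re] at hpath
  rw [assemble_eq_diracPart_add]
  exact neg_of_mul_neg_left (neg_pos.mp hpath) (det_diracPart_add_pos hF h.hC h.hS hG).le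

end sign

lemma det_cliff_poleVec : (cliff poleVec).det = 1 := by
  rw [cliff_apply]
  refine det_offDiag ?_
  rw [bordered_mul_conjTranspose, poleVec_unit, one_smul]

lemma locDet_hFun_neg {lam : ℝ} {ρ : ℕ} (hlam : 15 < lam) (hρ : lam ≤ ρ) :
    locDet ρ lam (bordered hFun) < 0 := by
  have hρ' : (2 : ℝ) ≤ ρ := by linarith
  have h1 := locDet_hFun_mul_pos hlam hρ
  have h2 := IsSu2.det_assemble_neg (isSu2_path_one (ρ := ρ) (lam := lam)) isFrame_cliff
    (by rw [sq_scale (by simp)]; ring)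
    (by linarith [le_scale (ρ := ρ) (lam := lam) (t := 1) (by simp) (by linarith) hρ])
    (by exact_mod_cast hρ') det_cliff_poleVec (by simp [Fintype.card_prod])
  exact neg_of_mul_pos_left h1 h2.le

lemma not_evPos_hFun : ¬ EvPos fun lam ρ => locDet ρ lam (bordered hFun) := by
  intro h
  obtain ⟨lam, h1, hlam⟩ := (h.and (Filter.eventually_gt_atTop (15 : ℝ))).exists
  obtain ⟨ρ, h2, hρ⟩ := (h1.and (Filter.eventually_ge_atTop ⌈lam⌉₊)).exists
  exact absurd h2 (locDet_hFun_neg hlam (Nat.ceil_le.mp hρ)).not_gt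

end Sign

section Interpolation

open UnitAddTorus MeasureTheory
open Matrix

/-- The character `exp (2 π i x_0)`. -/
def char0 : CT where
  toFun x := (AddCircle.toCircle (x 0) : ℂ)
  continuous_toFun := by fun_prop

/-- A primitive cube root of unity. -/
def cubeRoot : ℂ := AddCircle.toCircle ((-(1 / 3) : ℝ) : AddCircle (1 : ℝ))

lemma cubeRoot_pow_three : cubeRoot ^ 3 = 1 := by
  rw [cubeRoot, ← Circle.coe_pow, ← AddCircle.toCircle_nsmul, ← AddCircle.coe_nsmul]
  have h : ((3 • (-(1 / 3)) : ℝ) : AddCircle (1 : ℝ)) = 0 :=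
    AddCircle.coe_eq_zero_iff 1 |>.mpr ⟨-1, by norm_num⟩
  rw [h, AddCircle.toCircle_zero, Circle.coe_one]

lemma cubeRoot_sum : cubeRoot ^ 2 + cubeRoot + 1 = 0 := by
  have h1 : (cubeRoot - 1) * (cubeRoot ^ 2 + cubeRoot + 1) = 0 := by
    linear_combination cubeRoot_pow_three
  refine (mul_eq_zero.mp h1).resolve_left fun h => ?_
  have h2 : AddCircle.toCircle ((-(1 / 3) : ℝ) : AddCircle (1 : ℝ)) =
      AddCircle.toCircle (0 : AddCircle (1 : ℝ)) := by
    rw [AddCircle.toCircle_zero]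
    exact Circle.ext (sub_eq_zero.mp h)
  obtain ⟨n, hn⟩ := (AddCircle.coe_eq_zero_iff 1).mp (AddCircle.injective_toCircle one_ne_zero h2)
  have h3 : (3 * n : ℝ) = -1 := by
    rw [zsmul_eq_mul, mul_one] at hn
    rw [hn]
    norm_num
  have h4 : 3 * n = -1 := by exact_mod_cast h3
  omega

lemma char0_sub_w3 (x : Torus 5) (k : Fin 3) :
    char0 (x - w3 k) = char0 x * cubeRoot ^ (k : ℕ) := by
  have h : (x - w3 k) 0 = x 0 + (k : ℕ) • ((-(1 / 3) : ℝ) : AddCircle (1 : ℝ)) := by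
    rw [Pi.sub_apply, w3, if_pos rfl, ← AddCircle.coe_nsmul, sub_eq_add_neg, ← AddCircle.coe_neg]
    congr 2
    rw [nsmul_eq_mul]
    ring
  simp only [char0, ContinuousMap.coe_mk, h, AddCircle.toCircle_add, AddCircle.toCircle_nsmul,
    Circle.coe_mul, Circle.coe_pow, cubeRoot]

lemma char0_mul_conj (x : Torus 5) : char0 x * conj (char0 x) = 1 := by
  rw [Complex.mul_conj, char0, ContinuousMap.coe_mk, Circle.normSq_coe, Complex.ofReal_one]

lemma conj_cubeRoot : conj cubeRoot = cubeRoot ^ 2 := by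
  have h1 : cubeRoot * conj cubeRoot = 1 := by
    rw [Complex.mul_conj, cubeRoot, Circle.normSq_coe, Complex.ofReal_one]
  linear_combination cubeRoot ^ 2 * h1 - conj cubeRoot * cubeRoot_pow_three

/-- The interpolating filters for the three cosets. -/
def interp (i : Fin 3) : CT :=
  (1 / 3 : ℂ) • (1 + cubeRoot ^ (i : ℕ) • char0 + (cubeRoot ^ (i : ℕ) • char0) ^ 2)

lemma interp_apply (i : Fin 3) (x : Torus 5) : interp i x =
    (1 + cubeRoot ^ (i : ℕ) * char0 x + (cubeRoot ^ (i : ℕ) * char0 x) ^ 2) / 3 := by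
  simp only [interp, ContinuousMap.smul_apply, ContinuousMap.add_apply, ContinuousMap.pow_apply,
    ContinuousMap.one_apply, smul_eq_mul]
  ring

lemma interp_orthonormal (i j : Fin 3) (x : Torus 5) :
    ∑ k : Fin 3, conj (interp i (x - w3 k)) * interp j (x - w3 k) = if i = j then 1 else 0 := by
  have h1 := char0_mul_conj x
  have h2 := cubeRoot_sum
  simp only [interp_apply, char0_sub_w3, Fin.sum_univ_three, map_div₀, map_add, map_mul, map_pow,
    map_one, map_ofNat, conj_cubeRoot]
  generalize cubeRoot = c at *
  generalize char0 x = z at *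
  generalize conj z = y at *
  fin_cases i <;> fin_cases j <;> simp <;> grind

lemma interp_zero (i : Fin 3) : interp i 0 = if i = 0 then 1 else 0 := by
  have h : char0 0 = 1 := by simp [char0]
  rw [interp_apply, h]
  have h2 := cubeRoot_sum
  generalize cubeRoot = c at *
  fin_cases i <;> simp <;> grind

end Interpolation

section Cover

open UnitAddTorus MeasureTheory
open Matrix

/-- The quotient map of the torus by the group of the `w3 k`. -/
def cover (x : Torus 5) : Torus 5 := fun i => if i = 0 then 3 • x i else x i

lemma continuous_cover : Continuous cover := by
  refine continuous_pi fun i => ?_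
  unfold cover
  split_ifs <;> fun_prop

lemma three_nsmul_w3 (k : Fin 3) : 3 • w3 k 0 = 0 := by
  rw [w3, if_pos rfl, ← AddCircle.coe_nsmul, AddCircle.coe_eq_zero_iff]
  exact ⟨k, by simp; ring⟩

lemma cover_sub_w3 (x : Torus 5) (k : Fin 3) : cover (x - w3 k) = cover x := by
  ext i
  by_cases h : i = 0
  · simp only [cover, h, if_true, Pi.sub_apply, nsmul_sub, three_nsmul_w3, sub_zero]
  · simp only [cover, if_neg h, Pi.sub_apply, w3, sub_zero]

lemma exists_sub_w3_of_cover_eq {x y : Torus 5} (h : cover x = cover y) :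
    ∃ k, y = x - w3 k := by
  have h0 : 3 • (x 0 - y 0) = 0 := by
    rw [nsmul_sub, sub_eq_zero]
    simpa [cover] using congrFun h 0
  obtain ⟨m, hm, hk⟩ := (AddCircle.nsmul_eq_zero_iff three_pos).mp h0
  refine ⟨⟨m, hm⟩, funext fun i => ?_⟩
  by_cases hi : i = 0
  · subst hi
    rw [Pi.sub_apply, w3, if_pos rfl, eq_sub_iff_add_eq, ← eq_sub_iff_add_eq', ← hk]
    simp
  · have := congrFun h i
    rw [Pi.sub_apply, w3, if_neg hi, sub_zero]
    simpa [cover, hi] using this.symm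

lemma cover_surjective : Function.Surjective cover := by
  intro y
  obtain ⟨t, ht⟩ := QuotientAddGroup.mk_surjective (y 0)
  refine ⟨Function.update y 0 ((t / 3 : ℝ) : AddCircle (1 : ℝ)), funext fun i => ?_⟩
  by_cases hi : i = 0
  · subst hi
    rw [cover, if_pos rfl, Function.update_self, ← AddCircle.coe_nsmul, ← ht]
    congr 1
    rw [nsmul_eq_mul]
    push_cast
    ring
  · rw [cover, if_neg hi, Function.update_of_ne hi]

lemma isQuotientMap_cover : Topology.IsQuotientMap cover :=
  continuous_cover.isClosedMap.isQuotientMap continuous_cover cover_surjective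

lemma w3_add (i j : Fin 3) : w3 (i + j) = w3 i + w3 j := by
  have h : ((1 : ℝ) : AddCircle (1 : ℝ)) = 0 := AddCircle.coe_period 1
  funext l
  by_cases hl : l = 0
  · simp only [w3, hl, if_true, Pi.add_apply]
    rw [← AddCircle.coe_add]
    rcases Nat.lt_or_ge ((i : ℕ) + j) 3 with hij | hij
    · rw [Fin.val_add, Nat.mod_eq_of_lt hij]
      congr 1
      push_cast
      ring
    · have h1 : ((i : ℕ) + j) % 3 + 3 = i + j := by omega
      have h2 : ((((i : ℕ) + j) % 3 : ℕ) : ℝ) + 3 = i + j := by exact_mod_cast h1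
      rw [Fin.val_add, ← add_zero (((((i : ℕ) + j) % 3 : ℕ) / 3 : ℝ) : AddCircle (1 : ℝ)), ← h,
        ← AddCircle.coe_add]
      congr 1
      linarith
  · simp only [w3, if_neg hl, Pi.add_apply, add_zero]

lemma sum_sub_w3 (f : Torus 5 → ℂ) (x : Torus 5) (k : Fin 3) :
    ∑ i, f (x - w3 k - w3 i) = ∑ i, f (x - w3 i) := by
  simp only [sub_sub, ← w3_add]
  exact Fintype.sum_equiv (Equiv.addLeft k) _ _ fun i => rfl

/-- A function invariant under the `w3 k` descends along `cover`. -/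
lemma exists_descent (g : CT) (hg : ∀ x k, g (x - w3 k) = g x) :
    ∃ f : CT, ∀ x, f (cover x) = g x := by
  have hf : Function.FactorsThrough g cover := fun x y hxy => by
    obtain ⟨k, rfl⟩ := exists_sub_w3_of_cover_eq hxy
    exact (hg x k).symm
  refine ⟨Topology.IsQuotientMap.lift (f := ⟨cover, continuous_cover⟩) isQuotientMap_cover g hf,
    fun x => ?_⟩
  exact congrArg (fun f : CT => f x)
    (Topology.IsQuotientMap.lift_comp (f := ⟨cover, continuous_cover⟩) isQuotientMap_cover g hf)

lemma hFun_ne_zero (x : Torus 5) : ∃ i, hFun i x ≠ 0 := by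
  by_contra! h
  have h1 : (fun i => hFun i x) = 0 := funext h
  rw [hFun_apply] at h1
  set z : Fin 5 → ℂ := fun j => mFourier (Pi.single j 1 : Fin 5 → ℤ) x with hz
  have hnorm (j : Fin 5) : (z j).re ^ 2 + (z j).im ^ 2 = 1 := by
    have h2 : z j * conj (z j) = 1 := by
      rw [hz]
      simp only
      rw [star_mFourier_apply, ← mFourier_add, add_neg_cancel, mFourier_zero]
      rfl
    rw [Complex.mul_conj, Complex.normSq_apply] at h2
    have h3 : (z j).re * (z j).re + (z j).im * (z j).im = 1 := by exact_mod_cast h2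
    linarith
  have e0 := congrFun h1 0
  have e1 := congrFun h1 1
  have e2 := congrFun h1 2
  simp [Fin.sum_univ_five, dirVec, poleVec] at e0 e1 e2
  have i0 := congrArg Complex.im e0
  have r0 := congrArg Complex.re e0
  have i1 := congrArg Complex.im e1
  have r1 := congrArg Complex.re e1
  have i2 := congrArg Complex.im e2
  have r2 := congrArg Complex.re e2
  simp at i0 r0 i1 r1 i2 r2
  have hre (j : Fin 5) (h0 : (z j).im = 0) : (z j).re = 1 ∨ (z j).re = -1 := by
    rw [← sq_eq_one_iff, ← hnorm j, h0]
    ring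
  rcases hre 0 i0 with h0 | h0 <;> rcases hre 1 r1 with h1 | h1 <;>
    rcases hre 2 i1 with h2 | h2 <;> rcases hre 3 r2 with h3 | h3 <;>
    rcases hre 4 i2 with h4 | h4 <;> simp only [hz] at h0 h1 h2 h3 h4 <;>
    rw [h0, h1, h2, h3, h4] at r0 <;> norm_num at r0

end Cover

section Filters

open UnitAddTorus MeasureTheory
open Matrix

/-- The norm of the vector field `hFun`. -/
def hNorm (x : Torus 5) : ℝ := √(∑ i, ‖hFun i x‖ ^ 2)

lemma hNorm_pos (x : Torus 5) : 0 < hNorm x := by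
  obtain ⟨i, hi⟩ := hFun_ne_zero x
  exact Real.sqrt_pos.mpr <| Finset.sum_pos' (fun _ _ => by positivity)
    ⟨i, Finset.mem_univ i, by positivity⟩

lemma continuous_hNorm : Continuous hNorm := by
  unfold hNorm
  fun_prop

/-- The normalization of `hFun`. -/
def hUnit (i : Fin 3) : CT where
  toFun x := ((hNorm x)⁻¹ : ℝ) * hFun i x
  continuous_toFun := by
    have h : Continuous fun x => (hNorm x)⁻¹ := continuous_hNorm.inv₀ fun x => (hNorm_pos x).ne'
    exact (Complex.continuous_ofReal.comp h).mul (hFun i).continuous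

lemma hUnit_apply (i : Fin 3) (x : Torus 5) : hUnit i x = ((hNorm x)⁻¹ : ℝ) * hFun i x := rfl

lemma sum_hUnit (x : Torus 5) : ∑ i, hUnit i x * conj (hUnit i x) = 1 := by
  have h1 : ∑ i, ‖hFun i x‖ ^ 2 = hNorm x ^ 2 :=
    (Real.sq_sqrt (Finset.sum_nonneg fun _ _ => by positivity)).symm
  have h2 : ∑ i, ((hNorm x)⁻¹ : ℝ) ^ 2 * ‖hFun i x‖ ^ 2 = 1 := by
    rw [← Finset.mul_sum, h1, inv_pow, inv_mul_cancel₀ (pow_ne_zero 2 (hNorm_pos x).ne')]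
  refine Eq.trans ?_ (congrArg Complex.ofReal h2)
  rw [Complex.ofReal_sum]
  refine Finset.sum_congr rfl fun i _ => ?_
  rw [Complex.mul_conj, Complex.normSq_eq_norm_sq, hUnit_apply, norm_mul, Complex.norm_real,
    mul_pow, Real.norm_eq_abs, sq_abs]

lemma hFun_zero (i : Fin 3) : hFun i 0 = if i = 0 then 9 else 0 := by
  have h := congrFun (hFun_apply 0) i
  simp only [mFourier, ContinuousMap.coe_mk, Pi.zero_apply] at h
  rw [h]
  fin_cases i <;> simp [poleVec]
  norm_num

lemma hUnit_zero_zero : hUnit 0 0 = 1 := by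
  have h : hNorm 0 = 9 := by
    simp [hNorm, hFun_zero, apply_ite]
  rw [hUnit_apply, h, hFun_zero]
  norm_num

/-- The low-pass filter with polyphase components `hUnit`. -/
def lowpass : CT := ∑ i, interp i * (hUnit i).comp ⟨cover, continuous_cover⟩

lemma lowpass_apply (x : Torus 5) : lowpass x = ∑ i, interp i x * hUnit i (cover x) := by
  simp [lowpass, ContinuousMap.sum_apply]

lemma lowpass_zero : lowpass 0 = 1 := by
  have h : cover 0 = 0 := by
    funext i
    simp [cover]
  simp [lowpass_apply, interp_zero, h, hUnit_zero_zero]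

lemma sum_conj_interp_mul_lowpass (i : Fin 3) (x : Torus 5) :
    ∑ k, conj (interp i (x - w3 k)) * lowpass (x - w3 k) = hUnit i (cover x) := by
  simp only [lowpass_apply, cover_sub_w3, Finset.mul_sum]
  rw [Finset.sum_comm]
  simp only [← mul_assoc, ← Finset.sum_mul, interp_orthonormal, ite_mul, one_mul, zero_mul]
  simp

lemma sum_lowpass (x : Torus 5) :
    ∑ k, lowpass (x - w3 k) * conj (lowpass (x - w3 k)) = 1 := by
  have h (k : Fin 3) : conj (lowpass (x - w3 k)) =
      ∑ i, conj (interp i (x - w3 k)) * conj (hUnit i (cover x)) := by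
    simp only [lowpass_apply, cover_sub_w3, map_sum, map_mul]
  simp only [h, Finset.mul_sum]
  rw [Finset.sum_comm, ← sum_hUnit (cover x)]
  refine Finset.sum_congr rfl fun i _ => ?_
  rw [← sum_conj_interp_mul_lowpass i x, Finset.sum_mul]
  refine Finset.sum_congr rfl fun k _ => ?_
  rw [sum_conj_interp_mul_lowpass]
  ring

/-- The polyphase components of a function. -/
def polyphase (f : CT) (i : Fin 3) : CT where
  toFun x := ∑ k, conj (interp i (x - w3 k)) * f (x - w3 k)
  continuous_toFun := by fun_prop

lemma exists_polyphase (f : CT) (i : Fin 3) :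
    ∃ g : CT, ∀ x, g (cover x) = ∑ k, conj (interp i (x - w3 k)) * f (x - w3 k) :=
  exists_descent (polyphase f i) fun x k => sum_sub_w3 (fun y => conj (interp i y) * f y) x k

/-- The low-pass filter has no pair of high-pass filters. -/
lemma not_exists_highpass (H : Fin 3 → CT) (hH0 : H 0 = lowpass)
    (hH : ∀ (j k : Fin 3) (x : Torus 5),
      ∑ i, H j (x - w3 i) * conj (H k (x - w3 i)) = if j = k then (1 : ℂ) else 0) : False := by
  choose M hM using fun i j => exists_polyphase (H j) i
  refine not_evPos_hFun (evPos_of_column (M := of M) ?_ hFun_ne_zero fun x => ?_)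
  · ext i j y
    obtain ⟨x, rfl⟩ := cover_surjective y
    let U : Matrix (Fin 3) (Fin 3) ℂ := of fun k i => interp i (x - w3 k)
    let V : Matrix (Fin 3) (Fin 3) ℂ := of fun k j => H j (x - w3 k)
    have hU : Uᴴ * U = 1 := by
      ext i j
      simpa [U, mul_apply, one_apply] using interp_orthonormal i j x
    have hV : Vᴴ * V = 1 := by
      ext i j
      simp only [V, mul_apply, one_apply, conjTranspose_apply, of_apply, RCLike.star_def]
      simp only [eq_comm (a := i), ← hH j i x]
      exact Finset.sum_congr rfl fun k _ => mul_comm _ _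
    have hN (i j : Fin 3) : M i j (cover x) = (Uᴴ * V) i j := by
      simp [hM, U, V, mul_apply]
    have key : (Uᴴ * V) * (Uᴴ * V)ᴴ = 1 := by
      rw [conjTranspose_mul, conjTranspose_conjTranspose, mul_assoc, ← mul_assoc V,
        mul_eq_one_comm.mp hV, one_mul, hU]
    have h1 : (of M * (of M)ᴴ) i j (cover x) = ((Uᴴ * V) * (Uᴴ * V)ᴴ) i j := by
      rw [mul_apply, mul_apply, ContinuousMap.sum_apply]
      simp only [ContinuousMap.mul_apply, conjTranspose_apply, of_apply, ContinuousMap.star_apply,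
        hN]
    rw [h1, key, one_apply, one_apply]
    split_ifs <;> rfl
  · obtain ⟨y, rfl⟩ := cover_surjective x
    refine ⟨(hNorm (cover y))⁻¹, inv_pos.mpr (hNorm_pos _), fun i => ?_⟩
    rw [of_apply, hM, hH0, sum_conj_interp_mul_lowpass, hUnit_apply]

end Filters

end Lowpass

/-- There is a normalized continuous low-pass filter `h_0` on `𝕋^5` (for the order-3
subgroup `F = {w_0, w_1, w_2}`: `h_0(0) = 1` and `∑_k |h_0(x − w_k)|² = 1`) which admits
NO corresponding pair of continuous high-pass filters `h_1, h_2`; i.e. there are no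
continuous `h_1, h_2` with `⟨h_j, h_k⟩ = δ_{jk}` for `0 ≤ j, k ≤ 2`. Thus the condition
`2q − 1 > n` is sharp for `n = 5`, `q = 3`. -/
theorem exists_lowpass_without_highpass :
    ∃ h0 : C(Torus 5, ℂ), h0 0 = 1 ∧
      (∀ x : Torus 5, ∑ k : Fin 3, h0 (x - w3 k) * conj (h0 (x - w3 k)) = 1) ∧
      ¬ ∃ h1 h2 : C(Torus 5, ℂ),
          ∀ (j k : Fin 3) (x : Torus 5),
            ∑ i : Fin 3, ![h0, h1, h2] j (x - w3 i) * conj (![h0, h1, h2] k (x - w3 i)) =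
              if j = k then (1 : ℂ) else 0 :=
  ⟨Lowpass.lowpass, Lowpass.lowpass_zero, Lowpass.sum_lowpass,
    fun ⟨_, _, h⟩ => Lowpass.not_exists_highpass _ rfl h⟩
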